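/- Let M be an integral projective variety of dimension n over an algebraically closed field of arbitrary characteristic, and let L and R be line bundles on M with L very ample. Fix a linear subspace V ⊆ H^0(L) such that the associated map j : M → ℙ^{dim V − 1} is an embedding whose image is not very strange. Fix an integer k ≤ min{h^0(R), dim V − n − 2}. Let W ⊆ H^0(L ⊗ R) be the image of the multiplication map V ⊗ H^0(R) → H^0(L ⊗ R), and let X ⊂ ℙ^r, r = dim W − 1, be the embedding of M induced by W. Then σ_k(X) has dimension kn + k − 1 and a general q ∈ σ_k(X) has exactly one decomposition: #S(q,X) = 1. -/

import Mathlib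

noncomputable section

namespace ContactLoci

variable {K : Type*} [Field K] {ι : Type*} [Fintype ι]

/-- Projective space over `K` with homogeneous coordinates indexed by `ι`. -/
abbrev PP (K : Type*) [Field K] (ι : Type*) : Type _ :=
  Projectivization K (ι → K)

/-- The affine cone over a set of projective points. -/
def coneOf (S : Set (PP K ι)) : Set (ι → K) :=
  ⋃ x ∈ S, (x.submodule : Set (ι → K))

/-- The linear span, in the underlying vector space, of the cone over `S`. -/
def vspan (S : Set (PP K ι)) : Submodule K (ι → K) :=
  Submodule.span K (coneOf S)

/-- The projective linear span of a set of projective points. -/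
def projSpan (S : Set (PP K ι)) : Set (PP K ι) :=
  {x | x.submodule ≤ vspan S}

/-- The projective dimension of the linear span of `S` (`-1` for `S = ∅`). -/
def projDim (S : Set (PP K ι)) : ℤ :=
  (Module.finrank K (vspan S) : ℤ) - 1

/-- A set of projective points is non-degenerate if its linear span is everything. -/
def Nondegenerate (S : Set (PP K ι)) : Prop :=
  vspan S = ⊤

/-- The common zero locus in projective space of a set of polynomials. -/
def zeroLocus (S : Set (MvPolynomial ι K)) : Set (PP K ι) :=
  {x | ∀ f ∈ S, ∀ v ∈ x.submodule, MvPolynomial.eval v f = 0}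

/-- Zariski-closed subsets of projective space: common zero loci of sets of
homogeneous polynomials. -/
def IsZClosed (X : Set (PP K ι)) : Prop :=
  ∃ S : Set (MvPolynomial ι K), (∀ f ∈ S, ∃ d : ℕ, f.IsHomogeneous d) ∧ X = zeroLocus S

/-- Zariski closure. -/
def zclosure (S : Set (PP K ι)) : Set (PP K ι) :=
  ⋂₀ {Y | IsZClosed Y ∧ S ⊆ Y}

/-- Irreducibility with respect to the Zariski topology. -/
def IsZIrreducible (S : Set (PP K ι)) : Prop :=
  S.Nonempty ∧ ∀ Y Z : Set (PP K ι), IsZClosed Y → IsZClosed Z → S ⊆ Y ∪ Z → S ⊆ Y ∨ S ⊆ Z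

/-- An integral projective variety: a Zariski-closed irreducible subset. -/
def IsIntegralVariety (X : Set (PP K ι)) : Prop :=
  IsZClosed X ∧ IsZIrreducible X

/-- `C` is an irreducible component of `S`: a maximal irreducible subset of `S`. -/
def IsZIrredComponent (S C : Set (PP K ι)) : Prop :=
  IsZIrreducible C ∧ C ⊆ S ∧ ∀ D : Set (PP K ι), IsZIrreducible D → D ⊆ S → C ⊆ D → C = D

/-- The dimension of a set: the Krull dimension of the poset of irreducible
Zariski-closed subsets of its Zariski closure (`⊥` for the empty set). -/
def zdim (S : Set (PP K ι)) : WithBot ℕ∞ :=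
  Order.krullDim ({Y : Set (PP K ι) // IsZClosed Y ∧ IsZIrreducible Y ∧ Y ⊆ zclosure S})

/-- A property holds at a general point of `X`: it holds away from a proper
Zariski-closed subset. -/
def HoldsGenerically (X : Set (PP K ι)) (P : PP K ι → Prop) : Prop :=
  ∃ Y : Set (PP K ι), IsZClosed Y ∧ ¬X ⊆ Y ∧ ∀ x ∈ X \ Y, P x

/-- Zero locus of multihomogeneous polynomials in a self-product of projective space. -/
def multiZeroLocus {m : ℕ} (S : Set (MvPolynomial (Fin m × ι) K)) :
    Set (Fin m → PP K ι) :=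
  {u | ∀ f ∈ S, ∀ v : Fin m → ι → K, (∀ i, v i ∈ (u i).submodule) →
    MvPolynomial.eval (fun p => v p.1 p.2) f = 0}

/-- Zariski-closed subsets of the `m`-fold self-product of projective space. -/
def IsMultiZClosed {m : ℕ} (T : Set (Fin m → PP K ι)) : Prop :=
  ∃ S : Set (MvPolynomial (Fin m × ι) K),
    (∀ f ∈ S, ∀ i : Fin m, ∃ d : ℕ,
      MvPolynomial.IsWeightedHomogeneous (fun p : Fin m × ι => if p.1 = i then 1 else 0) f d) ∧
    T = multiZeroLocus S

/-- A property holds for a general `m`-tuple of points of `X`. -/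
def HoldsForGeneralTuples (X : Set (PP K ι)) (m : ℕ) (P : (Fin m → PP K ι) → Prop) : Prop :=
  ∃ T : Set (Fin m → PP K ι), IsMultiZClosed T ∧
    (∃ u : Fin m → PP K ι, (∀ i, u i ∈ X) ∧ u ∉ T) ∧
    ∀ u : Fin m → PP K ι, (∀ i, u i ∈ X) → u ∉ T → P u

/-- The homogeneous vanishing ideal of `X` (as a set of homogeneous polynomials). -/
def homogVanishingIdeal (X : Set (PP K ι)) : Set (MvPolynomial ι K) :=
  {f | (∃ d : ℕ, f.IsHomogeneous d) ∧ ∀ x ∈ X, ∀ v ∈ x.submodule, MvPolynomial.eval v f = 0}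

/-- The embedded (projective) tangent space of `X` at `x`. -/
def embTangentSpace (X : Set (PP K ι)) (x : PP K ι) : Set (PP K ι) :=
  {y | ∀ f ∈ homogVanishingIdeal X,
    ∑ i : ι, y.rep i * MvPolynomial.eval x.rep (MvPolynomial.pderiv i f) = 0}

/-- Smooth points of `X`. -/
def IsSmoothPoint (X : Set (PP K ι)) (x : PP K ι) : Prop :=
  x ∈ X ∧ zdim (embTangentSpace X x) = zdim X

/-- `M_A`: the linear span of the tangent spaces of `X` at the points of `A`. -/
def tangentSpan (X A : Set (PP K ι)) : Set (PP K ι) :=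
  projSpan (⋃ a ∈ A, embTangentSpace X a)

/-- The locus of smooth points of `X` at which `M_A` is tangent to `X`. -/
def tangencyLocus (X A : Set (PP K ι)) : Set (PP K ι) :=
  {x | IsSmoothPoint X x ∧ embTangentSpace X x ⊆ tangentSpan X A}

/-- The tangential contact locus of `X` at `A`: the closure of the union of the
irreducible components of the tangency locus meeting `A`. -/
def contactLocus (X A : Set (PP K ι)) : Set (PP K ι) :=
  zclosure (⋃ C ∈ {C : Set (PP K ι) |
    IsZIrredComponent (tangencyLocus X A) C ∧ (C ∩ A).Nonempty}, C)

/-- `X` is weakly `k`-defective: the tangential contact locus at `k` general points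
has positive dimension. -/
def WeaklyDefective (X : Set (PP K ι)) (k : ℕ) : Prop :=
  HoldsForGeneralTuples X k fun u => 0 < zdim (contactLocus X (Set.range u))

/-- The `k`-th secant variety of `X`. -/
def secant (k : ℕ) (X : Set (PP K ι)) : Set (PP K ι) :=
  zclosure {q | ∃ S : Finset (PP K ι), ↑S ⊆ X ∧ S.card = k ∧ q ∈ projSpan (S : Set (PP K ι))}

/-- The `X`-rank of a point. -/
def xrank (X : Set (PP K ι)) (q : PP K ι) : ℕ :=
  sInf {k | ∃ S : Finset (PP K ι), ↑S ⊆ X ∧ S.card = k ∧ q ∈ projSpan (S : Set (PP K ι))}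

/-- `𝒮(q,X)`: the set of minimal `X`-decompositions of `q`. -/
def decompositions (X : Set (PP K ι)) (q : PP K ι) : Set (Finset (PP K ι)) :=
  {S | ↑S ⊆ X ∧ S.card = xrank X q ∧ q ∈ projSpan (S : Set (PP K ι))}

/-- `X` is `k`-identifiable: a general point of `σ_k(X)` has a unique minimal
decomposition. -/
def Identifiable (X : Set (PP K ι)) (k : ℕ) : Prop :=
  HoldsGenerically (secant k X) fun q => ∃! S : Finset (PP K ι), S ∈ decompositions X q

/-- `α` is the `k`-th secant degree of `X`. -/
def HasSecantDegree (X : Set (PP K ι)) (k α : ℕ) : Prop :=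
  HoldsGenerically (secant k X) fun q => (decompositions X q).ncard = α

/-- Projective linear subspaces. -/
def IsProjLinear (L : Set (PP K ι)) : Prop :=
  L = projSpan L

/-- Lines in projective space. -/
def IsLine (L : Set (PP K ι)) : Prop :=
  IsProjLinear L ∧ Module.finrank K (vspan L) = 2

/-- `X` is uniruled by lines: through a general point of `X` there is a line
contained in `X`. -/
def UniruledByLines (X : Set (PP K ι)) : Prop :=
  HoldsGenerically X fun x => ∃ L : Set (PP K ι), IsLine L ∧ x ∈ L ∧ L ⊆ X

/-- The join of two sets in projective space. -/
def join (A B : Set (PP K ι)) : Set (PP K ι) :=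
  zclosure (⋃ a ∈ A, ⋃ b ∈ B, projSpan {a, b})

/-- The linear space `M` is tangent to `X` along `W`. -/
def TangentAlong (M X W : Set (PP K ι)) : Prop :=
  ∀ x ∈ W, IsSmoothPoint X x → embTangentSpace X x ⊆ M

/-- `S` has exactly `m` irreducible components, all of them projective linear
subspaces, and these components are linearly independent. -/
def ComponentsAreIndepLinear (S : Set (PP K ι)) (m : ℕ) : Prop :=
  ∃ C : Fin m → Set (PP K ι), Function.Injective C ∧
    (∀ D : Set (PP K ι), IsZIrredComponent S D ↔ ∃ i, D = C i) ∧
    (∀ i, IsProjLinear (C i)) ∧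
    Module.finrank K (vspan S) = ∑ i, Module.finrank K (vspan (C i))


/-- The Segre variety: the image of `ℙ^{n 1} × ⋯ × ℙ^{n s}` under the Segre
embedding, given by the complete linear system `|O(1,…,1)|`. -/
def segreVariety (K : Type*) [Field K] (s : ℕ) (n : Fin s → ℕ) :
    Set (PP K (∀ i : Fin s, Fin (n i + 1))) :=
  {x | ∃ u : ∀ i : Fin s, Fin (n i + 1) → K,
    x.submodule = Submodule.span K
      ({fun t => ∏ i, u i (t i)} : Set ((∀ i : Fin s, Fin (n i + 1)) → K))}

/-- The projection of `L ⊆ Segre` to the `i`-th factor is a single point, i.e. `L`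
lies in a single fiber of the `i`-th projection. -/
def SegreFactorIsPoint (K : Type*) [Field K] (s : ℕ) (n : Fin s → ℕ) (i : Fin s)
    (L : Set (PP K (∀ j : Fin s, Fin (n j + 1)))) : Prop :=
  ∃ w : Fin (n i + 1) → K, w ≠ 0 ∧ ∀ x ∈ L,
    ∃ u : ∀ j : Fin s, Fin (n j + 1) → K,
      x.submodule = Submodule.span K
        ({fun t => ∏ j, u j (t j)} : Set ((∀ j : Fin s, Fin (n j + 1)) → K)) ∧
      u i ∈ Submodule.span K ({w} : Set (Fin (n i + 1) → K))

/-- Index type for the Segre–Veronese embedding of multidegree `d`: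
multi-indices of degree `d i` in the homogeneous variables of the `i`-th factor. -/
abbrev svIndex (s : ℕ) (n d : Fin s → ℕ) : Type :=
  ∀ i : Fin s, {w : Fin (n i + 1) → Fin (d i + 1) // ∑ j, (w j : ℕ) = d i}

/-- The Segre–Veronese variety of multidegree `d`: the image of
`ℙ^{n 1} × ⋯ × ℙ^{n s}` under the embedding by `|L_1^{d 1} ⊗ ⋯ ⊗ L_s^{d s}|`. -/
def segreVeroneseVariety (K : Type*) [Field K] (s : ℕ) (n d : Fin s → ℕ) :
    Set (PP K (svIndex s n d)) :=
  {x | ∃ u : ∀ i : Fin s, Fin (n i + 1) → K,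
    x.submodule = Submodule.span K
      ({fun t => ∏ i, ∏ j, u i j ^ ((t i).1 j : ℕ)} : Set (svIndex s n d → K))}

/-- The vector of the moments of degree `≤ d` of the one-dimensional Gaussian
distribution with mean `μ` and variance `t`. -/
def gaussMomentVec (K : Type*) [Field K] (d : ℕ) (μ t : K) : Fin (d + 1) → K := fun i =>
  ∑ j ∈ Finset.range ((i : ℕ) / 2 + 1),
    ((Nat.choose (i : ℕ) (2 * j) * Nat.doubleFactorial (2 * j - 1) : ℕ) : K) *
      t ^ j * μ ^ ((i : ℕ) - 2 * j)

/-- The Gaussian moment variety `𝒢_{1,d} ⊆ ℙ^d`. -/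
def gaussianMomentVariety (K : Type*) [Field K] (d : ℕ) : Set (PP K (Fin (d + 1))) :=
  zclosure {x | ∃ μ t : K,
    x.submodule = Submodule.span K ({gaussMomentVec K d μ t} : Set (Fin (d + 1) → K))}

/-- Zariski-closed families of `m`-tuples of coefficient vectors of linear forms. -/
def IsAffineClosedFamily {m : ℕ} (T : Set (Fin m → ι → K)) : Prop :=
  ∃ S : Set (MvPolynomial (Fin m × ι) K),
    T = {h | ∀ f ∈ S, MvPolynomial.eval (fun p => h p.1 p.2) f = 0}

/-- The linear subspace cut out by the `m` linear forms with coefficient vectors `h`. -/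
def linearSlice {m : ℕ} (h : Fin m → ι → K) : Set (PP K ι) :=
  {x | ∀ j : Fin m, ∑ i : ι, h j i * x.rep i = 0}

/-- `x` lies on the hyperplane with coefficient vector `f`. -/
def inHyperplane (f : ι → K) (x : PP K ι) : Prop :=
  ∑ i : ι, f i * x.rep i = 0

/-- `X ⊆ ℙ^r` (of dimension `n`, `r + 1 = card ι`) is very strange: for a general
codimension-`n` linear subspace `M`, some `r - n + 2` points of `X ∩ M` lie in a
hyperplane of `M`, i.e. in a linear subspace of projective dimension `r - n - 1`. -/
def VeryStrange (n : ℕ) (X : Set (PP K ι)) : Prop :=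
  ∃ T : Set (Fin n → ι → K), IsAffineClosedFamily T ∧ (∃ h, h ∉ T) ∧
    ∀ h : Fin n → ι → K, h ∉ T →
      ∃ A : Finset (PP K ι), ↑A ⊆ X ∩ linearSlice h ∧
        A.card = Fintype.card ι + 1 - n ∧
        Module.finrank K (vspan (A : Set (PP K ι))) ≤ Fintype.card ι - 1 - n

set_option linter.unusedSectionVars false
set_option linter.unusedVariables false
set_option linter.unusedSimpArgs false
-- Part 1

lemma exists_algHom_of_nontrivial {K B : Type*} [Field K] [IsAlgClosed K] [CommRing B] [Algebra K B]
    [Algebra.FiniteType K B] [Nontrivial B] : Nonempty (B →ₐ[K] K) := by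
  obtain ⟨M, hM⟩ := Ideal.exists_maximal B
  let : Field (B ⧸ M) := Ideal.Quotient.field M
  have : Algebra.FiniteType K (B ⧸ M) := inferInstance
  have : Module.Finite K (B ⧸ M) := finite_of_finite_type_of_isJacobsonRing K (B ⧸ M)
  have hb := IsAlgClosed.algebraMap_bijective_of_isIntegral (k := K) (K := B ⧸ M)
  let e := AlgEquiv.ofBijective (Algebra.ofId K (B ⧸ M)) hb
  exact ⟨e.symm.toAlgHom.comp (Ideal.Quotient.mkₐ K M)⟩

lemma algHom_eq_of_ker_le {K A : Type*} [Field K] [CommRing A] [Algebra K A]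
    (φ ψ : A →ₐ[K] K) (h : ∀ a, φ a = 0 → ψ a = 0) : ψ = φ := by
  ext a
  have := h (a - algebraMap K A (φ a)) (by simp)
  rw [map_sub, sub_eq_zero, AlgHom.commutes] at this
  simpa using this

/-- Dominant morphisms have images containing nonempty opens. -/
lemma DL0 {K A B : Type*} [Field K] [IsAlgClosed K] [CommRing A] [IsDomain A] [Algebra K A]
    [Algebra.FiniteType K A] [CommRing B] [Algebra K B] [Algebra.FiniteType K B]
    (f : A →ₐ[K] B) (hf : ∀ a, f a = 0 → a = 0) :
    ∃ a : A, a ≠ 0 ∧ ∀ φ : A →ₐ[K] K, φ a ≠ 0 → ∃ ψ : B →ₐ[K] K, ψ.comp f = φ := by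
  classical
  have : IsNoetherianRing A := Algebra.FiniteType.isNoetherianRing K A
  have hft : f.toRingHom.FiniteType := by
    have h1 : (algebraMap K B).FiniteType := by
      rw [RingHom.finiteType_algebraMap]; infer_instance
    have h2 : (f.toRingHom.comp (algebraMap K A)) = algebraMap K B := f.comp_algebraMap
    rw [← h2] at h1
    exact RingHom.FiniteType.of_comp_finiteType h1
  have hfp : f.toRingHom.FinitePresentation := RingHom.FinitePresentation.of_finiteType.mp hft
  obtain ⟨S, hS⟩ := PrimeSpectrum.exists_constructibleSetData_iff.mpr
    (PrimeSpectrum.isConstructible_range_comap hfp)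
  have hinj : Function.Injective f.toRingHom := (injective_iff_map_eq_zero f.toRingHom).mpr hf
  obtain ⟨q, hq, hq'⟩ := Ideal.exists_comap_eq_of_mem_minimalPrimes_of_injective hinj
    (⊥ : Ideal A) (by rw [IsDomain.minimalPrimes_eq_singleton_bot]; rfl)
  have hgen : (⊥ : PrimeSpectrum A) ∈ S.toSet := by
    rw [hS]
    refine ⟨⟨q, hq⟩, ?_⟩
    ext1
    simpa using hq'
  simp only [PrimeSpectrum.ConstructibleSetData.toSet, Set.mem_iUnion] at hgen
  obtain ⟨C, hC, hCm⟩ := hgen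
  have hg : ∀ i, C.g i = 0 := by
    intro i
    have := hCm.1 (Set.mem_range_self i)
    simpa using this
  have hfne : C.f ≠ 0 := by
    intro h
    apply hCm.2
    simp [h]
  refine ⟨C.f, hfne, fun φ hφ => ?_⟩
  have hp : (RingHom.ker φ.toRingHom).IsPrime := RingHom.ker_isPrime _
  have hmem : (⟨RingHom.ker φ.toRingHom, hp⟩ : PrimeSpectrum A) ∈ S.toSet := by
    simp only [PrimeSpectrum.ConstructibleSetData.toSet, Set.mem_iUnion]
    refine ⟨C, hC, ?_, ?_⟩
    · rintro _ ⟨i, rfl⟩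
      simp [hg i]
    · intro h
      have := h (Set.mem_singleton _)
      exact hφ (by simpa using this)
  rw [hS] at hmem
  obtain ⟨Q, hQ⟩ := hmem
  have hQ' : ∀ a, φ a = 0 → f a ∈ Q.asIdeal := by
    intro a ha
    have : a ∈ (PrimeSpectrum.comap f.toRingHom Q).asIdeal := by
      rw [hQ]; simpa using ha
    simpa using this
  have : Nontrivial (B ⧸ Q.asIdeal) := Ideal.Quotient.nontrivial_iff.mpr Q.2.ne_top
  obtain ⟨χ⟩ := exists_algHom_of_nontrivial (K := K) (B := B ⧸ Q.asIdeal)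
  refine ⟨χ.comp (Ideal.Quotient.mkₐ K Q.asIdeal), ?_⟩
  apply algHom_eq_of_ker_le
  intro a ha
  have : (Ideal.Quotient.mk Q.asIdeal) (f a) = 0 := Ideal.Quotient.eq_zero_iff_mem.mpr (hQ' a ha)
  simp [this]

lemma DL1 {K A B : Type*} [Field K] [IsAlgClosed K] [CommRing A] [IsDomain A] [Algebra K A]
    [Algebra.FiniteType K A] [CommRing B] [Algebra K B] [Algebra.FiniteType K B]
    (f : A →ₐ[K] B) (g : B) :
    (∃ a : A, a ≠ 0 ∧ ∃ N : ℕ, g ^ N * f a = 0) ∨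
    ∃ a : A, a ≠ 0 ∧ ∀ φ : A →ₐ[K] K, φ a ≠ 0 → ∃ ψ : B →ₐ[K] K, ψ.comp f = φ ∧ ψ g ≠ 0 := by
  by_cases h : ∀ a, algebraMap B (Localization.Away g) (f a) = 0 → a = 0
  · right
    have : Algebra.FiniteType K (Localization.Away g) :=
      have : Algebra.FiniteType B (Localization.Away g) := inferInstance
      Algebra.FiniteType.trans (S := B) inferInstance inferInstance
    obtain ⟨a, ha, H⟩ := DL0 ((IsScalarTower.toAlgHom K B (Localization.Away g)).comp f) (by simpa using h)
    refine ⟨a, ha, fun φ hφ => ?_⟩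
    obtain ⟨ψ, hψ⟩ := H φ hφ
    refine ⟨ψ.comp (IsScalarTower.toAlgHom K B (Localization.Away g)), ?_, ?_⟩
    · rw [← hψ]; rfl
    · have : IsUnit (algebraMap B (Localization.Away g) g) := IsLocalization.Away.algebraMap_isUnit g
      exact (this.map ψ).ne_zero
  · left
    push Not at h
    obtain ⟨a, h1, h2⟩ := h
    refine ⟨a, h2, ?_⟩
    rw [IsLocalization.map_eq_zero_iff (Submonoid.powers g)] at h1
    obtain ⟨⟨_, N, rfl⟩, h⟩ := h1
    exact ⟨N, h⟩


/-- vanishing ideal -/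
def vI {K σ : Type*} [Field K] (Z : Set (σ → K)) : Ideal (MvPolynomial σ K) :=
  MvPolynomial.vanishingIdeal K Z

lemma mem_vI {K σ : Type*} [Field K] {Z : Set (σ → K)} {p : MvPolynomial σ K} :
    p ∈ vI Z ↔ ∀ x ∈ Z, MvPolynomial.eval x p = 0 := by
  simp [vI, MvPolynomial.mem_vanishingIdeal_iff, MvPolynomial.aeval_eq_eval]

lemma notMem_vI {K σ : Type*} [Field K] {Z : Set (σ → K)} {p : MvPolynomial σ K} :
    p ∉ vI Z ↔ ∃ x ∈ Z, MvPolynomial.eval x p ≠ 0 := by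
  simp [mem_vI]

/-- the polynomial map -/
def pmap {K σ τ : Type*} [Field K] (Φ : σ → MvPolynomial τ K) (t : τ → K) : σ → K :=
  fun s => MvPolynomial.eval t (Φ s)

lemma eval_bind1 {K σ τ : Type*} [Field K] (Φ : σ → MvPolynomial τ K) (t : τ → K)
    (p : MvPolynomial σ K) :
    MvPolynomial.eval t (MvPolynomial.bind₁ Φ p) = MvPolynomial.eval (pmap Φ t) p := by
  have h : (MvPolynomial.aeval t).comp (MvPolynomial.bind₁ Φ) =
      (MvPolynomial.aeval (pmap Φ t) : MvPolynomial σ K →ₐ[K] K) := by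
    apply MvPolynomial.algHom_ext
    intro i
    simp only [AlgHom.comp_apply, MvPolynomial.bind₁_X_right, MvPolynomial.aeval_X, pmap,
      MvPolynomial.aeval_eq_eval]
  have h2 := DFunLike.congr_fun h p
  simpa only [AlgHom.comp_apply, MvPolynomial.aeval_eq_eval] using h2

theorem geomDL {K σ τ : Type*} [Field K] [IsAlgClosed K] [Finite σ] [Finite τ]
    (Z : Set (σ → K)) (hZ : (vI Z).IsPrime) (Φ : σ → MvPolynomial τ K)
    (F : Set (MvPolynomial τ K)) (G : MvPolynomial τ K) :
    (∃ a, a ∉ vI Z ∧ ∀ t, (∀ f ∈ F, MvPolynomial.eval t f = 0) → MvPolynomial.eval t G ≠ 0 →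
      (∀ p ∈ vI Z, MvPolynomial.eval (pmap Φ t) p = 0) →
      MvPolynomial.eval (pmap Φ t) a = 0) ∨
    (∃ a, a ∉ vI Z ∧ ∀ z, (∀ p ∈ vI Z, MvPolynomial.eval z p = 0) → MvPolynomial.eval z a ≠ 0 →
      ∃ t, (∀ f ∈ F, MvPolynomial.eval t f = 0) ∧ MvPolynomial.eval t G ≠ 0 ∧ pmap Φ t = z) := by
  classical
  let J : Ideal (MvPolynomial τ K) :=
    Ideal.span (F ∪ (MvPolynomial.bind₁ Φ) '' (vI Z : Set (MvPolynomial σ K)))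
  let q : MvPolynomial τ K →ₐ[K] MvPolynomial τ K ⧸ J := Ideal.Quotient.mkₐ K J
  let qA : MvPolynomial σ K →ₐ[K] MvPolynomial σ K ⧸ vI Z := Ideal.Quotient.mkₐ K (vI Z)
  have hqA : Function.Surjective qA := Ideal.Quotient.mkₐ_surjective K _
  let f : (MvPolynomial σ K ⧸ vI Z) →ₐ[K] MvPolynomial τ K ⧸ J :=
    Ideal.Quotient.liftₐ (vI Z) (q.comp (MvPolynomial.bind₁ Φ)) (by
      intro a ha
      apply Ideal.Quotient.eq_zero_iff_mem.mpr
      exact Ideal.subset_span (Or.inr ⟨a, ha, rfl⟩))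
  have hf : ∀ p, f (qA p) = q (MvPolynomial.bind₁ Φ p) := fun p => rfl
  have hne : ∀ p, qA p ≠ 0 ↔ p ∉ vI Z := fun p => by
    rw [not_iff_not]; exact Ideal.Quotient.eq_zero_iff_mem
  rcases DL1 f (q G) with ⟨a, ha, N, hN⟩ | ⟨a, ha, H⟩
  · left
    obtain ⟨a, rfl⟩ := hqA a
    refine ⟨a, (hne a).mp ha, fun t ht hG hz => ?_⟩
    rw [hf, ← map_pow, ← map_mul] at hN
    have hN' : G ^ N * MvPolynomial.bind₁ Φ a ∈ J := Ideal.Quotient.eq_zero_iff_mem.mp hN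
    have hJ : J ≤ RingHom.ker (MvPolynomial.eval t) := by
      rw [Ideal.span_le]
      rintro p (hp | ⟨p, hp, rfl⟩)
      · exact ht p hp
      · change MvPolynomial.eval t _ = 0
        rw [eval_bind1]; exact hz p hp
    have := hJ hN'
    rw [RingHom.mem_ker, map_mul, map_pow, eval_bind1] at this
    exact (mul_eq_zero.mp this).resolve_left (pow_ne_zero _ hG)
  · right
    obtain ⟨a, rfl⟩ := hqA a
    refine ⟨a, (hne a).mp ha, fun z hz hza => ?_⟩
    let φ : (MvPolynomial σ K ⧸ vI Z) →ₐ[K] K :=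
      Ideal.Quotient.liftₐ (vI Z) (MvPolynomial.aeval z) (by
        intro p hp; rw [MvPolynomial.aeval_eq_eval]; exact hz p hp)
    have hφ : ∀ p, φ (qA p) = MvPolynomial.eval z p := fun p => by
      rw [← MvPolynomial.aeval_eq_eval]; rfl
    obtain ⟨ψ, h1, h2⟩ := H φ (by rw [hφ]; exact hza)
    let t : τ → K := fun i => ψ (q (MvPolynomial.X i))
    have ht : ∀ p, ψ (q p) = MvPolynomial.eval t p := fun p => by
      have : ψ.comp q = MvPolynomial.aeval t := by
        apply MvPolynomial.algHom_ext; intro i; simp [t]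
      rw [← MvPolynomial.aeval_eq_eval, ← this]; rfl
    refine ⟨t, fun p hp => ?_, ?_, ?_⟩
    · rw [← ht]
      have : q p = 0 := Ideal.Quotient.eq_zero_iff_mem.mpr (Ideal.subset_span (Or.inl hp))
      rw [this, map_zero]
    · rwa [← ht]
    · ext s
      have : ψ (f (qA (MvPolynomial.X s))) = φ (qA (MvPolynomial.X s)) := by rw [← h1]; rfl
      rw [hf, hφ, ht] at this
      simpa [pmap] using this


-- Part 2

lemma map_aeval' {K A B σ : Type*} [Field K] [CommRing A] [Algebra K A] [CommRing B] [Algebra K B]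
    (f : A →ₐ[K] B) (x : σ → A) (P : MvPolynomial σ K) :
    f (MvPolynomial.aeval x P) = MvPolynomial.aeval (fun i => f (x i)) P := by
  have : f.comp (MvPolynomial.aeval x) = MvPolynomial.aeval (fun i => f (x i)) := by
    apply MvPolynomial.algHom_ext; intro i; simp
  rw [← this]; rfl

lemma ai_of_map {K A B σ : Type*} [Field K] [CommRing A] [Algebra K A] [CommRing B] [Algebra K B]
    (f : A →ₐ[K] B) (x : σ → A) (h : AlgebraicIndependent K (fun i => f (x i))) :
    AlgebraicIndependent K x := by
  rw [algebraicIndependent_iff] at h ⊢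
  intro p hp
  apply h
  rw [← map_aeval', hp, map_zero]

lemma trdeg_lt_of_surj {K A B : Type*} [Field K] [CommRing A] [IsDomain A] [Algebra K A]
    [CommRing B] [IsDomain B] [Algebra K B] [Algebra.FiniteType K A] [Algebra.FiniteType K B]
    (f : A →ₐ[K] B) (hf : Function.Surjective f) (a : A) (ha : a ≠ 0) (hfa : f a = 0) :
    (Algebra.trdeg K B).toNat < (Algebra.trdeg K A).toNat := by
  obtain ⟨s, hs⟩ := exists_isTranscendenceBasis K B
  have hB : Algebra.trdeg K B < Cardinal.aleph0 := trdeg_lt_aleph0_of_finiteType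
  have hA : Algebra.trdeg K A < Cardinal.aleph0 := trdeg_lt_aleph0_of_finiteType
  have hsc := hs.cardinalMk_eq_trdeg
  have hfin : Finite s := by rw [← Cardinal.lt_aleph0_iff_finite, hsc]; exact hB
  choose g hg using hf
  let x : s → A := fun i => g i
  have hx : ∀ i, f (x i) = i := fun i => hg i
  have hxi : AlgebraicIndependent K x := by
    have h1 : AlgebraicIndependent K (f ∘ x) := by
      have : f ∘ x = Subtype.val := by ext i; exact hx i
      rw [this]; exact hs.1
    exact ai_of_map f x h1
  by_contra hlt
  push Not at hlt
  have hxb : IsTranscendenceBasis K x := by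
    apply hxi.isTranscendenceBasis_of_lift_trdeg_le_of_finite
    rw [← Cardinal.cast_toNat_of_lt_aleph0 hA]
    rw [hsc, ← Cardinal.cast_toNat_of_lt_aleph0 hB]
    simpa using hlt
  have halg := hxb.isAlgebraic
  have h1 := Ideal.comap_ne_bot_of_algebraic_mem (R := Algebra.adjoin K (Set.range x)) ha
    (I := RingHom.ker f) (by simpa using hfa) (halg.isAlgebraic a)
  apply h1
  rw [eq_bot_iff]
  rintro ⟨p, hp⟩ hp'
  have hp2 : f p = 0 := hp'
  rw [Algebra.adjoin_range_eq_range_aeval] at hp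
  obtain ⟨P, rfl⟩ := hp
  have h3 : MvPolynomial.aeval (Subtype.val : s → B) P = 0 := by
    rw [← hp2]
    change _ = f (MvPolynomial.aeval x P)
    rw [map_aeval']
    simp only [hx]
  have : P = 0 := by
    have := hs.1
    rw [algebraicIndependent_iff] at this
    exact this P h3
  ext
  simp [this]


-- Part 3

lemma mem_coneOf {Z : Set (PP K ι)} {v : ι → K} : v ∈ coneOf Z ↔ ∃ x ∈ Z, v ∈ x.submodule := by
  simp [coneOf]

lemma mem_submodule_mk {v w : ι → K} (hv : v ≠ 0) :
    w ∈ (Projectivization.mk K v hv).submodule ↔ ∃ c : K, w = c • v := by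
  rw [Projectivization.submodule_mk, Submodule.mem_span_singleton]
  exact ⟨fun ⟨a, b⟩ => ⟨a, b.symm⟩, fun ⟨a, b⟩ => ⟨a, b.symm⟩⟩

lemma mem_submodule_iff {x : PP K ι} {w : ι → K} (hw : w ≠ 0) :
    w ∈ x.submodule ↔ x = Projectivization.mk K w hw := by
  induction x using Projectivization.ind with
  | h v hv =>
    rw [mem_submodule_mk]
    rw [Projectivization.mk_eq_mk_iff']
    constructor
    · rintro ⟨c, rfl⟩
      have hc : c ≠ 0 := by rintro rfl; simp at hw
      exact ⟨c⁻¹, by simp [smul_smul, hc]⟩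
    · rintro ⟨c, rfl⟩
      have hc : c ≠ 0 := by rintro rfl; simp at hv
      exact ⟨c⁻¹, by simp [smul_smul, hc]⟩

lemma mem_coneOf_mk {Z : Set (PP K ι)} {v : ι → K} (hv : v ≠ 0) :
    v ∈ coneOf Z ↔ Projectivization.mk K v hv ∈ Z := by
  rw [mem_coneOf]
  constructor
  · rintro ⟨x, hx, h⟩
    rw [mem_submodule_iff hv] at h
    exact h ▸ hx
  · intro h
    exact ⟨_, h, (mem_submodule_iff hv).mpr rfl⟩

lemma rep_mem_cone {Z : Set (PP K ι)} {x : PP K ι} (hx : x ∈ Z) : x.rep ∈ coneOf Z := by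
  rw [mem_coneOf_mk x.rep_nonzero, Projectivization.mk_rep]; exact hx

lemma rep_mem_submodule (x : PP K ι) : x.rep ∈ x.submodule := by
  rw [mem_submodule_iff x.rep_nonzero, Projectivization.mk_rep]

lemma smul_mem_cone {Z : Set (PP K ι)} {v : ι → K} (h : v ∈ coneOf Z) (c : K) :
    c • v ∈ coneOf Z := by
  rw [mem_coneOf] at *
  obtain ⟨x, hx, h⟩ := h
  exact ⟨x, hx, Submodule.smul_mem _ _ h⟩

lemma zero_mem_cone {Z : Set (PP K ι)} (h : Z.Nonempty) : (0 : ι → K) ∈ coneOf Z := by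
  obtain ⟨x, hx⟩ := h
  exact mem_coneOf.mpr ⟨x, hx, Submodule.zero_mem _⟩

lemma coneOf_mono {Z Z' : Set (PP K ι)} (h : Z ⊆ Z') : coneOf Z ⊆ coneOf Z' := by
  intro v hv
  rw [mem_coneOf] at *
  obtain ⟨x, hx, hh⟩ := hv
  exact ⟨x, h hx, hh⟩

lemma subset_of_cone {Z Z' : Set (PP K ι)} (h : coneOf Z ⊆ coneOf Z') : Z ⊆ Z' := by
  intro x hx
  have := h (rep_mem_cone hx)
  rwa [mem_coneOf_mk x.rep_nonzero, Projectivization.mk_rep] at this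

lemma eval_smul_hom {f : MvPolynomial ι K} {d : ℕ} (hf : f.IsHomogeneous d) (c : K) (v : ι → K) :
    MvPolynomial.eval (c • v) f = c ^ d * MvPolynomial.eval v f := by
  rw [MvPolynomial.eval_eq, MvPolynomial.eval_eq, Finset.mul_sum]
  apply Finset.sum_congr rfl
  intro m hm
  have hd : m.degree = d := by
    rw [Finsupp.degree_eq_weight_one]; exact hf (MvPolynomial.mem_support_iff.mp hm)
  have : ∏ i ∈ m.support, c ^ m i = c ^ d := by
    rw [Finset.prod_pow_eq_pow_sum, ← hd]; rfl
  simp only [Pi.smul_apply, smul_eq_mul, mul_pow, Finset.prod_mul_distrib, this]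
  ring

lemma eval_smul_sum (f : MvPolynomial ι K) (c : K) (v : ι → K) :
    MvPolynomial.eval (c • v) f = ∑ i ∈ Finset.range (f.totalDegree + 1),
      c ^ i * MvPolynomial.eval v (MvPolynomial.homogeneousComponent i f) := by
  conv_lhs => rw [← MvPolynomial.sum_homogeneousComponent f]
  rw [map_sum]
  apply Finset.sum_congr rfl
  intro i _
  rw [eval_smul_hom (MvPolynomial.homogeneousComponent_isHomogeneous i f)]

/-- a set stable under scalars has a homogeneous ideal -/
lemma vI_hom_comp [Infinite K] {Z : Set (ι → K)} (hZ : ∀ v ∈ Z, ∀ c : K, c • v ∈ Z)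
    {f : MvPolynomial ι K} (hf : f ∈ vI Z) (i : ℕ) :
    MvPolynomial.homogeneousComponent i f ∈ vI Z := by
  rw [mem_vI] at *
  intro v hv
  by_cases hi : i < f.totalDegree + 1
  swap
  · rw [MvPolynomial.homogeneousComponent_eq_zero _ _ (by omega), map_zero]
  let p : Polynomial K := ∑ i ∈ Finset.range (f.totalDegree + 1),
    Polynomial.monomial i (MvPolynomial.eval v (MvPolynomial.homogeneousComponent i f))
  have hp : p = 0 := by
    apply Polynomial.funext
    intro c
    have := hf _ (hZ v hv c)
    rw [eval_smul_sum] at this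
    simp only [p, Polynomial.eval_finsetSum, Polynomial.eval_monomial, Polynomial.eval_zero]
    rw [← this]
    exact Finset.sum_congr rfl fun _ _ => mul_comm _ _
  have := congrArg (fun q => Polynomial.coeff q i) hp
  simp only [p, Polynomial.finsetSum_coeff, Polynomial.coeff_monomial, Polynomial.coeff_zero] at this
  rw [Finset.sum_ite_eq' ] at this
  simpa [hi] using this

attribute [local instance] MvPolynomial.gradedAlgebra

lemma vI_isHomogeneous [Infinite K] {Z : Set (ι → K)} (hZ : ∀ v ∈ Z, ∀ c : K, c • v ∈ Z) :
    (vI Z).IsHomogeneous (MvPolynomial.homogeneousSubmodule ι K) := by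
  intro i f hf
  have := vI_hom_comp hZ hf i
  rw [← MvPolynomial.decomposition.decompose'_apply] at this
  exact this

lemma exists_hom_notMem [Infinite K] {Z : Set (ι → K)} 
    {f : MvPolynomial ι K} (hf : f ∉ vI Z) :
    ∃ i, MvPolynomial.homogeneousComponent i f ∉ vI Z := by
  by_contra h
  push Not at h
  apply hf
  rw [← MvPolynomial.sum_homogeneousComponent f]
  exact Ideal.sum_mem _ fun i _ => h i

lemma vI_prime_iff {Z : Set (ι → K)} : (vI Z).IsPrime ↔ Z.Nonempty ∧ ∀ f g : MvPolynomial ι K,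
    f ∉ vI Z → g ∉ vI Z → ∃ v ∈ Z, MvPolynomial.eval v f ≠ 0 ∧ MvPolynomial.eval v g ≠ 0 := by
  constructor
  · intro h
    constructor
    · by_contra hne
      rw [Set.not_nonempty_iff_eq_empty] at hne
      apply h.ne_top
      rw [Ideal.eq_top_iff_one, mem_vI]
      simp [hne]
    · intro f g hf hg
      have : f * g ∉ vI Z := fun hh => (h.mem_or_mem hh).elim hf hg
      rw [notMem_vI] at this
      obtain ⟨v, hv, hh⟩ := this
      rw [map_mul] at hh
      exact ⟨v, hv, left_ne_zero_of_mul hh, right_ne_zero_of_mul hh⟩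
  · rintro ⟨⟨v, hv⟩, h⟩
    refine ⟨?_, ?_⟩
    · rw [Ideal.ne_top_iff_one, notMem_vI]
      exact ⟨v, hv, by simp⟩
    · intro f g hfg
      by_contra hh
      push Not at hh
      obtain ⟨w, hw, h1, h2⟩ := h f g hh.1 hh.2
      rw [mem_vI] at hfg
      have := hfg w hw
      rw [map_mul] at this
      exact (mul_ne_zero h1 h2) this

lemma irr_iff [Infinite K] {Z : Set (PP K ι)} :
    IsZIrreducible Z ↔ Z.Nonempty ∧ (vI (coneOf Z)).IsPrime := by
  constructor
  · rintro ⟨hne, h⟩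
    refine ⟨hne, ?_⟩
    apply (vI_isHomogeneous (Z := coneOf Z)
      (fun v hv c => smul_mem_cone hv c)).isPrime_of_homogeneous_mem_or_mem
    · rw [Ideal.ne_top_iff_one, notMem_vI]
      exact ⟨0, zero_mem_cone hne, by simp⟩
    · rintro f g ⟨d, hf⟩ ⟨e, hg⟩ hfg
      rw [MvPolynomial.mem_homogeneousSubmodule] at hf hg
      have key : ∀ f : MvPolynomial ι K, Z ⊆ zeroLocus {f} → f ∈ vI (coneOf Z) := by
        intro f hf
        rw [mem_vI]
        intro v hv
        obtain ⟨x, hx, hv⟩ := mem_coneOf.mp hv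
        exact hf hx f rfl v hv
      refine (h (zeroLocus {f}) (zeroLocus {g}) ⟨{f}, by rintro _ rfl; exact ⟨d, hf⟩, rfl⟩
        ⟨{g}, by rintro _ rfl; exact ⟨e, hg⟩, rfl⟩ ?_).imp (key f) (key g)
      intro x hx
      have h1 := mem_vI.mp hfg _ (rep_mem_cone hx)
      have key2 : ∀ (f : MvPolynomial ι K) (d : ℕ), f.IsHomogeneous d →
          MvPolynomial.eval x.rep f = 0 → x ∈ zeroLocus {f} := by
        rintro f d hf h0 _ rfl v hv
        rw [← x.mk_rep, mem_submodule_mk] at hv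
        obtain ⟨c, rfl⟩ := hv
        rw [eval_smul_hom hf, h0, mul_zero]
      rw [map_mul] at h1
      exact (mul_eq_zero.mp h1).imp (key2 f d hf) (key2 g e hg)
  · rintro ⟨hne, h⟩
    refine ⟨hne, ?_⟩
    rintro _ _ ⟨S, -, rfl⟩ ⟨S', -, rfl⟩ hZ
    by_contra hh
    push Not at hh
    have key : ∀ S : Set (MvPolynomial ι K), ¬ Z ⊆ zeroLocus S → ∃ f ∈ S, f ∉ vI (coneOf Z) := by
      intro S hS
      by_contra hc
      push Not at hc
      apply hS
      intro x hx f hf v hv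
      exact mem_vI.mp (hc f hf) v (mem_coneOf.mpr ⟨x, hx, hv⟩)
    obtain ⟨f, hf, hf'⟩ := key S hh.1
    obtain ⟨g, hg, hg'⟩ := key S' hh.2
    obtain ⟨v, hv, h1, h2⟩ := (vI_prime_iff.mp h).2 f g hf' hg'
    obtain ⟨x, hx, hv⟩ := mem_coneOf.mp hv
    rcases hZ hx with h | h
    · exact h1 (h f hf v hv)
    · exact h2 (h g hg v hv)

lemma cone_closed {Z : Set (PP K ι)} (hZ : IsZClosed Z) (hne : Z.Nonempty) {v : ι → K}
    (hv : ∀ p ∈ vI (coneOf Z), MvPolynomial.eval v p = 0) : v ∈ coneOf Z := by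
  by_cases h0 : v = 0
  · rw [h0]; exact zero_mem_cone hne
  rw [mem_coneOf_mk h0]
  obtain ⟨S, hS, rfl⟩ := hZ
  intro f hf w hw
  obtain ⟨d, hd⟩ := hS f hf
  rw [mem_submodule_mk] at hw
  obtain ⟨c, rfl⟩ := hw
  rw [eval_smul_hom hd, hv f, mul_zero]
  rw [mem_vI]
  intro w hw
  obtain ⟨x, hx, hw⟩ := mem_coneOf.mp hw
  exact hx f hf w hw

lemma vI_anti {σ : Type*} {A B : Set (σ → K)} (h : A ⊆ B) : vI B ≤ vI A := fun p hp =>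
  mem_vI.mpr fun x hx => mem_vI.mp hp x (h hx)

lemma zclosure_of_closed {Z : Set (PP K ι)} (hZ : IsZClosed Z) : zclosure Z = Z := by
  apply Set.Subset.antisymm
  · intro x hx
    exact hx Z ⟨hZ, subset_rfl⟩
  · intro x hx Y hY
    exact hY.2 hx

lemma subset_zclosure (Z : Set (PP K ι)) : Z ⊆ zclosure Z := fun _ hx _ hY => hY.2 hx

/-- closed set attached to a homogeneous condition: closure description -/
lemma zclosure_eq (Z : Set (PP K ι)) : zclosure Z =
    zeroLocus {f | (∃ d : ℕ, f.IsHomogeneous d) ∧ f ∈ vI (coneOf Z)} := by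
  apply Set.Subset.antisymm
  · intro x hx
    apply hx
    refine ⟨⟨_, fun f hf => hf.1, rfl⟩, ?_⟩
    intro y hy f hf v hv
    exact mem_vI.mp hf.2 v (mem_coneOf.mpr ⟨y, hy, hv⟩)
  · rintro x hx _ ⟨⟨S, hS, rfl⟩, hY⟩
    intro f hf v hv
    refine hx f ⟨hS f hf, ?_⟩ v hv
    rw [mem_vI]
    intro w hw
    obtain ⟨y, hy, hw⟩ := mem_coneOf.mp hw
    exact hY hy f hf w hw

lemma zclosure_isZClosed (Z : Set (PP K ι)) : IsZClosed (zclosure Z) :=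
  ⟨_, fun _ hf => hf.1, zclosure_eq Z⟩

lemma vI_zclosure [Infinite K] (Z : Set (PP K ι)) : vI (coneOf (zclosure Z)) = vI (coneOf Z) := by
  apply le_antisymm
  · exact vI_anti (coneOf_mono (subset_zclosure Z))
  · intro f hf
    rw [← MvPolynomial.sum_homogeneousComponent f]
    refine Ideal.sum_mem _ fun i _ => ?_
    rw [mem_vI]
    intro v hv
    obtain ⟨x, hx, hv⟩ := mem_coneOf.mp hv
    rw [zclosure_eq] at hx
    exact hx _ ⟨⟨i, MvPolynomial.homogeneousComponent_isHomogeneous i f⟩,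
      vI_hom_comp (fun v hv c => smul_mem_cone hv c) hf i⟩ v hv


-- Part 4

lemma primeChain (K A : Type*) [Field K] [CommRing A] [IsDomain A] [Algebra K A]
    [Algebra.FiniteType K A] :
    ∃ L : LTSeries (PrimeSpectrum A), L.length = (Algebra.trdeg K A).toNat := by
  obtain ⟨s, g, hinj, hint⟩ := exists_integral_inj_algHom_of_fg K A
  let : Algebra (MvPolynomial (Fin s) K) A := g.toRingHom.toAlgebra
  have htow : IsScalarTower K (MvPolynomial (Fin s) K) A := IsScalarTower.of_algHom g
  have hI : Algebra.IsIntegral (MvPolynomial (Fin s) K) A := ⟨hint⟩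
  have hF : FaithfulSMul (MvPolynomial (Fin s) K) A := by
    rw [faithfulSMul_iff_algebraMap_injective]; exact hinj
  have htr : (Algebra.trdeg K A).toNat = s := by
    have h1 := lift_trdeg_add_eq K (MvPolynomial (Fin s) K) A
    have h2 : Algebra.trdeg (MvPolynomial (Fin s) K) A = 0 := trdeg_eq_zero
    rw [h2, MvPolynomial.trdeg_of_isDomain] at h1
    have := congrArg Cardinal.toNat h1
    simpa using this.symm
  have hd : ((s : ℕ) : WithBot ℕ∞) ≤ Order.krullDim (PrimeSpectrum (MvPolynomial (Fin s) K)) := by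
    have := MvPolynomial.ringKrullDim_of_isNoetherianRing (R := K) (ι := Fin s)
    rw [ringKrullDim] at this
    rw [this]
    simp [ringKrullDim_eq_zero_of_field]
  obtain ⟨l, hl⟩ := Order.le_krullDim_iff.mp hd
  obtain ⟨P, hP, hP'⟩ := Ideal.exists_ideal_over_prime_of_isIntegral_of_isDomain (S := A) l.head.asIdeal
    (by rw [(RingHom.injective_iff_ker_eq_bot _).mp (show Function.Injective (algebraMap (MvPolynomial (Fin s) K) A) from hinj)]; exact bot_le)
  have : P.LiesOver (RelSeries.head l).asIdeal := ⟨hP'.symm⟩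
  obtain ⟨L, hL, -⟩ := Ideal.exists_ltSeries_of_hasGoingUp l P
  exact ⟨L, by rw [hL, hl, htr]⟩


/-- transcendence degree of the quotient -/
def td {σ : Type*} (P : Ideal (MvPolynomial σ K)) : ℕ :=
  (Algebra.trdeg K (MvPolynomial σ K ⧸ P)).toNat

lemma td_lt {σ : Type*} [Finite σ] {P Q : Ideal (MvPolynomial σ K)} (hP : P.IsPrime) (hQ : Q.IsPrime)
    (h : P < Q) : td Q < td P := by
  obtain ⟨a, haQ, haP⟩ := SetLike.exists_of_lt h
  exact trdeg_lt_of_surj (Ideal.Quotient.factorₐ K h.le) (Ideal.Quotient.factor_surjective h.le)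
    (Ideal.Quotient.mk P a) (by rwa [Ne, Ideal.Quotient.eq_zero_iff_mem])
    (by simpa [Ideal.Quotient.eq_zero_iff_mem] using haQ)

lemma vI_lt_of_ssub {Y Z : Set (PP K ι)} (hY : IsZClosed Y) (hYn : Y.Nonempty) (h : Y ⊂ Z) :
    vI (coneOf Z) < vI (coneOf Y) := by
  refine lt_of_le_of_ne (vI_anti (coneOf_mono h.subset)) fun he => ?_
  apply h.not_subset
  apply subset_of_cone
  intro v hv
  apply cone_closed hY hYn
  intro p hp
  rw [← he] at hp
  exact mem_vI.mp hp v hv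

lemma td_pos [Infinite K] {Z : Set (PP K ι)} (hZ : IsZIrreducible Z) : 0 < td (vI (coneOf Z)) := by
  obtain ⟨x, hx⟩ := hZ.1
  have h0 : (vI ({0} : Set (ι → K))).IsPrime := by
    rw [vI_prime_iff]
    refine ⟨⟨0, rfl⟩, fun f g hf hg => ⟨0, rfl, ?_⟩⟩
    rw [notMem_vI] at hf hg
    simpa using And.intro hf hg
  refine lt_of_le_of_lt (Nat.zero_le _) (td_lt (irr_iff.mp hZ).2 h0 ?_)
  refine lt_of_le_of_ne (vI_anti ?_) fun he => ?_
  · rintro _ rfl; exact zero_mem_cone hZ.1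
  · obtain ⟨i, hi⟩ := Function.ne_iff.mp x.rep_nonzero
    have : (MvPolynomial.X i : MvPolynomial ι K) ∈ vI ({0} : Set (ι → K)) := by
      rw [mem_vI]; simp
    rw [← he, mem_vI] at this
    exact hi (by simpa using this _ (rep_mem_cone hx))

lemma zdim_le [Infinite K] {Z : Set (PP K ι)} (hZ : IsZClosed Z) (hZi : IsZIrreducible Z) :
    zdim Z ≤ ((td (vI (coneOf Z)) - 1 : ℕ) : WithBot ℕ∞) := by
  unfold zdim
  rw [zclosure_of_closed hZ, Order.krullDim]
  apply iSup_le
  intro l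
  have hmono : StrictMono (fun Y : {Y : Set (PP K ι) // IsZClosed Y ∧ IsZIrreducible Y ∧ Y ⊆ Z} =>
      td (vI (coneOf Y.1))) := by
    intro Y Y' h
    exact td_lt (irr_iff.mp Y'.2.2.1).2 (irr_iff.mp Y.2.2.1).2 (vI_lt_of_ssub Y.2.1 Y.2.2.1.1 h)
  have h1 := (l.map _ hmono).head_add_length_le_nat
  have h2 : td (vI (coneOf l.head.1)) + l.length ≤ td (vI (coneOf l.last.1)) := h1
  have h3 := td_pos l.head.2.2.1
  have h4 : td (vI (coneOf l.last.1)) ≤ td (vI (coneOf Z)) := by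
    rcases eq_or_ne l.last.1 Z with h | h
    · rw [h]
    · exact (td_lt (irr_iff.mp hZi).2 (irr_iff.mp l.last.2.2.1).2
        (vI_lt_of_ssub l.last.2.1 l.last.2.2.1.1 (lt_of_le_of_ne l.last.2.2.2 h))).le
  exact_mod_cast (by omega : l.length ≤ td (vI (coneOf Z)) - 1)


-- Part 5

/-- affine slice -/
def slice (Z : Set (PP K ι)) (j : ι) : Set (ι → K) := {v | v ∈ coneOf Z ∧ v j = 1}

/-- homogenization by the `j`-th variable -/
def hmg (j : ι) (f : MvPolynomial ι K) : MvPolynomial ι K :=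
  ∑ i ∈ Finset.range (f.totalDegree + 1),
    MvPolynomial.X j ^ (f.totalDegree - i) * MvPolynomial.homogeneousComponent i f

lemma hmg_hom (j : ι) (f : MvPolynomial ι K) : (hmg j f).IsHomogeneous f.totalDegree := by
  apply MvPolynomial.IsHomogeneous.sum
  intro i hi
  have h1 : f.totalDegree = 1 * (f.totalDegree - i) + i := by
    have := Finset.mem_range.mp hi; omega
  conv_rhs => rw [h1]
  exact ((MvPolynomial.isHomogeneous_X K j).pow _).mul
    (MvPolynomial.homogeneousComponent_isHomogeneous i f)

lemma eval_hmg (j : ι) (f : MvPolynomial ι K) (v : ι → K) (hv : v j = 1) :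
    MvPolynomial.eval v (hmg j f) = MvPolynomial.eval v f := by
  conv_rhs => rw [← MvPolynomial.sum_homogeneousComponent f]
  rw [hmg, map_sum, map_sum]
  apply Finset.sum_congr rfl
  intro i _
  simp [hv]

lemma slice_of_cone {Z : Set (PP K ι)} {j : ι} {v : ι → K} (hv : v ∈ coneOf Z) (hj : v j ≠ 0) :
    (v j)⁻¹ • v ∈ slice Z j :=
  ⟨smul_mem_cone hv _, by simp [hj]⟩

lemma slice_prime [Infinite K] {Z : Set (PP K ι)} (hZi : IsZIrreducible Z) {j : ι}
    (hj : MvPolynomial.X j ∉ vI (coneOf Z)) : (vI (slice Z j)).IsPrime := by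
  have hP := (irr_iff.mp hZi).2
  rw [vI_prime_iff]
  constructor
  · obtain ⟨v, hv, h⟩ := notMem_vI.mp hj
    exact ⟨_, slice_of_cone hv (by simpa using h)⟩
  · intro f g hf hg
    have key : ∀ f : MvPolynomial ι K, f ∉ vI (slice Z j) → hmg j f ∉ vI (coneOf Z) := by
      intro f hf
      rw [notMem_vI] at *
      obtain ⟨v, hv, h⟩ := hf
      exact ⟨v, hv.1, by rwa [eval_hmg j f v hv.2]⟩
    have h1 : hmg j f * hmg j g ∉ vI (coneOf Z) := fun h =>
      (hP.mem_or_mem h).elim (key f hf) (key g hg)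
    obtain ⟨v, hv, h2, h3⟩ := (vI_prime_iff.mp hP).2 _ _ h1 hj
    have h3' : v j ≠ 0 := by simpa using h3
    refine ⟨_, slice_of_cone hv h3', ?_, ?_⟩
    · rw [← eval_hmg j _ _ (slice_of_cone hv h3').2, eval_smul_hom (hmg_hom j f)]
      rw [map_mul] at h2
      exact mul_ne_zero (pow_ne_zero _ (inv_ne_zero h3')) (left_ne_zero_of_mul h2)
    · rw [← eval_hmg j _ _ (slice_of_cone hv h3').2, eval_smul_hom (hmg_hom j g)]
      rw [map_mul] at h2
      exact mul_ne_zero (pow_ne_zero _ (inv_ne_zero h3')) (right_ne_zero_of_mul h2)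

lemma td_slice [Infinite K] {Z : Set (PP K ι)} (hZi : IsZIrreducible Z) {j : ι}
    (hj : MvPolynomial.X j ∉ vI (coneOf Z)) : td (vI (coneOf Z)) ≤ td (vI (slice Z j)) + 1 := by
  have hP := (irr_iff.mp hZi).2
  have hJ := slice_prime hZi hj
  let S := MvPolynomial ι K ⧸ vI (slice Z j)
  let q : MvPolynomial ι K →ₐ[K] S := Ideal.Quotient.mkₐ K (vI (slice Z j))
  let φ : MvPolynomial ι K →ₐ[K] Polynomial S := MvPolynomial.aeval
    (fun i => Polynomial.X * Polynomial.C (q (MvPolynomial.X i)))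
  -- evaluation
  let ev : ∀ v ∈ slice Z j, S →ₐ[K] K := fun v hv =>
    Ideal.Quotient.liftₐ (vI (slice Z j)) (MvPolynomial.aeval v) (by
      intro p hp; rw [MvPolynomial.aeval_eq_eval]; exact mem_vI.mp hp v hv)
  have hφ : ∀ f (v) (hv : v ∈ slice Z j) (t : K),
      Polynomial.eval t ((φ f).map (ev v hv).toRingHom) = MvPolynomial.eval (t • v) f := by
    intro f v hv t
    have : ((Polynomial.aeval t).comp (Polynomial.mapAlgHom (ev v hv))).comp φ =
        MvPolynomial.aeval (t • v) := by
      apply MvPolynomial.algHom_ext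
      intro i
      have : (ev v hv) (q (MvPolynomial.X i)) = v i := by
        change (MvPolynomial.aeval v) (MvPolynomial.X i) = _
        simp
      simp [φ, this]
      exact mul_comm _ _
    have h2 := DFunLike.congr_fun this f
    rw [MvPolynomial.aeval_eq_eval] at h2
    rw [← h2]
    simp only [AlgHom.comp_apply, Polynomial.coe_aeval_eq_eval]
    rfl
  have hker : ∀ f, φ f = 0 → f ∈ vI (coneOf Z) := by
    intro f hf
    by_contra hne
    obtain ⟨v, hv, h2, h3⟩ := (vI_prime_iff.mp hP).2 _ _ hne hj
    have h3' : v j ≠ 0 := by simpa using h3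
    have := hφ f _ (slice_of_cone hv h3') (v j)
    rw [hf, smul_smul, mul_inv_cancel₀ h3', one_smul] at this
    apply h2; rw [← this]; simp
  have hker2 : ∀ f ∈ vI (coneOf Z), φ f = 0 := by
    intro f hf
    ext i
    obtain ⟨c, hc⟩ := Ideal.Quotient.mkₐ_surjective K _ ((φ f).coeff i)
    rw [← hc, Polynomial.coeff_zero]
    apply Ideal.Quotient.eq_zero_iff_mem.mpr
    rw [mem_vI]
    intro v hv
    have h0 : (φ f).map (ev v hv).toRingHom = 0 := by
      apply Polynomial.funext
      intro t
      rw [hφ _ _ hv, Polynomial.eval_zero]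
      exact mem_vI.mp hf _ (smul_mem_cone hv.1 t)
    have h1 := congrArg (fun p => Polynomial.coeff p i) h0
    simp only [Polynomial.coeff_map, Polynomial.coeff_zero] at h1
    rw [← hc] at h1
    change (MvPolynomial.aeval v) c = 0 at h1
    rwa [MvPolynomial.aeval_eq_eval] at h1
  let ψ : (MvPolynomial ι K ⧸ vI (coneOf Z)) →ₐ[K] Polynomial S :=
    Ideal.Quotient.liftₐ _ φ hker2
  have hψ : Function.Injective ψ := by
    rw [injective_iff_map_eq_zero]
    intro a ha
    obtain ⟨a, rfl⟩ := Ideal.Quotient.mkₐ_surjective K _ a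
    exact Ideal.Quotient.eq_zero_iff_mem.mpr (hker a ha)
  have h1 := trdeg_le_of_injective (R := K) (A := MvPolynomial ι K ⧸ vI (coneOf Z))
    (A' := Polynomial S) ψ hψ
  have h2 := trdeg_add_eq K S (A := Polynomial S)
  rw [Polynomial.trdeg_of_isDomain] at h2
  have hS : Algebra.trdeg K S < Cardinal.aleph0 := trdeg_lt_aleph0_of_finiteType
  rw [← h2] at h1
  have h3 := Cardinal.toNat_le_toNat h1 (Cardinal.add_lt_aleph0 hS Cardinal.one_lt_aleph0)
  rw [Cardinal.toNat_add hS Cardinal.one_lt_aleph0] at h3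
  simpa [td] using h3

attribute [local instance] MvPolynomial.gradedAlgebra

/-- projective set attached to affine one -/
def prj (V : Set (ι → K)) : Set (PP K ι) := {x | ∃ v ∈ V, v ≠ 0 ∧ v ∈ x.submodule}

lemma hom_mem_vI_prj {V : Set (ι → K)} (hV : ∀ v ∈ V, v ≠ 0) {f : MvPolynomial ι K} {d : ℕ}
    (hf : f.IsHomogeneous d) : f ∈ vI (coneOf (prj V)) ↔ f ∈ vI V := by
  rw [mem_vI, mem_vI]
  constructor
  · intro h v hv
    apply h
    rw [mem_coneOf_mk (hV v hv)]
    exact ⟨v, hv, hV v hv, (mem_submodule_iff (hV v hv)).mpr rfl⟩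
  · intro h w hw
    obtain ⟨x, ⟨v, hv, hv0, hvx⟩, hwx⟩ := mem_coneOf.mp hw
    rw [mem_submodule_iff hv0] at hvx
    rw [hvx, mem_submodule_mk] at hwx
    obtain ⟨c, rfl⟩ := hwx
    rw [eval_smul_hom hf, h v hv, mul_zero]

lemma prj_irr [Infinite K] {V : Set (ι → K)} (hV : ∀ v ∈ V, v ≠ 0) (hp : (vI V).IsPrime) :
    IsZIrreducible (zclosure (prj V)) := by
  obtain ⟨v, hv⟩ := (vI_prime_iff.mp hp).1
  have hne : (prj V).Nonempty := ⟨Projectivization.mk K v (hV v hv), v, hv, hV v hv,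
    (mem_submodule_iff (hV v hv)).mpr rfl⟩
  rw [irr_iff, vI_zclosure]
  refine ⟨hne.mono (subset_zclosure _), ?_⟩
  apply (vI_isHomogeneous (Z := coneOf (prj V))
      (fun v hv c => smul_mem_cone hv c)).isPrime_of_homogeneous_mem_or_mem
  · rw [Ideal.ne_top_iff_one, notMem_vI]
    exact ⟨0, zero_mem_cone hne, by simp⟩
  · rintro f g ⟨d, hf⟩ ⟨e, hg⟩ hfg
    rw [MvPolynomial.mem_homogeneousSubmodule] at hf hg
    rw [hom_mem_vI_prj hV (hf.mul hg)] at hfg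
    rw [hom_mem_vI_prj hV hf, hom_mem_vI_prj hV hg]
    exact hp.mem_or_mem hfg

lemma le_zdim [IsAlgClosed K] {Z : Set (PP K ι)} (hZ : IsZClosed Z) (hZi : IsZIrreducible Z) :
    ((td (vI (coneOf Z)) - 1 : ℕ) : WithBot ℕ∞) ≤ zdim Z := by
  have hK : Infinite K := IsAlgClosed.instInfinite
  obtain ⟨x, hx⟩ := hZi.1
  obtain ⟨j, hj⟩ := Function.ne_iff.mp x.rep_nonzero
  have hj : MvPolynomial.X j ∉ vI (coneOf Z) := notMem_vI.mpr ⟨_, rep_mem_cone hx, by simpa using hj⟩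
  have hJ := slice_prime hZi hj
  set J := vI (slice Z j) with hJdef
  obtain ⟨L, hL⟩ := primeChain K (MvPolynomial ι K ⧸ J)
  have hL' : td (vI (coneOf Z)) - 1 ≤ L.length := by
    have h := td_slice hZi hj
    have : L.length = td (vI (slice Z j)) := hL
    omega
  -- the zero locus of a prime
  let Qof : PrimeSpectrum (MvPolynomial ι K ⧸ J) → Ideal (MvPolynomial ι K) := fun q =>
    q.asIdeal.comap (Ideal.Quotient.mk J)
  have hQp : ∀ q, (Qof q).IsPrime := fun q => Ideal.IsPrime.comap _
  have hJQ : ∀ q, J ≤ Qof q := by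
    intro q f hf
    change Ideal.Quotient.mk J f ∈ q.asIdeal
    rw [Ideal.Quotient.eq_zero_iff_mem.mpr hf]; exact zero_mem _
  let V : PrimeSpectrum (MvPolynomial ι K ⧸ J) → Set (ι → K) := fun q =>
    MvPolynomial.zeroLocus K (Qof q)
  have hV : ∀ q, vI (V q) = Qof q := fun q => by
    have := hQp q
    exact MvPolynomial.IsPrime.vanishingIdeal_zeroLocus (Qof q)
  have hVmem : ∀ q, ∀ v ∈ V q, ∀ f ∈ Qof q, MvPolynomial.eval v f = 0 := by
    intro q v hv f hf
    rw [← hV q] at hf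
    exact mem_vI.mp hf v hv
  have hVj : ∀ q, ∀ v ∈ V q, v j = 1 := by
    intro q v hv
    have h1 : MvPolynomial.X j - 1 ∈ J := by
      rw [hJdef, mem_vI]
      intro w hw
      simp [hw.2]
    have := hVmem q v hv _ (hJQ q h1)
    simpa [sub_eq_zero] using this
  have hV0 : ∀ q, ∀ v ∈ V q, v ≠ 0 := by
    rintro q v hv rfl
    simpa using hVj q _ hv
  have hVp : ∀ q, (vI (V q)).IsPrime := fun q => by rw [hV]; exact hQp q
  let Y : PrimeSpectrum (MvPolynomial ι K ⧸ J) →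
      ({Y : Set (PP K ι) // IsZClosed Y ∧ IsZIrreducible Y ∧ Y ⊆ zclosure Z})ᵒᵈ := fun q =>
    OrderDual.toDual ⟨zclosure (prj (V q)), zclosure_isZClosed _, prj_irr (hV0 q) (hVp q), by
      rw [zclosure_eq, zclosure_eq]
      rintro y hy f ⟨⟨d, hd⟩, hf⟩ v hv
      refine hy f ⟨⟨d, hd⟩, ?_⟩ v hv
      rw [hom_mem_vI_prj (hV0 q) hd, hV]
      exact hJQ q (vI_anti (fun v hv => hv.1) hf)⟩
  have hYmono : StrictMono Y := by
    intro q q' hqq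
    have hle : Qof q ≤ Qof q' := Ideal.comap_mono hqq.le
    have hne : ∃ f, f ∈ Qof q' ∧ f ∉ Qof q := by
      obtain ⟨a, ha, ha'⟩ := SetLike.exists_of_lt (show q.asIdeal < q'.asIdeal from hqq)
      obtain ⟨f, rfl⟩ := Ideal.Quotient.mk_surjective a
      exact ⟨f, ha, ha'⟩
    obtain ⟨f, hf', hf⟩ := hne
    change zclosure (prj (V q')) < zclosure (prj (V q))
    refine lt_of_le_of_ne ?_ ?_
    · rw [zclosure_eq, zclosure_eq]
      rintro y hy f ⟨⟨d, hd⟩, hf⟩ v hv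
      refine hy f ⟨⟨d, hd⟩, ?_⟩ v hv
      rw [hom_mem_vI_prj (hV0 _) hd, hV] at hf ⊢
      exact hle hf
    · intro he
      have hev : ∀ q, hmg j f ∈ vI (coneOf (zclosure (prj (V q)))) ↔ f ∈ Qof q := by
        intro q
        rw [vI_zclosure, hom_mem_vI_prj (hV0 q) (hmg_hom j f), ← hV q, mem_vI, mem_vI]
        exact forall₂_congr fun v hv => by rw [eval_hmg j f v (hVj q v hv)]
      have h1 := (hev q').mpr hf'
      rw [he, hev] at h1
      exact hf h1
  have h1 : ((L.length : ℕ) : WithBot ℕ∞) ≤ zdim Z := by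
    unfold zdim
    rw [← Order.krullDim_orderDual]
    exact Order.LTSeries.length_le_krullDim (L.map Y hYmono)
  refine le_trans ?_ h1
  exact_mod_cast hL'

theorem zdim_eq [IsAlgClosed K] {Z : Set (PP K ι)} (hZ : IsZClosed Z) (hZi : IsZIrreducible Z) :
    zdim Z = ((td (vI (coneOf Z)) - 1 : ℕ) : WithBot ℕ∞) :=
  have : Infinite K := IsAlgClosed.instInfinite
  le_antisymm (zdim_le hZ hZi) (le_zdim hZ hZi)


-- Part 6

/-- row of a matrix-like vector -/
def row {κ : Type*} (u : κ × ι → K) (i : κ) : ι → K := fun a => u (i, a)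

/-- product of copies of `C` -/
def tup (C : Set (ι → K)) (κ : Type*) : Set (κ × ι → K) := {u | ∀ i, row u i ∈ C}

open Classical in
/-- replace a row -/
def slotMap {κ : Type*} (w : κ × ι → K) (i : κ) : κ × ι → MvPolynomial ι K :=
  fun p => if p.1 = i then MvPolynomial.X p.2 else MvPolynomial.C (w p)

lemma row_slot_same {κ : Type*} (w : κ × ι → K) (i : κ) (x : ι → K) :
    row (pmap (slotMap w i) x) i = x := by
  ext a; simp [row, pmap, slotMap]

lemma row_slot_ne {κ : Type*} (w : κ × ι → K) (i j : κ) (h : j ≠ i) (x : ι → K) :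
    row (pmap (slotMap w i) x) j = row w j := by
  ext a; simp [row, pmap, slotMap, h]

lemma slot_self {κ : Type*} (w : κ × ι → K) (i : κ) :
    pmap (slotMap w i) (row w i) = w := by
  ext ⟨j, a⟩
  by_cases h : j = i
  · subst h; simp [row, pmap, slotMap]
  · simp [row, pmap, slotMap, h]

lemma slot_mem {κ : Type*} {C : Set (ι → K)} {w : κ × ι → K} (hw : w ∈ tup C κ) (i : κ) {x : ι → K}
    (hx : x ∈ C) : pmap (slotMap w i) x ∈ tup C κ := by
  intro j
  by_cases h : j = i
  · subst h; rwa [row_slot_same]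
  · rw [row_slot_ne _ _ _ h]; exact hw j

lemma tup_nonempty {κ : Type*} {C : Set (ι → K)} (h : C.Nonempty) : (tup C κ).Nonempty := by
  obtain ⟨v, hv⟩ := h
  exact ⟨fun p => v p.2, fun i => hv⟩

lemma vI_prime_iff' {σ : Type*} {Z : Set (σ → K)} :
    (vI Z).IsPrime ↔ Z.Nonempty ∧ ∀ f g : MvPolynomial σ K,
    f ∉ vI Z → g ∉ vI Z → ∃ v ∈ Z, MvPolynomial.eval v f ≠ 0 ∧ MvPolynomial.eval v g ≠ 0 := by
  constructor
  · intro h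
    constructor
    · by_contra hne
      rw [Set.not_nonempty_iff_eq_empty] at hne
      apply h.ne_top
      rw [Ideal.eq_top_iff_one, mem_vI]
      simp [hne]
    · intro f g hf hg
      have : f * g ∉ vI Z := fun hh => (h.mem_or_mem hh).elim hf hg
      rw [notMem_vI] at this
      obtain ⟨v, hv, hh⟩ := this
      rw [map_mul] at hh
      exact ⟨v, hv, left_ne_zero_of_mul hh, right_ne_zero_of_mul hh⟩
  · rintro ⟨⟨v, hv⟩, h⟩
    refine ⟨?_, ?_⟩
    · rw [Ideal.ne_top_iff_one, notMem_vI]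
      exact ⟨v, hv, by simp⟩
    · intro f g hfg
      by_contra hh
      push Not at hh
      obtain ⟨w, hw, h1, h2⟩ := h f g hh.1 hh.2
      rw [mem_vI] at hfg
      have := hfg w hw
      rw [map_mul] at this
      exact (mul_ne_zero h1 h2) this

lemma tup_prime {κ : Type*} [Finite κ] {C : Set (ι → K)} (hC : (vI C).IsPrime) :
    (vI (tup C κ)).IsPrime := by
  classical
  have := Fintype.ofFinite κ
  have hC' := vI_prime_iff'.mp hC
  rw [vI_prime_iff']
  refine ⟨tup_nonempty hC'.1, fun f g hf hg => ?_⟩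
  have key : ∀ S : Finset κ, ∃ a ∈ tup C κ, ∃ b ∈ tup C κ, MvPolynomial.eval a f ≠ 0 ∧
      MvPolynomial.eval b g ≠ 0 ∧ ∀ i ∈ S, row a i = row b i := by
    intro S
    induction S using Finset.induction_on with
    | empty =>
      obtain ⟨a, ha, ha'⟩ := notMem_vI.mp hf
      obtain ⟨b, hb, hb'⟩ := notMem_vI.mp hg
      exact ⟨a, ha, b, hb, ha', hb', by simp⟩
    | insert i S hi ih =>
      obtain ⟨a, ha, b, hb, ha', hb', hab⟩ := ih
      obtain ⟨x, hx, h1, h2⟩ := hC'.2 (MvPolynomial.bind₁ (slotMap a i) f)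
        (MvPolynomial.bind₁ (slotMap b i) g)
        (notMem_vI.mpr ⟨row a i, ha i, by rwa [eval_bind1, slot_self]⟩)
        (notMem_vI.mpr ⟨row b i, hb i, by rwa [eval_bind1, slot_self]⟩)
      rw [eval_bind1] at h1 h2
      refine ⟨_, slot_mem ha i hx, _, slot_mem hb i hx, h1, h2, ?_⟩
      intro j hj
      by_cases h : j = i
      · subst h; rw [row_slot_same, row_slot_same]
      · rw [row_slot_ne _ _ _ h, row_slot_ne _ _ _ h]
        exact hab j ((Finset.mem_insert.mp hj).resolve_left h)
  obtain ⟨a, ha, b, hb, ha', hb', hab⟩ := key Finset.univ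
  have : a = b := by
    ext ⟨i, c⟩
    exact congrFun (hab i (Finset.mem_univ i)) c
  subst this
  exact ⟨a, ha, ha', hb'⟩

lemma tup_closed {κ : Type*} {C : Set (ι → K)}
    (hcl : ∀ v, (∀ p ∈ vI C, MvPolynomial.eval v p = 0) → v ∈ C) {u : κ × ι → K}
    (hu : ∀ p ∈ vI (tup C κ), MvPolynomial.eval u p = 0) : u ∈ tup C κ := by
  intro i
  apply hcl
  intro p hp
  have := hu (MvPolynomial.rename (fun a => (i, a)) p) (by
    rw [mem_vI]
    intro w hw
    rw [MvPolynomial.eval_rename]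
    exact mem_vI.mp hp _ (hw i))
  rwa [MvPolynomial.eval_rename] at this

/-- pull back along an injection of index sets -/
lemma rename_notMem {κ κ' : Type*} {C : Set (ι → K)} (hne : C.Nonempty) {e : κ → κ'}
    (he : Function.Injective e) {a : MvPolynomial (κ × ι) K} (ha : a ∉ vI (tup C κ)) :
    MvPolynomial.rename (Prod.map e id) a ∉ vI (tup C κ') := by
  classical
  obtain ⟨u, hu, h⟩ := notMem_vI.mp ha
  obtain ⟨v, hv⟩ := hne
  rw [notMem_vI]
  refine ⟨fun p => if h : ∃ i, e i = p.1 then u (h.choose, p.2) else v p.2, ?_, ?_⟩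
  · intro i
    by_cases h : ∃ j, e j = i
    · have h1 := hu h.choose
      have : row (fun p : κ' × ι => if h : ∃ i, e i = p.1 then u (h.choose, p.2) else v p.2) i
          = row u h.choose := by
        funext a; simp only [row]; rw [dif_pos h]
      rw [this]; exact h1
    · have : row (fun p : κ' × ι => if h : ∃ i, e i = p.1 then u (h.choose, p.2) else v p.2) i
          = v := by
        funext a; simp only [row]; rw [dif_neg h]
      rw [this]; exact hv
  · rw [MvPolynomial.eval_rename]
    convert h using 3
    funext ⟨i, a⟩
    have hex : ∃ j, e j = e i := ⟨i, rfl⟩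
    have : hex.choose = i := he hex.choose_spec
    change (if h : ∃ j, e j = e i then u (h.choose, a) else v a) = _
    rw [dif_pos hex, this]

lemma eval_rename_row {κ κ' : Type*} (e : κ → κ') (a : MvPolynomial (κ × ι) K) (u : κ' × ι → K) :
    MvPolynomial.eval u (MvPolynomial.rename (Prod.map e id) a) =
      MvPolynomial.eval (fun p : κ × ι => u (e p.1, p.2)) a := by
  rw [MvPolynomial.eval_rename]; rfl

/-- generic independence -/
lemma indep_gen {μ : Type*} [Fintype μ] {C : Set (ι → K)} (H : μ → MvPolynomial ι K)
    (hH : LinearIndependent K (fun j : μ => (fun v : C => MvPolynomial.eval (v : ι → K) (H j))))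
    (k : ℕ) (hk : k ≤ Fintype.card μ) :
    ∃ G : MvPolynomial (Fin k × ι) K, G ∉ vI (tup C (Fin k)) ∧ ∀ u, MvPolynomial.eval u G ≠ 0 →
      LinearIndependent K (fun i : Fin k => fun j : μ => MvPolynomial.eval (row u i) (H j)) := by
  classical
  let s : Set (μ → K) := {w | ∃ v ∈ C, w = fun j => MvPolynomial.eval v (H j)}
  have hs : Submodule.span K s = ⊤ := by
    by_contra hne
    obtain ⟨φ, hφ, hφ'⟩ := Submodule.exists_le_ker_of_lt_top _ (lt_top_iff_ne_top.mpr hne)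
    apply hφ
    have h0 : ∀ v ∈ C, ∑ j, φ (Pi.single j 1) * MvPolynomial.eval v (H j) = 0 := by
      intro v hv
      have : φ (fun j => MvPolynomial.eval v (H j)) = 0 :=
        hφ' (Submodule.subset_span ⟨v, hv, rfl⟩)
      rw [LinearMap.pi_apply_eq_sum_univ φ] at this
      rw [← this]
      apply Finset.sum_congr rfl
      intro j _
      rw [smul_eq_mul, mul_comm]
      congr 2
      ext i; simp [Pi.single_apply, eq_comm]
    rw [Fintype.linearIndependent_iff] at hH
    have h1 := hH (fun j => φ (Pi.single j 1)) (by
      ext v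
      simpa using h0 v.1 v.2)
    apply LinearMap.pi_ext'
    intro j
    ext
    simpa using h1 j
  obtain ⟨f, hf, -, hfi⟩ := Submodule.exists_fun_fin_finrank_span_eq K s
  have hfr : Module.finrank K (Submodule.span K s) = Fintype.card μ := by
    rw [hs, finrank_top, Module.finrank_fintype_fun_eq_card]
  let f' : Fin k → (μ → K) := fun i => f (Fin.castLE (hk.trans hfr.ge) i)
  have hf' : LinearIndependent K f' := hfi.comp _ (Fin.castLE_injective _)
  have hv : ∀ i, ∃ v ∈ C, f' i = fun j => MvPolynomial.eval v (H j) := fun i => hf _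
  choose v hvC hv using hv
  obtain ⟨L, hL⟩ := (Fintype.linearCombination K f').exists_leftInverse_of_injective
    (by
      rw [LinearMap.ker_eq_bot]
      exact hf'.fintypeLinearCombination_injective)
  have hL' : ∀ i, L (f' i) = Pi.single i 1 := by
    intro i
    have := LinearMap.congr_fun hL (Pi.single i 1)
    simpa using this
  let A : Matrix (Fin k) (Fin k) (MvPolynomial (Fin k × ι) K) := fun i j =>
    ∑ l, MvPolynomial.C (L (Pi.single l 1) j) * MvPolynomial.rename (fun a => (i, a)) (H l)
  have hA : ∀ u : Fin k × ι → K, (A.map (MvPolynomial.eval u)) =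
      fun i j => L (fun l => MvPolynomial.eval (row u i) (H l)) j := by
    intro u
    ext i j
    have h1 : (fun l => MvPolynomial.eval (row u i) (H l)) =
      ∑ l, MvPolynomial.eval (row u i) (H l) • (Pi.single l 1 : μ → K) := by
      ext l; simp [Finset.sum_apply, Pi.single_apply]
    rw [h1]
    change MvPolynomial.eval u (∑ l, MvPolynomial.C (L (Pi.single l 1) j) * MvPolynomial.rename (fun a => (i, a)) (H l)) = _
    simp only [ map_sum, map_mul, MvPolynomial.eval_C,
      MvPolynomial.eval_rename, map_smul, Finset.sum_apply, Pi.smul_apply, smul_eq_mul]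
    apply Finset.sum_congr rfl
    intro l _
    rw [mul_comm]; rfl
  refine ⟨A.det, ?_, ?_⟩
  · rw [notMem_vI]
    refine ⟨fun p => v p.1 p.2, fun i => hvC i, ?_⟩
    rw [RingHom.map_det, RingHom.mapMatrix_apply, hA]
    have : (fun i j => L (fun l => MvPolynomial.eval (row (fun p : Fin k × ι => v p.1 p.2) i) (H l)) j)
      = (1 : Matrix (Fin k) (Fin k) K) := by
      ext i j
      have h2 := hL' i
      rw [hv i] at h2
      change L (fun l => MvPolynomial.eval (v i) (H l)) j = _
      rw [h2, Matrix.one_apply, Pi.single_apply]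
      simp [eq_comm]
    rw [this]; simp
  · intro u hu
    rw [RingHom.map_det, RingHom.mapMatrix_apply, hA] at hu
    have h3 : LinearIndependent K (fun i => L (fun l => MvPolynomial.eval (row u i) (H l))) :=
      Matrix.linearIndependent_rows_of_det_ne_zero hu
    exact LinearIndependent.of_comp L h3


-- Part 7

/-- forms in `E` orthogonal to `u` -/
def perp (E : Submodule K (ι → K)) (u : ι → K) : Submodule K (ι → K) where
  carrier := {h | h ∈ E ∧ dotProduct h u = 0}
  add_mem' := by
    rintro a b ⟨h1, h2⟩ ⟨h3, h4⟩
    exact ⟨E.add_mem h1 h3, by rw [add_dotProduct, h2, h4, add_zero]⟩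
  zero_mem' := ⟨E.zero_mem, zero_dotProduct _⟩
  smul_mem' := by
    rintro c a ⟨h1, h2⟩
    exact ⟨E.smul_mem c h1, by rw [smul_dotProduct, h2, smul_zero]⟩

lemma mem_perp {E : Submodule K (ι → K)} {u h : ι → K} :
    h ∈ perp E u ↔ h ∈ E ∧ dotProduct h u = 0 := Iff.rfl

/-- the projection of `C` given by `E` is still generically finite -/
def TR (n : ℕ) (C : Set (ι → K)) (E : Submodule K (ι → K)) : Prop :=
  ∃ e : Fin (n + 1) → (ι → K), (∀ i, e i ∈ E) ∧ ∀ p : MvPolynomial (Fin (n + 1)) K,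
    (∀ u ∈ C, MvPolynomial.eval (fun i => dotProduct (e i) u) p = 0) → p = 0

lemma lemmaQ [Infinite K] {κ : Type*} (B : Polynomial (MvPolynomial κ K)) (hB : B ≠ 0) :
    ∃ b0 : MvPolynomial κ K, b0 ≠ 0 ∧ ∀ (Y0 Y1 : κ → K) (c : K), c ≠ 0 →
      (∀ t : K, Polynomial.eval₂ (MvPolynomial.eval (fun i => Y0 i + t * Y1 i)) (t * c) B = 0) →
      MvPolynomial.eval Y0 b0 = 0 := by
  obtain ⟨B', hB', hd⟩ := Polynomial.exists_eq_pow_rootMultiplicity_mul_and_not_dvd B hB 0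
  set m := Polynomial.rootMultiplicity 0 B
  rw [map_zero, sub_zero] at hB' hd
  rw [Polynomial.X_dvd_iff] at hd
  refine ⟨B'.coeff 0, hd, ?_⟩
  intro Y0 Y1 c hc h
  let θ : MvPolynomial κ K →+* Polynomial K :=
    (MvPolynomial.aeval (fun i => Polynomial.C (Y0 i) + Polynomial.X * Polynomial.C (Y1 i))).toRingHom
  let q : Polynomial K := Polynomial.eval₂ θ (Polynomial.X * Polynomial.C c) B'
  have hθ : ∀ t, (Polynomial.evalRingHom t).comp θ = MvPolynomial.eval (fun i => Y0 i + t * Y1 i) := by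
    intro t
    apply MvPolynomial.ringHom_ext
    · intro r; simp [θ]
    · intro i; simp [θ]; ring
  have hq : ∀ t, q.eval t =
      Polynomial.eval₂ (MvPolynomial.eval (fun i => Y0 i + t * Y1 i)) (t * c) B' := by
    intro t
    have := Polynomial.hom_eval₂ B' θ (Polynomial.evalRingHom t) (Polynomial.X * Polynomial.C c)
    rw [hθ] at this
    have h9 : Polynomial.evalRingHom t (Polynomial.X * Polynomial.C c) = t * c := by
      rw [map_mul]; simp
    rw [h9] at this
    exact this
  have hq0 : q = 0 := by
    have : Polynomial.X * q = 0 := by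
      apply Polynomial.funext
      intro t
      rw [Polynomial.eval_mul, Polynomial.eval_X, Polynomial.eval_zero]
      by_cases ht : t = 0
      · rw [ht, zero_mul]
      · have h1 := h t
        rw [hB', Polynomial.eval₂_mul, Polynomial.eval₂_pow, Polynomial.eval₂_X] at h1
        rw [hq]
        have h2 := (mul_eq_zero.mp h1).resolve_left (pow_ne_zero _ (mul_ne_zero ht hc))
        rw [h2, mul_zero]
    exact (mul_eq_zero.mp this).resolve_left Polynomial.X_ne_zero
  have h3 := hq 0
  rw [hq0] at h3
  simp only [Polynomial.eval_zero, zero_mul, add_zero] at h3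
  rw [Polynomial.eval₂_at_zero] at h3
  exact h3.symm

lemma P_1 [Infinite K] {n : ℕ} {C : Set (ι → K)} (hC : (vI C).IsPrime) {E : Submodule K (ι → K)}
    (hE : TR n C E) {g : MvPolynomial ι K} (hg : g ∉ vI C) (a : MvPolynomial (Fin n × ι) K)
    (ha : ∀ u ∈ C, MvPolynomial.eval u g ≠ 0 → ∀ h : Fin n × ι → K, (∀ p, row h p ∈ perp E u) →
      MvPolynomial.eval h a = 0) (h0 : Fin n × ι → K) (hh0 : ∀ p, row h0 p ∈ E) :
    MvPolynomial.eval h0 a = 0 := by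
  classical
  obtain ⟨e, he, htr⟩ := hE
  let κ := Fin n × Fin (n + 1)
  let B : Polynomial (MvPolynomial κ K) := MvPolynomial.aeval (fun q : Fin n × ι =>
    Polynomial.X * Polynomial.C (MvPolynomial.C (h0 q)) +
      Polynomial.C (∑ j, MvPolynomial.X (q.1, j) * MvPolynomial.C (e j q.2))) a
  have hBe : ∀ (t : K) (Y : κ → K), Polynomial.eval₂ (MvPolynomial.eval Y) t B =
      MvPolynomial.eval (fun q => t * h0 q + ∑ j, Y (q.1, j) * e j q.2) a := by
    intro t Y
    let f : Polynomial (MvPolynomial κ K) →ₐ[K] K :=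
      { Polynomial.eval₂RingHom (MvPolynomial.eval Y) t with
        commutes' := by intro r; simp [Polynomial.algebraMap_apply] }
    have h1 := map_aeval' f (fun q : Fin n × ι =>
      Polynomial.X * Polynomial.C (MvPolynomial.C (h0 q)) +
      Polynomial.C (∑ j, MvPolynomial.X (q.1, j) * MvPolynomial.C (e j q.2))) a
    have h2 : ∀ b, f b = Polynomial.eval₂ (MvPolynomial.eval Y) t b := fun b => rfl
    rw [← h2]
    rw [h1, MvPolynomial.aeval_eq_eval]
    change MvPolynomial.eval _ a = _
    congr 2
    funext q
    rw [h2]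
    rw [Polynomial.eval₂_add, Polynomial.eval₂_mul, Polynomial.eval₂_X, Polynomial.eval₂_C,
      Polynomial.eval₂_C]
    simp
  by_cases hB : B = 0
  · have := hBe 1 0
    rw [hB, Polynomial.eval₂_zero] at this
    simpa using this.symm
  exfalso
  obtain ⟨b0, hb0, hQ⟩ := lemmaQ B hB
  have hx0 : ∃ g' : MvPolynomial ι K, (∀ u, MvPolynomial.eval u g' = dotProduct (e 0) u) := by
    refine ⟨∑ i, MvPolynomial.C (e 0 i) * MvPolynomial.X i, fun u => ?_⟩
    simp [dotProduct]
  obtain ⟨x0, hx0⟩ := hx0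
  have hx0n : x0 ∉ vI C := by
    intro hh
    have := htr (MvPolynomial.X 0) (fun u hu => by
      rw [MvPolynomial.eval_X, ← hx0]; exact mem_vI.mp hh u hu)
    exact MvPolynomial.X_ne_zero _ this
  -- main vanishing
  have h1 : ∀ (y : Fin n → Fin n → K) (x : Fin (n + 1) → K),
      MvPolynomial.eval (fun q : κ => Fin.cases (motive := fun _ => K) (-∑ j, y q.1 j * x j.succ)
        (fun j => x 0 * y q.1 j) q.2) b0 = 0 := by
    intro y
    let Ψ : κ → MvPolynomial (Fin (n + 1)) K := fun q =>
      Fin.cases (motive := fun _ => MvPolynomial (Fin (n + 1)) K)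
        (-∑ j, MvPolynomial.C (y q.1 j) * MvPolynomial.X j.succ)
        (fun j => MvPolynomial.X 0 * MvPolynomial.C (y q.1 j)) q.2
    have hΨ : ∀ x, pmap Ψ x = (fun q : κ => Fin.cases (motive := fun _ => K)
        (-∑ j, y q.1 j * x j.succ) (fun j => x 0 * y q.1 j) q.2) := by
      intro x
      funext ⟨p, j⟩
      refine Fin.cases ?_ (fun j => ?_) j
      · simp [pmap, Ψ]
      · simp [pmap, Ψ]
    have hz : MvPolynomial.bind₁ Ψ b0 = 0 := by
      apply htr
      intro u hu
      -- polynomial in u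
      let P : MvPolynomial ι K := MvPolynomial.bind₁
        (fun i => ∑ l, MvPolynomial.C (e i l) * MvPolynomial.X l) (MvPolynomial.bind₁ Ψ b0)
      have hP : ∀ u, MvPolynomial.eval u P =
          MvPolynomial.eval (fun i => dotProduct (e i) u) (MvPolynomial.bind₁ Ψ b0) := by
        intro u
        simp only [P]
        rw [eval_bind1]
        congr 2
        funext i
        simp [pmap, dotProduct]
      have hm : P * g * x0 ∈ vI C := by
        rw [mem_vI]
        intro u hu
        rw [map_mul, map_mul, hP, hx0]
        by_cases hgu : MvPolynomial.eval u g = 0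
        · rw [hgu]; ring
        by_cases hxu : dotProduct (e 0) u = 0
        · rw [hxu]; ring
        rw [eval_bind1, hΨ]
        have := hQ (fun q : κ => Fin.cases (motive := fun _ => K)
          (-∑ j, y q.1 j * dotProduct (e j.succ) u) (fun j => dotProduct (e 0) u * y q.1 j) q.2)
          (fun q : κ => Fin.cases (motive := fun _ => K) (- dotProduct (row h0 q.1) u)
            (fun _ => 0) q.2) (dotProduct (e 0) u) hxu (by
          intro t
          rw [hBe]
          apply ha u hu hgu
          intro p
          have hrow : row (fun q : Fin n × ι => t * dotProduct (e 0) u * h0 q +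
              ∑ j, ((Fin.cases (motive := fun _ => K)
          (-∑ j, y q.1 j * dotProduct (e j.succ) u) (fun j => dotProduct (e 0) u * y q.1 j) j) +
              t * (Fin.cases (motive := fun _ => K) (- dotProduct (row h0 q.1) u)
            (fun _ => 0) j)) * e j q.2) p = (t * dotProduct (e 0) u) • row h0 p +
              ((-∑ j, y p j * dotProduct (e j.succ) u - t * dotProduct (row h0 p) u) • e 0 +
              ∑ j, (dotProduct (e 0) u * y p j) • e (Fin.succ j)) := by
            funext l
            simp only [row, Pi.add_apply, Pi.smul_apply, Finset.sum_apply, smul_eq_mul]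
            rw [Fin.sum_univ_succ]
            simp only [Fin.cases_zero, Fin.cases_succ]
            congr 2
            · ring
            · apply Finset.sum_congr rfl
              intro j _
              ring
          rw [hrow, mem_perp]
          constructor
          · refine E.add_mem (E.smul_mem _ (hh0 p)) (E.add_mem (E.smul_mem _ (he 0))
              (E.sum_mem fun j _ => E.smul_mem _ (he _)))
          · rw [add_dotProduct, add_dotProduct, sum_dotProduct]
            simp only [smul_dotProduct, smul_eq_mul]
            have : ∑ j : Fin n, dotProduct (e 0) u * y p j * dotProduct (e j.succ) u =
              dotProduct (e 0) u * ∑ j, y p j * dotProduct (e j.succ) u := by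
              rw [Finset.mul_sum]; apply Finset.sum_congr rfl; intros; ring
            rw [this]; ring)
        rw [this]; ring
      have h5 : P ∈ vI C :=
        (hC.mem_or_mem ((hC.mem_or_mem hm).resolve_right hx0n)).resolve_right hg
      rw [← hP]
      exact mem_vI.mp h5 u hu
    intro x
    have := eval_bind1 Ψ x b0
    rw [hz, map_zero, hΨ] at this
    exact this.symm
  -- det
  let dM : Matrix (Fin n) (Fin n) (MvPolynomial κ K) := fun p j => MvPolynomial.X (p, j.succ)
  have hdM : ∀ y, MvPolynomial.eval y dM.det =
      Matrix.det (fun p j => y (p, Fin.succ j) : Matrix (Fin n) (Fin n) K) := by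
    intro y
    rw [RingHom.map_det]
    congr 1
    ext p j
    change MvPolynomial.eval y (MvPolynomial.X (p, j.succ)) = _
    simp
  have hdet : dM.det ≠ 0 := by
    intro hh
    have := hdM (fun q => Fin.cases (motive := fun _ => K) 0 (fun j => (1 : Matrix (Fin n) (Fin n) K) q.1 j) q.2)
    rw [hh, map_zero] at this
    simp only [Fin.cases_succ] at this
    change 0 = Matrix.det (1 : Matrix (Fin n) (Fin n) K) at this
    simp at this
  apply mul_ne_zero hb0 hdet
  apply MvPolynomial.funext
  intro y
  rw [map_mul, map_zero, hdM]
  by_cases hd : Matrix.det (fun p j => y (p, Fin.succ j) : Matrix (Fin n) (Fin n) K) = 0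
  · rw [hd, mul_zero]
  let A : Matrix (Fin n) (Fin n) K := fun p j => y (p, Fin.succ j)
  have hA : IsUnit A.det := isUnit_iff_ne_zero.mpr hd
  let x' : Fin n → K := - A⁻¹.mulVec (fun p => y (p, 0))
  have hx' : A.mulVec x' = - (fun p => y (p, 0)) := by
    simp only [x', Matrix.mulVec_neg, Matrix.mulVec_mulVec, Matrix.mul_nonsing_inv A hA,
      Matrix.one_mulVec]
  have h6 := h1 A (Fin.cases (motive := fun _ => K) 1 x')
  simp only [Fin.cases_zero, Fin.cases_succ, one_mul] at h6
  have : (fun q : κ => Fin.cases (motive := fun _ => K) (-∑ j, A q.1 j * x' j) (fun j => A q.1 j) q.2) = y := by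
    funext ⟨p, j⟩
    refine Fin.cases ?_ (fun j => rfl) j
    have := congrFun hx' p
    change ∑ j, A p j * x' j = - y (p, 0) at this
    change -∑ j, A p j * x' j = _
    rw [this, neg_neg]
  rw [this] at h6
  rw [h6, zero_mul]


-- Part 8

lemma rk_step {K A : Type*} [Field K] [CommRing A] [IsDomain A] [Algebra K A] (s : Set A) (n : ℕ)
    (hs : ¬∃ f : Fin (n + 1) → A, (∀ i, f i ∈ s) ∧ AlgebraicIndependent K f)
    (f : Fin (n + 1) → A) (hf : AlgebraicIndependent K f)
    (hfs : ∀ i, IsAlgebraic (Algebra.adjoin K s) (f i)) : False := by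
  classical
  have hsub : Set.range f ⊆ (AlgebraicIndependent.matroid K A).closure s := by
    rintro _ ⟨i, rfl⟩
    rw [AlgebraicIndependent.matroid_closure_eq]
    exact hfs i
  have h1 : (AlgebraicIndependent.matroid K A).eRk (Set.range f) = ((n + 1 : ℕ) : ℕ∞) := by
    rw [Matroid.Indep.eRk_eq_encard]
    · rw [← Set.image_univ, hf.injective.encard_image, Set.encard_univ]
      simp
    · rw [AlgebraicIndependent.matroid_indep_iff]
      exact hf.coe_range
  have h2 := (AlgebraicIndependent.matroid K A).eRk_mono hsub
  rw [h1, Matroid.eRk_closure_eq] at h2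
  obtain ⟨I, hI⟩ := (AlgebraicIndependent.matroid K A).exists_isBasis s
  rw [← hI.encard_eq_eRk] at h2
  obtain ⟨t, ht, htc⟩ := Set.exists_subset_encard_eq h2
  have hind : AlgebraicIndepOn K id t := (hI.indep.subset ht)
  have hfin : t.Finite := Set.finite_of_encard_eq_coe htc
  have := hfin.fintype
  have hc : Fintype.card t = n + 1 := by
    rw [Set.encard_eq_coe_toFinset_card, Set.toFinset_card] at htc
    exact_mod_cast htc
  let e : Fin (n + 1) ≃ t := (Fintype.equivFinOfCardEq hc).symm
  apply hs
  refine ⟨fun i => (e i : A), fun i => hI.subset (ht (e i).2), ?_⟩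
  exact AlgebraicIndependent.comp hind e e.injective

/-- linear forms as elements of the coordinate ring -/
def ell (C : Set (ι → K)) : (ι → K) →ₗ[K] (MvPolynomial ι K ⧸ vI C) where
  toFun e := Ideal.Quotient.mkₐ K (vI C) (∑ i, MvPolynomial.C (e i) * MvPolynomial.X i)
  map_add' := by
    intro x y
    rw [← map_add, ← Finset.sum_add_distrib]
    congr 1
    apply Finset.sum_congr rfl
    intro i _
    simp [add_mul]
  map_smul' := by
    intro c x
    rw [RingHom.id_apply, ← map_smul, Finset.smul_sum]
    congr 1
    apply Finset.sum_congr rfl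
    intro i _
    simp [MvPolynomial.smul_eq_C_mul, mul_assoc]

lemma ell_zero_iff {C : Set (ι → K)} {κ : Type*} (e : κ → ι → K) (p : MvPolynomial κ K) :
    MvPolynomial.aeval (fun i => ell C (e i)) p = 0 ↔
      ∀ u ∈ C, MvPolynomial.eval (fun i => dotProduct (e i) u) p = 0 := by
  have h1 := map_aeval' (Ideal.Quotient.mkₐ K (vI C))
    (fun i => ∑ l, MvPolynomial.C (e i l) * MvPolynomial.X l) p
  change _ = MvPolynomial.aeval (fun i => ell C (e i)) p at h1
  rw [← h1, Ideal.Quotient.mkₐ_eq_mk, Ideal.Quotient.eq_zero_iff_mem, mem_vI]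
  apply forall₂_congr
  intro u hu
  have h2 := eval_bind1 (fun i => ∑ l, MvPolynomial.C (e i l) * MvPolynomial.X l) u p
  change MvPolynomial.eval u (MvPolynomial.aeval _ p) = _ at h2
  rw [h2]
  have : pmap (fun i => ∑ l, MvPolynomial.C (e i l) * MvPolynomial.X l) u =
      fun i => dotProduct (e i) u := by
    funext i; simp [pmap, dotProduct]
  rw [this]

lemma TR_iff {n : ℕ} {C : Set (ι → K)} {E : Submodule K (ι → K)} :
    TR n C E ↔ ∃ e : Fin (n + 1) → (ι → K), (∀ i, e i ∈ E) ∧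
      AlgebraicIndependent K (fun i => ell C (e i)) := by
  unfold TR
  simp only [algebraicIndependent_iff, ell_zero_iff]

lemma TR_top {n : ℕ} {C : Set (ι → K)} (hC : (vI C).IsPrime) (htd : td (vI C) = n + 1) :
    TR n C ⊤ := by
  classical
  rw [TR_iff]
  set A := MvPolynomial ι K ⧸ vI C
  have hd : IsDomain A := Ideal.Quotient.isDomain _
  let s : Set A := Set.range (fun i : ι => ell C (Pi.single i 1))
  have hX : ∀ i, ell C (Pi.single i 1) = Ideal.Quotient.mkₐ K (vI C) (MvPolynomial.X i) := by
    intro i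
    change Ideal.Quotient.mkₐ K (vI C) _ = _
    congr 1
    rw [Finset.sum_eq_single i]
    · simp
    · intro b _ hb
      simp [Pi.single_apply, hb]
    · simp
  have hs : Algebra.adjoin K s = ⊤ := by
    have h1 : s = (Ideal.Quotient.mkₐ K (vI C)) '' (Set.range MvPolynomial.X) := by
      ext a
      simp only [s, hX, Set.mem_range, Set.mem_image, exists_exists_eq_and]
    rw [h1, ← AlgHom.map_adjoin, MvPolynomial.adjoin_range_X, Algebra.map_top,
      AlgHom.range_eq_top]
    exact Ideal.Quotient.mkₐ_surjective _ _
  have halg : Algebra.IsAlgebraic (Algebra.adjoin K s) A := by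
    constructor
    intro a
    have : a ∈ Algebra.adjoin K s := by rw [hs]; trivial
    exact isAlgebraic_algebraMap (⟨a, this⟩ : Algebra.adjoin K s)
  obtain ⟨t, hts, ht⟩ := exists_isTranscendenceBasis_subset (R := K) s
  have hc := ht.cardinalMk_eq_trdeg
  have hlt : Algebra.trdeg K A < Cardinal.aleph0 := trdeg_lt_aleph0_of_finiteType
  have hfin : Finite t := by rw [← Cardinal.lt_aleph0_iff_finite, hc]; exact hlt
  have := Fintype.ofFinite t
  have hcard : Fintype.card t = n + 1 := by
    rw [← htd]
    unfold td
    change _ = (Algebra.trdeg K A).toNat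
    rw [← hc]; simp
  let e : Fin (n + 1) ≃ t := (Fintype.equivFinOfCardEq hcard).symm
  have hch : ∀ i, ∃ l : ι, ell C (Pi.single l 1) = (e i : A) := fun i => hts (e i).2
  choose l hl using hch
  refine ⟨fun i => Pi.single (l i) 1, fun _ => trivial, ?_⟩
  simp only [hl]
  exact AlgebraicIndependent.comp ht.1 e e.injective

lemma TR_key {n : ℕ} {C : Set (ι → K)} (hC : (vI C).IsPrime) {E : Submodule K (ι → K)}
    (hE : TR n C E) (u : ι → K) (hu : ¬ TR n C (perp E u)) {κ : Type*} (e : κ → ι → K)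
    (he : ∀ i, e i ∈ E) (p : MvPolynomial κ K)
    (hp : ∀ c ∈ C, MvPolynomial.eval (fun i => dotProduct (e i) c) p = 0) (c : ι → K) (hc : c ∈ C) :
    MvPolynomial.eval (fun i => dotProduct (e i) (c + u)) p = 0 := by
  classical
  have hd : IsDomain (MvPolynomial ι K ⧸ vI C) := Ideal.Quotient.isDomain _
  have hx : ∃ x ∈ E, dotProduct x u = 1 := by
    by_contra hno
    push Not at hno
    apply hu
    obtain ⟨e', he', h'⟩ := hE
    refine ⟨e', fun i => ⟨he' i, ?_⟩, h'⟩
    by_contra hne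
    apply hno _ (E.smul_mem (dotProduct (e' i) u)⁻¹ (he' i))
    rw [smul_dotProduct, smul_eq_mul, inv_mul_cancel₀ hne]
  obtain ⟨x, hxE, hxu⟩ := hx
  let s : Set (MvPolynomial ι K ⧸ vI C) := ell C '' (perp E u : Set (ι → K))
  have hdec : ∀ y ∈ E, y - (dotProduct y u) • x ∈ perp E u := by
    intro y hy
    refine ⟨E.sub_mem hy (E.smul_mem _ hxE), ?_⟩
    rw [sub_dotProduct, smul_dotProduct, hxu]; simp
  have hs : ¬∃ f : Fin (n + 1) → (MvPolynomial ι K ⧸ vI C), (∀ i, f i ∈ s) ∧ AlgebraicIndependent K f := by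
    rintro ⟨f, hf, hfi⟩
    apply hu
    rw [TR_iff]
    choose e' he' h' using hf
    refine ⟨e', he', ?_⟩
    simpa only [h'] using hfi
  let S0 := Algebra.adjoin K s
  have htrans : Transcendental S0 (ell C x) := by
    intro halg
    obtain ⟨f, hf, hfi⟩ := TR_iff.mp hE
    apply rk_step s n hs _ hfi
    intro i
    have h1 : f i = (f i - (dotProduct (f i) u) • x) + (dotProduct (f i) u) • x := by simp
    rw [h1, map_add, map_smul]
    apply IsAlgebraic.add
    · exact isAlgebraic_algebraMap (⟨_, Algebra.subset_adjoin ⟨_, hdec _ (hf i), rfl⟩⟩ : S0)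
    · have h8 : (dotProduct (f i) u) • (ell C x) = algebraMap K _ (dotProduct (f i) u) * ell C x :=
        Algebra.smul_def (dotProduct (f i) u) (ell C x)
      refine (congrArg (IsAlgebraic S0) h8).mpr ?_
      exact IsAlgebraic.mul (isAlgebraic_algebraMap (algebraMap K S0 (dotProduct (f i) u))) halg
  let y : κ → S0 := fun i => ⟨ell C (e i - (dotProduct (e i) u) • x),
    Algebra.subset_adjoin ⟨_, hdec _ (he i), rfl⟩⟩
  let q : Polynomial S0 := MvPolynomial.aeval (fun i => Polynomial.C (y i) +
    Polynomial.C (algebraMap K S0 (dotProduct (e i) u)) * Polynomial.X) p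
  have hq : ∀ z : MvPolynomial ι K ⧸ vI C, Polynomial.aeval z q =
      MvPolynomial.aeval (fun i => ell C (e i - (dotProduct (e i) u) • x) + (dotProduct (e i) u) • z) p := by
    intro z
    have h1 := map_aeval' ((Polynomial.aeval (R := S0) z).restrictScalars K) (fun i => Polynomial.C (y i) +
      Polynomial.C (algebraMap K S0 (dotProduct (e i) u)) * Polynomial.X) p
    change Polynomial.aeval z q = _ at h1
    rw [h1]
    congr 2
    funext i
    change Polynomial.aeval z _ = _
    rw [map_add, map_mul, Polynomial.aeval_C, Polynomial.aeval_C, Polynomial.aeval_X,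
      Algebra.smul_def (dotProduct (e i) u) z]
    rfl
  have hq0 : q = 0 := by
    by_contra hne
    apply htrans
    refine ⟨q, hne, ?_⟩
    rw [hq]
    rw [← (ell_zero_iff e p).mpr hp]
    congr 2
    funext i
    rw [← map_smul, ← map_add]; simp
  have h2 := hq (ell C x + 1)
  rw [hq0, map_zero] at h2
  -- evaluate at c
  let ev : (MvPolynomial ι K ⧸ vI C) →ₐ[K] K := Ideal.Quotient.liftₐ (vI C) (MvPolynomial.aeval c)
    (fun a ha => by rw [MvPolynomial.aeval_eq_eval]; exact mem_vI.mp ha c hc)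
  have hev : ∀ w, ev (ell C w) = dotProduct w c := by
    intro w
    change ev (Ideal.Quotient.mk (vI C) _) = _
    have : ev (Ideal.Quotient.mk (vI C) (∑ i, MvPolynomial.C (w i) * MvPolynomial.X i)) =
      MvPolynomial.aeval c (∑ i, MvPolynomial.C (w i) * MvPolynomial.X i) := rfl
    rw [this]
    simp [dotProduct]
  have h3 := congrArg ev h2
  rw [map_zero, map_aeval', MvPolynomial.aeval_eq_eval] at h3
  rw [h3]
  change _ = MvPolynomial.eval _ p
  congr 2
  funext i
  rw [map_add, map_smul, map_add, hev, hev, map_one, sub_dotProduct, smul_dotProduct,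
    dotProduct_add]
  simp only [smul_eq_mul]; ring

lemma TRstep [Infinite K] {n : ℕ} {C : Set (ι → K)} (hC : (vI C).IsPrime)
    (hsm : ∀ (c : K), ∀ v ∈ C, c • v ∈ C)
    (hsp : Submodule.span K C = ⊤) (htd : td (vI C) = n + 1) {E : Submodule K (ι → K)}
    (hE : TR n C E) (hfr : n + 2 ≤ Module.finrank K E) :
    ∃ G : MvPolynomial ι K, G ∉ vI C ∧ ∀ u ∈ C, MvPolynomial.eval u G ≠ 0 → TR n C (perp E u) := by
  classical
  have hd : IsDomain (MvPolynomial ι K ⧸ vI C) := Ideal.Quotient.isDomain _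
  obtain ⟨f, hf⟩ := exists_linearIndependent_of_le_finrank hfr
  let e : Fin (n + 2) → ι → K := fun i => (f i : ι → K)
  have he : ∀ i, e i ∈ E := fun i => (f i).2
  have hei : LinearIndependent K e := hf.map' E.subtype (Submodule.ker_subtype E)
  have hna : ¬ AlgebraicIndependent K (fun i => ell C (e i)) := by
    intro h
    have h1 := h.lift_cardinalMk_le_trdeg
    have hlt : Algebra.trdeg K (MvPolynomial ι K ⧸ vI C) < Cardinal.aleph0 :=
      trdeg_lt_aleph0_of_finiteType
    have h2 : Algebra.trdeg K (MvPolynomial ι K ⧸ vI C) = ((n + 1 : ℕ) : Cardinal) := by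
      rw [← htd]; unfold td; rw [Cardinal.cast_toNat_of_lt_aleph0 hlt]
    rw [h2] at h1
    simp only [Cardinal.mk_fin, Cardinal.lift_natCast] at h1
    have := Nat.cast_le.mp h1
    omega
  rw [algebraicIndependent_iff] at hna
  push Not at hna
  obtain ⟨p0, hp0, hp0n⟩ := hna
  rw [ell_zero_iff] at hp0
  -- find good p
  have hgood : ∃ p : MvPolynomial (Fin (n + 2)) K,
      (∀ c ∈ C, MvPolynomial.eval (fun i => dotProduct (e i) c) p = 0) ∧
      ∃ c ∈ C, ∃ u ∈ C, MvPolynomial.eval (fun i => dotProduct (e i) (c + u)) p ≠ 0 := by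
    by_contra hno
    push Not at hno
    apply hp0n
    have hall : ∀ v : ι → K, ∀ p : MvPolynomial (Fin (n + 2)) K,
        (∀ c ∈ C, MvPolynomial.eval (fun i => dotProduct (e i) c) p = 0) →
        ∀ c ∈ C, MvPolynomial.eval (fun i => dotProduct (e i) (c + v)) p = 0 := by
      intro v
      have hv : v ∈ Submodule.span K C := by rw [hsp]; trivial
      induction hv using Submodule.closure_induction with
      | zero => intro p hp c hc; rw [add_zero]; exact hp c hc
      | add x y _ _ hx hy =>
        intro p hp c hc
        let p' : MvPolynomial (Fin (n + 2)) K :=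
          MvPolynomial.bind₁ (fun i => MvPolynomial.X i + MvPolynomial.C (dotProduct (e i) y)) p
        have hp' : ∀ c, MvPolynomial.eval (fun i => dotProduct (e i) c) p' =
            MvPolynomial.eval (fun i => dotProduct (e i) (c + y)) p := by
          intro c
          simp only [p']
          rw [eval_bind1]
          congr 2
          funext i
          simp [pmap, dotProduct_add]
        have h1 := hx p' (fun c hc => by rw [hp']; exact hy p hp c hc) c hc
        rw [hp'] at h1
        rwa [add_assoc] at h1
      | smul_mem a x hx =>
        intro p hp c hc
        exact hno p hp c hc _ (hsm a x hx)
    obtain ⟨c0, hc0⟩ := (vI_prime_iff'.mp hC).1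
    apply MvPolynomial.funext
    intro y
    rw [map_zero]
    have hsurj : ∃ v : ι → K, (fun i => dotProduct (e i) v) = y := by
      obtain ⟨L, hL⟩ := (Fintype.linearCombination K e).exists_leftInverse_of_injective
        (by
          rw [LinearMap.ker_eq_bot]
          exact hei.fintypeLinearCombination_injective)
      have hL' : ∀ i, L (e i) = Pi.single i 1 := by
        intro i
        have := LinearMap.congr_fun hL (Pi.single i 1)
        simpa using this
      let φ : (ι → K) →ₗ[K] K := (Fintype.linearCombination K y).comp L
      have hφ : ∀ i, φ (e i) = y i := by
        intro i
        simp only [φ, LinearMap.comp_apply, hL']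
        simp
      refine ⟨fun l => φ (Pi.single l 1), ?_⟩
      funext i
      rw [← hφ, LinearMap.pi_apply_eq_sum_univ φ]
      apply Finset.sum_congr rfl
      intro l _
      rw [smul_eq_mul]
      change e i l * φ (Pi.single l 1) = _
      congr 2
      funext i'; simp [Pi.single_apply, eq_comm]
    obtain ⟨v, hv⟩ := hsurj
    have := hall (v - c0) p0 hp0 c0 hc0
    rw [add_sub_cancel, hv] at this
    exact this
  obtain ⟨p, hp, c, hc, u0, hu0, hne⟩ := hgood
  let G : MvPolynomial ι K := MvPolynomial.bind₁ (fun i => MvPolynomial.C (dotProduct (e i) c) +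
    ∑ l, MvPolynomial.C (e i l) * MvPolynomial.X l) p
  have hG : ∀ u, MvPolynomial.eval u G = MvPolynomial.eval (fun i => dotProduct (e i) (c + u)) p := by
    intro u
    simp only [G]
    rw [eval_bind1]
    congr 2
    funext i
    simp only [pmap, map_add, MvPolynomial.eval_C, dotProduct_add]
    simp [dotProduct]
  refine ⟨G, notMem_vI.mpr ⟨u0, hu0, by rw [hG]; exact hne⟩, ?_⟩
  intro u hu hGu
  by_contra hnt
  apply hGu
  rw [hG]
  exact TR_key hC hE u hnt e he p hp c hc

lemma finrank_perp (E : Submodule K (ι → K)) (u : ι → K) :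
    Module.finrank K E ≤ Module.finrank K (perp E u) + 1 := by
  let φ : E →ₗ[K] K := { toFun := fun h => dotProduct (h : ι → K) u
                         map_add' := fun a b => by simp [add_dotProduct]
                         map_smul' := fun a b => by simp [smul_dotProduct] }
  have h1 := φ.finrank_range_add_finrank_ker
  have h2 : Module.finrank K (LinearMap.range φ) ≤ 1 := by
    simpa using (LinearMap.range φ).finrank_le
  have h3 : (LinearMap.ker φ).map E.subtype = perp E u := by
    ext h
    simp only [Submodule.mem_map, LinearMap.mem_ker, Submodule.subtype_apply, Subtype.exists, mem_perp]
    constructor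
    · rintro ⟨a, ha, h1, rfl⟩
      exact ⟨ha, h1⟩
    · rintro ⟨h1, h2⟩
      exact ⟨h, h1, h2, rfl⟩
  have h4 : Module.finrank K (perp E u) = Module.finrank K (LinearMap.ker φ) := by
    rw [← h3]
    exact LinearEquiv.finrank_eq (Submodule.equivMapOfInjective _ E.injective_subtype _).symm
  omega

lemma DOM [Infinite K] {n : ℕ} {C : Set (ι → K)} (hC : (vI C).IsPrime)
    (hsm : ∀ (c : K), ∀ v ∈ C, c • v ∈ C)
    (hsp : Submodule.span K C = ⊤) (htd : td (vI C) = n + 1) (a : MvPolynomial (Fin n × ι) K) (j : ℕ) :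
    ∀ (E : Submodule K (ι → K)) (hE : TR n C E) (hfr : n + 1 + j ≤ Module.finrank K E)
    (G : MvPolynomial (Fin j × ι) K) (hG : G ∉ vI (tup C (Fin j)))
    (ha : ∀ u ∈ tup C (Fin j), MvPolynomial.eval u G ≠ 0 → ∀ h : Fin n × ι → K,
      (∀ p, row h p ∈ E) → (∀ p i, dotProduct (row h p) (row u i) = 0) →
      MvPolynomial.eval h a = 0) (h0 : Fin n × ι → K) (hh0 : ∀ p, row h0 p ∈ E),
    MvPolynomial.eval h0 a = 0 := by
  induction j with
  | zero =>
    intro E hE hfr G hG ha h0 hh0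
    obtain ⟨u, hu, hGu⟩ := notMem_vI.mp hG
    exact ha u hu hGu h0 hh0 (fun p i => i.elim0)
  | succ j ih =>
    intro E hE hfr G hG ha h0 hh0
    obtain ⟨G2, hG2, hTR⟩ := TRstep hC hsm hsp htd hE (by omega)
    obtain ⟨w, hw, hGw⟩ := notMem_vI.mp hG
    let g := MvPolynomial.bind₁ (slotMap w 0) G
    have hgn : g ∉ vI C := notMem_vI.mpr ⟨row w 0, hw 0, by
      simp only [g]; rwa [eval_bind1, slot_self]⟩
    apply P_1 hC hE (g := g * G2) (fun hh => (hC.mem_or_mem hh).elim hgn hG2) a _ h0 hh0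
    intro u hu hgu h hh
    rw [map_mul] at hgu
    have hgu1 := left_ne_zero_of_mul hgu
    have hgu2 := right_ne_zero_of_mul hgu
    let Φ : Fin (j + 1) × ι → MvPolynomial (Fin j × ι) K := fun q =>
      Fin.cases (motive := fun _ => MvPolynomial (Fin j × ι) K) (MvPolynomial.C (u q.2))
        (fun i => MvPolynomial.X (i, q.2)) q.1
    have hΦ0 : ∀ v, row (pmap Φ v) 0 = u := by
      intro v; funext l; simp [row, pmap, Φ]
    have hΦs : ∀ v i, row (pmap Φ v) (Fin.succ i) = row v i := by
      intro v i; funext l; simp [row, pmap, Φ]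
    refine ih (perp E u) (hTR u hu hgu2) (by have := finrank_perp E u; omega)
      (MvPolynomial.bind₁ Φ G) (notMem_vI.mpr ⟨fun q => w (q.1.succ, q.2), fun i => hw i.succ, ?_⟩)
      ?_ h hh
    · rw [eval_bind1]
      simp only [g] at hgu1
      rw [eval_bind1] at hgu1
      convert hgu1 using 3
      funext ⟨i, l⟩
      refine Fin.cases ?_ (fun i => ?_) i
      · simp [pmap, Φ, slotMap]
      · simp [pmap, Φ, slotMap]
    · intro v hv hGv h hh hdot
      rw [eval_bind1] at hGv
      refine ha (pmap Φ v) ?_ hGv h (fun p => (hh p).1) ?_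
      · intro i
        refine Fin.cases ?_ (fun i => ?_) i
        · rw [hΦ0]; exact hu
        · rw [hΦs]; exact hv i
      · intro p i
        refine Fin.cases ?_ (fun i => ?_) i
        · rw [hΦ0]; exact (hh p).2
        · rw [hΦs]; exact hdot p i


-- Part 9

lemma mk_family {R : ℕ} {κ : Type*} [Fintype κ] (w : κ → ι → K) (u : Fin R → ι → K)
    (hu : LinearIndependent K u) (M : κ → Fin R → K) (hw : ∀ x, w x = ∑ j, M x j • u j)
    (hM : Function.Injective (fun x => {j | M x j ≠ 0})) (hne : ∀ x, ∃ j, M x j ≠ 0) :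
    ∃ A : Finset (PP K ι), A.card = Fintype.card κ ∧
      (∀ p ∈ A, ∃ x, ∃ h : w x ≠ 0, p = Projectivization.mk K (w x) h) ∧
      vspan (A : Set (PP K ι)) ≤ Submodule.span K (Set.range u) := by
  classical
  have hw0 : ∀ x, w x ≠ 0 := by
    intro x h0
    obtain ⟨j, hj⟩ := hne x
    rw [hw] at h0
    exact hj (Fintype.linearIndependent_iff.mp hu _ h0 j)
  let P : κ → PP K ι := fun x => Projectivization.mk K (w x) (hw0 x)
  have hP : Function.Injective P := by
    intro x y hxy
    obtain ⟨c, hc⟩ := (Projectivization.mk_eq_mk_iff' K _ _ (hw0 x) (hw0 y)).mp hxy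
    have hc0 : c ≠ 0 := by
      rintro rfl
      rw [zero_smul] at hc
      exact hw0 x hc.symm
    have h1 : ∀ j, c * M y j - M x j = 0 := by
      apply Fintype.linearIndependent_iff.mp hu
      simp only [sub_smul, Finset.sum_sub_distrib, mul_smul, ← Finset.smul_sum]
      rw [← hw, ← hw, hc, sub_self]
    apply hM
    ext j
    have h2 := sub_eq_zero.mp (h1 j)
    simp only [Set.mem_setOf_eq, ← h2]
    simp [hc0]
  refine ⟨Finset.univ.image P, ?_, ?_, ?_⟩
  · rw [Finset.card_image_of_injective _ hP, Finset.card_univ]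
  · intro p hp
    obtain ⟨x, -, rfl⟩ := Finset.mem_image.mp hp
    exact ⟨x, hw0 x, rfl⟩
  · unfold vspan
    rw [Submodule.span_le]
    intro v hv
    obtain ⟨p, hp, hvp⟩ := mem_coneOf.mp hv
    obtain ⟨x, -, rfl⟩ := Finset.mem_image.mp (Finset.mem_coe.mp hp)
    obtain ⟨c, rfl⟩ := (mem_submodule_mk (hw0 x)).mp hvp
    apply Submodule.smul_mem
    rw [hw]
    exact Submodule.sum_mem _ fun j _ => Submodule.smul_mem _ _ (Submodule.subset_span ⟨j, rfl⟩)

lemma coord_indep {C : Set (ι → K)} (hsp : Submodule.span K C = ⊤) :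
    LinearIndependent K (fun j : ι => (fun v : C => MvPolynomial.eval (v : ι → K) (MvPolynomial.X j))) := by
  classical
  rw [Fintype.linearIndependent_iff]
  intro c hc
  have h1 : ∀ v : ι → K, ∑ j, c j * v j = 0 := by
    intro v
    have hv : v ∈ Submodule.span K C := by rw [hsp]; trivial
    induction hv using Submodule.span_induction with
    | mem v hv =>
      have := congrFun hc ⟨v, hv⟩
      simpa using this
    | zero => simp
    | add x y _ _ hx hy => simp only [Pi.add_apply, mul_add, Finset.sum_add_distrib, hx, hy, add_zero]
    | smul a x _ hx =>
      have : ∑ j, c j * (a • x) j = a * ∑ j, c j * x j := by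
        rw [Finset.mul_sum]; apply Finset.sum_congr rfl; intro j _; simp; ring
      rw [this, hx, mul_zero]
  intro j
  have := h1 (Pi.single j 1)
  simpa [Pi.single_apply] using this

lemma vI_univ_prime {σ : Type*} [Infinite K] : (vI (Set.univ : Set (σ → K))).IsPrime := by
  have : vI (Set.univ : Set (σ → K)) = ⊥ := by
    rw [eq_bot_iff]
    intro p hp
    rw [Ideal.mem_bot]
    apply MvPolynomial.funext
    intro x
    rw [map_zero]
    exact mem_vI.mp hp x trivial
  rw [this]
  exact Ideal.isPrime_bot

/-- Generic sections by codimension `n` linear spaces contain general tuples. -/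
lemma slice_gen [IsAlgClosed K] {n : ℕ} {C : Set (ι → K)} (hC : (vI C).IsPrime)
    (hcl : ∀ v, (∀ p ∈ vI C, MvPolynomial.eval v p = 0) → v ∈ C)
    (hsm : ∀ (c : K), ∀ v ∈ C, c • v ∈ C)
    (hsp : Submodule.span K C = ⊤) (htd : td (vI C) = n + 1) (R : ℕ)
    (hR : n + 1 + R ≤ Fintype.card ι) (Gt : MvPolynomial (Fin R × ι) K)
    (hGt : Gt ∉ vI (tup C (Fin R))) :
    ∃ a : MvPolynomial (Fin n × ι) K, (∃ h, MvPolynomial.eval h a ≠ 0) ∧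
      ∀ h, MvPolynomial.eval h a ≠ 0 → ∃ u ∈ tup C (Fin R), MvPolynomial.eval u Gt ≠ 0 ∧
        ∀ p i, dotProduct (row h p) (row u i) = 0 := by
  have hinf : Infinite K := IsAlgClosed.instInfinite
  let τ := (Fin n × ι) ⊕ (Fin R × ι)
  let Φ : Fin n × ι → MvPolynomial τ K := fun q => MvPolynomial.X (Sum.inl q)
  let F : Set (MvPolynomial τ K) :=
    {f | ∃ i, ∃ p ∈ vI C, f = MvPolynomial.rename (fun l => Sum.inr (i, l)) p} ∪
    {f | ∃ p i, f = ∑ l, MvPolynomial.X (Sum.inl (p, l)) * MvPolynomial.X (Sum.inr (i, l))}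
  have hF : ∀ t : τ → K, (∀ f ∈ F, MvPolynomial.eval t f = 0) ↔
      ((fun q => t (Sum.inr q)) ∈ tup C (Fin R) ∧
      ∀ p i, dotProduct (row (fun q => t (Sum.inl q)) p) (row (fun q => t (Sum.inr q)) i) = 0) := by
    intro t
    constructor
    · intro h
      constructor
      · intro i
        apply hcl
        intro p hp
        have := h _ (Or.inl ⟨i, p, hp, rfl⟩)
        rw [MvPolynomial.eval_rename] at this
        exact this
      · intro p i
        have := h _ (Or.inr ⟨p, i, rfl⟩)
        simpa [dotProduct, row] using this
    · rintro ⟨h1, h2⟩ f (⟨i, p, hp, rfl⟩ | ⟨p, i, rfl⟩)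
      · rw [MvPolynomial.eval_rename]
        exact mem_vI.mp hp _ (h1 i)
      · simpa [dotProduct, row] using h2 p i
  have hΦ : ∀ t, pmap Φ t = fun q => t (Sum.inl q) := by
    intro t; funext q; simp [pmap, Φ]
  rcases geomDL Set.univ vI_univ_prime Φ F (MvPolynomial.rename Sum.inr Gt) with
    ⟨a, ha, h⟩ | ⟨a, ha, h⟩
  · exfalso
    obtain ⟨h0, -, hh0⟩ := notMem_vI.mp ha
    apply hh0
    refine DOM hC hsm hsp htd a R ⊤ (TR_top hC htd) (by simpa using hR) Gt hGt ?_ h0 (fun _ => trivial)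
    intro u hu hGu h' _ hdot
    have := h (Sum.elim h' u) ((hF _).mpr ⟨hu, hdot⟩) (by
      rw [MvPolynomial.eval_rename]; exact hGu) (fun p hp => mem_vI.mp hp _ trivial)
    rw [hΦ] at this
    exact this
  · obtain ⟨h0, -, hh0⟩ := notMem_vI.mp ha
    refine ⟨a, ⟨h0, hh0⟩, fun h' hh' => ?_⟩
    obtain ⟨t, h1, h2, h3⟩ := h h' (fun p hp => mem_vI.mp hp _ trivial) hh'
    rw [MvPolynomial.eval_rename] at h2
    rw [hΦ] at h3
    obtain ⟨h4, h5⟩ := (hF t).mp h1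
    refine ⟨_, h4, h2, ?_⟩
    rw [← h3]; exact h5

lemma trisec [IsAlgClosed K] {n : ℕ} {X0 : Set (PP K ι)} (hC : (vI (coneOf X0)).IsPrime)
    (hcl : ∀ v, (∀ p ∈ vI (coneOf X0), MvPolynomial.eval v p = 0) → v ∈ coneOf X0)
    (hsp : Submodule.span K (coneOf X0) = ⊤) (htd : td (vI (coneOf X0)) = n + 1)
    (hvs : ¬ VeryStrange n X0) (s : ℕ) (hs2 : 2 ≤ s) (hs : s + n + 2 ≤ Fintype.card ι) :
    ∃ a : MvPolynomial (Fin s × ι) K, a ∉ vI (tup (coneOf X0) (Fin s)) ∧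
      ∀ u ∈ tup (coneOf X0) (Fin s), MvPolynomial.eval u a ≠ 0 → ∀ c : Fin s → K, (∀ i, c i ≠ 0) →
        ∑ i, c i • row u i ∉ coneOf X0 := by
  classical
  set C := coneOf X0 with hCdef
  have hsm : ∀ (c : K), ∀ v ∈ C, c • v ∈ C := fun c v hv => smul_mem_cone hv c
  let τ := (Fin s × ι) ⊕ Fin s
  let Φ : Fin s × ι → MvPolynomial τ K := fun q => MvPolynomial.X (Sum.inl q)
  have hΦ : ∀ t, pmap Φ t = fun q => t (Sum.inl q) := by
    intro t; funext q; simp [pmap, Φ]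
  let Ψ : ι → MvPolynomial τ K := fun l =>
    ∑ i, MvPolynomial.X (Sum.inr i) * MvPolynomial.X (Sum.inl (i, l))
  have hΨ : ∀ t : τ → K, pmap Ψ t = ∑ i, t (Sum.inr i) • row (fun q => t (Sum.inl q)) i := by
    intro t; funext l; simp [pmap, Ψ, row]
  let F : Set (MvPolynomial τ K) := {f | ∃ p ∈ vI C, f = MvPolynomial.bind₁ Ψ p}
  have hF : ∀ t : τ → K, (∀ f ∈ F, MvPolynomial.eval t f = 0) ↔
      ∑ i, t (Sum.inr i) • row (fun q => t (Sum.inl q)) i ∈ C := by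
    intro t
    rw [← hΨ]
    constructor
    · intro h
      apply hcl
      intro p hp
      have := h _ ⟨p, hp, rfl⟩
      rwa [eval_bind1] at this
    · rintro h f ⟨p, hp, rfl⟩
      rw [eval_bind1]
      exact mem_vI.mp hp _ h
  rcases geomDL (tup C (Fin s)) (tup_prime hC) Φ F (∏ i, MvPolynomial.X (Sum.inr i)) with
    ⟨a, ha, h⟩ | ⟨a, ha, h⟩
  · refine ⟨a, ha, fun u hu hau c hc hmem => hau ?_⟩
    have := h (Sum.elim u c) ((hF _).mpr hmem) (by
      rw [map_prod]
      simpa [Finset.prod_ne_zero_iff] using hc) (by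
      rw [hΦ]; exact fun p hp => mem_vI.mp hp u hu)
    rw [hΦ] at this
    exact this
  · exfalso
    have hbad : ∀ u ∈ tup C (Fin s), MvPolynomial.eval u a ≠ 0 → ∃ c : Fin s → K, (∀ i, c i ≠ 0) ∧
        ∑ i, c i • row u i ∈ C := by
      intro u hu hau
      obtain ⟨t, h1, h2, h3⟩ := h u (fun p hp => mem_vI.mp hp u hu) hau
      rw [hΦ] at h3
      refine ⟨fun i => t (Sum.inr i), ?_, ?_⟩
      · rw [map_prod, Finset.prod_ne_zero_iff] at h2
        intro i
        simpa using h2 i (Finset.mem_univ i)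
      · have := (hF t).mp h1
        rwa [h3] at this
    obtain ⟨R, hR⟩ : ∃ R, n + 1 + R = Fintype.card ι := ⟨Fintype.card ι - (n + 1), by omega⟩
    have hsR : s + 1 ≤ R := by omega
    let α : Fin s → Fin R := fun i => ⟨i + 1, by omega⟩
    let β : Fin s → Fin R := fun i => ⟨if (i : ℕ) = 0 then 0 else i + 1, by split_ifs <;> omega⟩
    have hα : Function.Injective α := by
      intro i j hij
      simp only [α, Fin.mk.injEq] at hij
      ext; omega
    have hβ : Function.Injective β := by
      intro i j hij
      simp only [β, Fin.mk.injEq] at hij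
      ext
      split_ifs at hij <;> omega
    have hne : C.Nonempty := (vI_prime_iff'.mp hC).1
    obtain ⟨G3, hG3, hG3i⟩ := indep_gen (C := C) (fun j : ι => MvPolynomial.X j) (coord_indep hsp) R
      (by omega)
    have hp := tup_prime (κ := Fin R) hC
    have hG : MvPolynomial.rename (Prod.map α id) a * MvPolynomial.rename (Prod.map β id) a * G3 ∉
        vI (tup C (Fin R)) := by
      intro hh
      rcases hp.mem_or_mem hh with hh | hh
      · rcases hp.mem_or_mem hh with hh | hh
        · exact rename_notMem hne hα ha hh
        · exact rename_notMem hne hβ ha hh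
      · exact hG3 hh
    obtain ⟨b, ⟨h0, hb0⟩, hb⟩ := slice_gen hC hcl hsm hsp htd R hR.le _ hG
    apply hvs
    refine ⟨{h | MvPolynomial.eval (fun p => h p.1 p.2) b = 0}, ⟨{b}, by simp⟩,
      ⟨fun p l => h0 (p, l), hb0⟩, ?_⟩
    intro h' hh'
    obtain ⟨u, hu, hGu, hdot⟩ := hb (fun p => h' p.1 p.2) hh'
    rw [map_mul, map_mul, eval_rename_row, eval_rename_row] at hGu
    have hi : LinearIndependent K (fun i : Fin R => row u i) := by
      have := hG3i u (right_ne_zero_of_mul hGu)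
      simpa using this
    obtain ⟨c1, hc1, hm1⟩ := hbad (fun p => u (α p.1, p.2)) (fun i => hu (α i))
      (left_ne_zero_of_mul (left_ne_zero_of_mul hGu))
    obtain ⟨c2, hc2, hm2⟩ := hbad (fun p => u (β p.1, p.2)) (fun i => hu (β i))
      (right_ne_zero_of_mul (left_ne_zero_of_mul hGu))
    change ∑ i, c1 i • row u (α i) ∈ C at hm1
    change ∑ i, c2 i • row u (β i) ∈ C at hm2
    let M : Fin R ⊕ Fin 2 → Fin R → K := Sum.elim (fun j => Pi.single j 1)
      ![Function.extend α c1 0, Function.extend β c2 0]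
    let w : Fin R ⊕ Fin 2 → ι → K := fun x => ∑ j, M x j • row u j
    have hw1 : ∀ (γ : Fin s → Fin R) (hγ : Function.Injective γ) (c : Fin s → K),
        ∑ j, (Function.extend γ c 0 j) • row u j = ∑ i, c i • row u (γ i) := by
      intro γ hγ c
      symm
      apply Fintype.sum_of_injective γ hγ
      · intro j hj
        rw [Function.extend_apply' _ _ _ (by simpa using hj)]; simp
      · intro i
        rw [hγ.extend_apply]
    have hwC : ∀ x, w x ∈ C := by
      rintro (j | j)
      · have : w (Sum.inl j) = row u j := by
          simp [w, M, Pi.single_apply]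
        rw [this]; exact hu j
      · fin_cases j
        · change ∑ j, (Function.extend α c1 0 j) • row u j ∈ C
          rw [hw1 α hα]; exact hm1
        · change ∑ j, (Function.extend β c2 0 j) • row u j ∈ C
          rw [hw1 β hβ]; exact hm2
    have hsupp1 : ∀ (γ : Fin s → Fin R) (hγ : Function.Injective γ) (c : Fin s → K) (hc : ∀ i, c i ≠ 0),
        {j | Function.extend γ c 0 j ≠ 0} = Set.range γ := by
      intro γ hγ c hc
      ext j
      constructor
      · intro hj
        by_contra hh
        exact hj (by rw [Function.extend_apply' _ _ _ (by simpa using hh)]; rfl)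
      · rintro ⟨i, rfl⟩
        change Function.extend γ c 0 (γ i) ≠ 0
        rw [hγ.extend_apply]; exact hc i
    let sup : Fin R ⊕ Fin 2 → Set (Fin R) := Sum.elim (fun j => {j}) ![Set.range α, Set.range β]
    have hsup : ∀ x, {j | M x j ≠ 0} = sup x := by
      rintro (j | j)
      · ext i
        simp [M, sup, Pi.single_apply]
      · fin_cases j
        · exact hsupp1 α hα c1 hc1
        · exact hsupp1 β hβ c2 hc2
    have hns : ∀ (γ : Fin s → Fin R) (hγ : Function.Injective γ) (j : Fin R), Set.range γ ≠ {j} := by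
      intro γ hγ j hh
      have e1 : γ ⟨0, by omega⟩ = j := by
        have : γ ⟨0, by omega⟩ ∈ Set.range γ := ⟨_, rfl⟩
        rwa [hh] at this
      have e2 : γ ⟨1, by omega⟩ = j := by
        have : γ ⟨1, by omega⟩ ∈ Set.range γ := ⟨_, rfl⟩
        rwa [hh] at this
      have := hγ (e1.trans e2.symm)
      simp at this
    have hab : Set.range α ≠ Set.range β := by
      intro hh
      have h1 : (⟨0, by omega⟩ : Fin R) ∈ Set.range β := ⟨⟨0, by omega⟩, by simp [β]⟩
      rw [← hh] at h1
      obtain ⟨i, hi⟩ := h1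
      simp [α] at hi
    have hinj : Function.Injective (fun x => {j | M x j ≠ 0}) := by
      intro x y hxy
      simp only [hsup] at hxy
      rcases x with x | x <;> rcases y with y | y
      · have : ({x} : Set (Fin R)) = {y} := hxy
        rw [Set.singleton_eq_singleton_iff] at this
        rw [this]
      · fin_cases y
        · exact absurd hxy.symm (hns α hα x)
        · exact absurd hxy.symm (hns β hβ x)
      · fin_cases x
        · exact absurd hxy (hns α hα y)
        · exact absurd hxy (hns β hβ y)
      · fin_cases x <;> fin_cases y
        · rfl
        · exact absurd hxy hab
        · exact absurd hxy.symm hab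
        · rfl
    have hnz : ∀ x, ∃ j, M x j ≠ 0 := by
      intro x
      have : (sup x).Nonempty := by
        rcases x with x | x
        · exact ⟨x, rfl⟩
        · fin_cases x
          · exact ⟨α ⟨0, by omega⟩, ⟨_, rfl⟩⟩
          · exact ⟨β ⟨0, by omega⟩, ⟨_, rfl⟩⟩
      rw [← hsup] at this
      exact this
    obtain ⟨A, hAc, hA, hAs⟩ := mk_family w (row u) hi M (fun x => rfl) hinj hnz
    refine ⟨A, ?_, ?_, ?_⟩
    · intro p hp
      obtain ⟨x, hx, rfl⟩ := hA p hp
      refine ⟨(mem_coneOf_mk hx).mp (hwC x), ?_⟩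
      intro p
      obtain ⟨c, hc⟩ := Projectivization.exists_smul_eq_mk_rep K (w x) hx
      rw [← hc]
      have h7 : dotProduct (h' p) (w x) = 0 := by
        simp only [w, dotProduct_sum, dotProduct_smul]
        apply Finset.sum_eq_zero
        intro j _
        have := hdot p j
        change dotProduct (h' p) (row u j) = 0 at this
        rw [this, smul_zero]
      change dotProduct (h' p) ((c : K) • w x) = 0
      rw [dotProduct_smul, h7, smul_zero]
    · rw [hAc]; simp; omega
    · have h8 := Submodule.finrank_mono hAs
      rw [finrank_span_eq_card hi] at h8
      simp at h8
      omega


-- Part 10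

/-- good tuples -/
def Good {k m : ℕ} (C : Set (ι → K)) (g : Fin m → MvPolynomial ι K) (u : Fin k × ι → K) : Prop :=
  LinearIndependent K (row u) ∧
  LinearIndependent K (fun i : Fin k => fun j : Fin m => MvPolynomial.eval (row u i) (g j)) ∧
  ∀ c : Fin k → K, (∑ i, c i • row u i) ∈ C → ∃ i, ∀ j, j ≠ i → c j = 0

lemma exists_good [IsAlgClosed K] {n : ℕ} {X0 : Set (PP K ι)}
    (hC : (vI (coneOf X0)).IsPrime)
    (hcl : ∀ v, (∀ p ∈ vI (coneOf X0), MvPolynomial.eval v p = 0) → v ∈ coneOf X0)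
    (hsp : Submodule.span K (coneOf X0) = ⊤) (htd : td (vI (coneOf X0)) = n + 1)
    (hvs : ¬VeryStrange n X0) {m : ℕ} (g : Fin m → MvPolynomial ι K)
    (hgind : LinearIndependent K fun j : Fin m =>
      (fun v : coneOf X0 => MvPolynomial.eval (v : ι → K) (g j)))
    (k : ℕ) (hk : 1 ≤ k) (hkm : k ≤ m) (hkV : k + n + 2 ≤ Fintype.card ι) :
    ∃ G, G ∉ vI (tup (coneOf X0) (Fin k)) ∧ ∀ u ∈ tup (coneOf X0) (Fin k),
      MvPolynomial.eval u G ≠ 0 → Good (coneOf X0) g u := by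
  classical
  have hP : (vI (tup (coneOf X0) (Fin k))).IsPrime := tup_prime hC
  have hne : (coneOf X0).Nonempty := (vI_prime_iff'.mp hC).1
  obtain ⟨G1, hG1, h1⟩ := indep_gen (C := coneOf X0) (fun j : ι => MvPolynomial.X j)
    (coord_indep hsp) k (by omega)
  obtain ⟨G2, hG2, h2⟩ := indep_gen (C := coneOf X0) g hgind k (by simpa using hkm)
  have h3 : ∀ T : Finset (Fin k), ∃ a, a ∉ vI (tup (coneOf X0) (Fin k)) ∧
      ∀ u ∈ tup (coneOf X0) (Fin k), MvPolynomial.eval u a ≠ 0 → 2 ≤ T.card →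
      ∀ c : Fin k → K, (∀ i, i ∈ T ↔ c i ≠ 0) → (∑ i, c i • row u i) ∉ coneOf X0 := by
    intro T
    by_cases hT : 2 ≤ T.card
    · have hle : T.card ≤ k := by simpa using Finset.card_le_univ T
      obtain ⟨a, ha, h⟩ := trisec hC hcl hsp htd hvs T.card hT (by omega)
      let e := T.orderEmbOfFin rfl
      refine ⟨MvPolynomial.rename (Prod.map e id) a, rename_notMem hne e.injective ha, ?_⟩
      intro u hu hua _ c hc
      rw [eval_rename_row] at hua
      have := h _ (fun i => hu (e i)) hua (fun i => c (e i))
        (fun i => (hc _).mp (T.orderEmbOfFin_mem rfl i))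
      convert this using 2
      symm
      apply Fintype.sum_of_injective e e.injective
      · intro i hi
        have : i ∉ T := by
          intro hh; apply hi; rw [Finset.range_orderEmbOfFin]; exact hh
        rw [hc, not_not] at this
        rw [this, zero_smul]
      · intro i; rfl
    · exact ⟨1, fun h => hP.ne_top ((Ideal.eq_top_iff_one _).mpr h), fun _ _ _ h => absurd h hT⟩
  choose a ha h3 using h3
  refine ⟨G1 * G2 * ∏ T, a T, ?_, ?_⟩
  · intro h
    rcases hP.mem_or_mem h with h | h
    · exact (hP.mem_or_mem h).elim hG1 hG2
    · obtain ⟨T, _, hT⟩ := (hP.prod_mem_iff).mp h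
      exact ha T hT
  · intro u hu hG
    simp only [map_mul, map_prod, mul_ne_zero_iff, Finset.prod_ne_zero_iff] at hG
    refine ⟨?_, h2 u hG.1.2, ?_⟩
    · simpa using h1 u hG.1.1
    · intro c hc
      by_cases hcard : 2 ≤ (Finset.univ.filter (fun i => c i ≠ 0)).card
      · exact absurd hc (h3 _ u hu (hG.2 _ (Finset.mem_univ _)) hcard c (by simp))
      · by_cases h0 : ∃ i, c i ≠ 0
        · obtain ⟨i, hi⟩ := h0
          refine ⟨i, fun j hj => ?_⟩
          by_contra hcj
          apply hcard
          have : ({i, j} : Finset (Fin k)) ⊆ Finset.univ.filter (fun i => c i ≠ 0) := by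
            intro x hx; simp at hx; rcases hx with rfl | rfl <;> simp [*]
          have h := Finset.card_le_card this
          rwa [Finset.card_pair (Ne.symm hj)] at h
        · push Not at h0
          exact ⟨⟨0, hk⟩, fun j _ => h0 j⟩


-- Part 11

/-- rank one tensors -/
def tens {μ : Type*} (v : ι → K) (w : μ → K) : ι × μ → K := fun p => v p.1 * w p.2

lemma tens_smul_left {μ : Type*} (c : K) (v : ι → K) (w : μ → K) :
    tens (c • v) w = c • tens v w := by
  funext p; simp [tens, mul_assoc]

lemma tens_smul_right {μ : Type*} (c : K) (v : ι → K) (w : μ → K) :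
    tens v (c • w) = c • tens v w := by
  funext p; simp [tens]; ring

lemma tens_sub_right {μ : Type*} (v : ι → K) (w w' : μ → K) :
    tens v (w - w') = tens v w - tens v w' := by
  funext p; simp [tens]; ring

/-- contraction on the second factor -/
def ctr {μ : Type*} (ψ : (μ → K) →ₗ[K] K) : (ι × μ → K) →ₗ[K] (ι → K) where
  toFun y := fun i => ψ (fun j => y (i, j))
  map_add' y z := by
    funext i; rw [Pi.add_apply, ← map_add]; rfl
  map_smul' c y := by
    funext i; rw [Pi.smul_apply, RingHom.id_apply, ← map_smul]; rfl

lemma ctr_tens {μ : Type*} (ψ : (μ → K) →ₗ[K] K) (v : ι → K) (w : μ → K) :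
    ctr ψ (tens v w) = ψ w • v := by
  funext i
  change ψ (v i • w) = _
  rw [map_smul]; simp [mul_comm]

lemma exists_dual {μ κ : Type*} [Finite κ] [DecidableEq κ] {w : κ → μ → K} (hw : LinearIndependent K w) (i : κ) :
    ∃ ψ : (μ → K) →ₗ[K] K, ∀ j, ψ (w j) = if j = i then 1 else 0 := by
  have := Fintype.ofFinite κ
  obtain ⟨φ, hφ⟩ := LinearMap.exists_leftInverse_of_injective (Fintype.linearCombination K w)
    (LinearMap.ker_eq_bot.mpr hw.fintypeLinearCombination_injective)
  refine ⟨(LinearMap.proj i).comp φ, fun j => ?_⟩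
  have h : φ (w j) = Pi.single j 1 := by
    have := LinearMap.congr_fun hφ (Pi.single j 1)
    simpa [Fintype.linearCombination_apply_single] using this
  change φ (w j) i = _
  rw [h, Pi.single_apply]
  simp only [eq_comm]

lemma tens_sum_inj {μ κ : Type*} [Fintype κ] {v : κ → ι → K} (hv : LinearIndependent K v)
    {w w' : κ → μ → K} (h : ∑ i, tens (v i) (w i) = ∑ i, tens (v i) (w' i)) : w = w' := by
  have h0 : ∑ i, tens (v i) (w i - w' i) = 0 := by
    simp only [tens_sub_right, Finset.sum_sub_distrib, h, sub_self]
  funext i j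
  have h1 : ∑ i, (w i j - w' i j) • v i = 0 := by
    funext a
    have := congrFun h0 (a, j)
    simpa [tens, mul_comm, Finset.sum_apply] using this
  exact sub_eq_zero.mp (Fintype.linearIndependent_iff.mp hv _ h1 i)

lemma tens_rank {μ κ σ : Type*} [Fintype κ] [Fintype σ] {v : κ → ι → K}
    (hv : LinearIndependent K v) {w : κ → μ → K} (hw : LinearIndependent K w)
    (a : σ → ι → K) (b : σ → μ → K) (hcard : Fintype.card σ ≤ Fintype.card κ)
    (h : ∑ i, tens (v i) (w i) = ∑ s, tens (a s) (b s)) :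
    Fintype.card σ = Fintype.card κ ∧ LinearIndependent K a ∧
      Submodule.span K (Set.range a) = Submodule.span K (Set.range v) := by
  classical
  have hle : Submodule.span K (Set.range v) ≤ Submodule.span K (Set.range a) := by
    rw [Submodule.span_le]
    rintro _ ⟨i, rfl⟩
    obtain ⟨ψ, hψ⟩ := exists_dual hw i
    have := congrArg (ctr ψ) h
    simp only [map_sum, ctr_tens, hψ, ite_smul, one_smul, zero_smul, Finset.sum_ite_eq',
      Finset.mem_univ, if_true] at this
    rw [this]
    exact Submodule.sum_mem _ fun s _ => Submodule.smul_mem _ _ (Submodule.subset_span ⟨s, rfl⟩)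
  have h1 := Submodule.finrank_mono hle
  rw [finrank_span_eq_card hv] at h1
  have h2 : Module.finrank K (Submodule.span K (Set.range a)) ≤ Fintype.card σ :=
    finrank_range_le_card a
  refine ⟨by omega, ?_, ?_⟩
  · rw [linearIndependent_iff_card_eq_finrank_span]
    change Fintype.card σ = Module.finrank K (Submodule.span K (Set.range a))
    omega
  · symm
    apply Submodule.eq_of_le_of_finrank_eq hle
    rw [finrank_span_eq_card hv]; omega

/-- values of g -/
def gv {m : ℕ} (g : Fin m → MvPolynomial ι K) (v : ι → K) : Fin m → K :=
  fun j => MvPolynomial.eval v (g j)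

lemma gv_smul {m D : ℕ} {g : Fin m → MvPolynomial ι K} (hg : ∀ j, (g j).IsHomogeneous D)
    (c : K) (v : ι → K) : gv g (c • v) = c ^ D • gv g v := by
  funext j
  simp only [gv, Pi.smul_apply, smul_eq_mul]
  exact eval_smul_hom (hg j) c v

theorem good_core {k m : ℕ} {C : Set (ι → K)} {g : Fin m → MvPolynomial ι K}
    {u : Fin k × ι → K} (hu : Good C g u) {σ : Type*} [Fintype σ]
    (a : σ → ι → K) (ha : ∀ s, a s ∈ C) (b : σ → Fin m → K) (hcard : Fintype.card σ ≤ k)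
    (h : ∑ i, tens (row u i) (gv g (row u i)) = ∑ s, tens (a s) (b s)) :
    ∃ e : σ ≃ Fin k, ∃ l : σ → K, (∀ s, l s ≠ 0) ∧ ∀ s, a s = l s • row u (e s) ∧
      l s • b s = gv g (row u (e s)) := by
  classical
  obtain ⟨h1, h2, h3⟩ := hu
  obtain ⟨hc, hai, hsp⟩ := tens_rank h1 h2 a b (by simpa using hcard) h
  have key : ∀ s, ∃ i, ∃ l : K, a s = l • row u i := by
    intro s
    have : a s ∈ Submodule.span K (Set.range (row u)) := by
      rw [← hsp]; exact Submodule.subset_span ⟨s, rfl⟩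
    rw [Submodule.mem_span_range_iff_exists_fun] at this
    obtain ⟨c, hcs⟩ := this
    obtain ⟨i, hi⟩ := h3 c (by rw [hcs]; exact ha s)
    refine ⟨i, c i, ?_⟩
    rw [← hcs, Finset.sum_eq_single i]
    · intro j _ hj; rw [hi j hj, zero_smul]
    · simp
  choose e l hel using key
  have hl : ∀ s, l s ≠ 0 := by
    intro s hs
    apply hai.ne_zero s
    rw [hel, hs, zero_smul]
  have hinj : Function.Injective e := by
    intro s t hst
    by_contra hne
    have h5 := (Fintype.linearIndependent_iff.mp hai) (Pi.single s (l t) - Pi.single t (l s)) (by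
      simp only [Pi.sub_apply, sub_smul, Finset.sum_sub_distrib, Pi.single_apply, ite_smul,
        zero_smul, Finset.sum_ite_eq', Finset.mem_univ, if_true]
      rw [hel s, hel t, hst, smul_smul, smul_smul, mul_comm, sub_self]) s
    simp [Pi.single_apply, hne] at h5
    exact hl t h5
  have hbij : Function.Bijective e := by
    rw [Fintype.bijective_iff_injective_and_card]
    exact ⟨hinj, by simpa using hc⟩
  let E := Equiv.ofBijective e hbij
  refine ⟨E, l, hl, fun s => ⟨hel s, ?_⟩⟩
  have h6 : ∑ s, tens (row u (E s)) (l s • b s) = ∑ s, tens (row u (E s)) (gv g (row u (E s))) := by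
    rw [E.sum_comp (fun i => tens (row u i) (gv g (row u i))), h]
    apply Finset.sum_congr rfl
    intro s _
    rw [tens_smul_right, ← tens_smul_left]
    congr 1
    exact (hel s).symm
  exact congrFun (tens_sum_inj (h1.comp E E.injective) h6) s

/-- fibres over good points are finite -/
lemma good_fib {k m D : ℕ} {C : Set (ι → K)} {g : Fin m → MvPolynomial ι K}
    (hg : ∀ j, (g j).IsHomogeneous D)
    {u u' : Fin k × ι → K} (hu : Good C g u) (hu' : u' ∈ tup C (Fin k))
    (h : ∑ i, tens (row u i) (gv g (row u i)) = ∑ i, tens (row u' i) (gv g (row u' i)))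
    (p : Fin k × ι) :
    ∃ i : Fin k, ∃ l : K, l ^ (D + 1) = 1 ∧ u' p = l * u (i, p.2) := by
  obtain ⟨e, l, hl, h1⟩ := good_core hu (row u') hu' (fun i => gv g (row u' i)) (by simp) h
  obtain ⟨h2, h3⟩ := h1 p.1
  refine ⟨e p.1, l p.1, ?_, congrFun h2 p.2⟩
  rw [h2, gv_smul hg, smul_smul] at h3
  have h4 : gv g (row u (e p.1)) ≠ 0 := hu.2.1.ne_zero (e p.1)
  have h5 : (l p.1 * l p.1 ^ D - 1) • gv g (row u (e p.1)) = 0 := by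
    rw [sub_smul, h3, one_smul, sub_self]
  have h6 := (smul_eq_zero.mp h5).resolve_right h4
  rw [pow_succ']
  exact sub_eq_zero.mp h6


-- Part 12

lemma vI_image {σ τ : Type*} (Φ : σ → MvPolynomial τ K) (Z : Set (τ → K)) (p : MvPolynomial σ K) :
    p ∈ vI (pmap Φ '' Z) ↔ MvPolynomial.bind₁ Φ p ∈ vI Z := by
  simp only [mem_vI, Set.forall_mem_image, eval_bind1]

lemma vI_image_prime {σ τ : Type*} (Φ : σ → MvPolynomial τ K) {Z : Set (τ → K)}
    (hZ : (vI Z).IsPrime) : (vI (pmap Φ '' Z)).IsPrime := by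
  have : vI (pmap Φ '' Z) = (vI Z).comap (MvPolynomial.bind₁ Φ) := by
    ext p; exact vI_image Φ Z p
  rw [this]
  exact Ideal.comap_isPrime _ _

/-- the parametrization -/
def Phi {m : ℕ} (g : Fin m → MvPolynomial ι K) (k : ℕ) (p : ι × Fin m) :
    MvPolynomial (Fin k × ι) K :=
  ∑ i : Fin k, MvPolynomial.X (i, p.1) * MvPolynomial.rename (fun a => (i, a)) (g p.2)

lemma pmap_Phi {m : ℕ} (g : Fin m → MvPolynomial ι K) (k : ℕ) (u : Fin k × ι → K) :
    pmap (Phi g k) u = ∑ i, tens (row u i) (gv g (row u i)) := by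
  funext p
  rw [Finset.sum_apply]
  simp only [pmap, Phi, map_sum, map_mul, MvPolynomial.eval_X, MvPolynomial.eval_rename]
  rfl

/-- image cone -/
def Tc {m : ℕ} (g : Fin m → MvPolynomial ι K) (C : Set (ι → K)) : Set (ι × Fin m → K) :=
  (fun v => tens v (gv g v)) '' C

lemma Tc_smul [IsAlgClosed K] {m D : ℕ} {g : Fin m → MvPolynomial ι K}
    (hg : ∀ j, (g j).IsHomogeneous D) {C : Set (ι → K)} (hsm : ∀ v ∈ C, ∀ c : K, c • v ∈ C)
    {y : ι × Fin m → K} (hy : y ∈ Tc g C) (c : K) : c • y ∈ Tc g C := by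
  obtain ⟨v, hv, rfl⟩ := hy
  obtain ⟨r, hr⟩ := IsAlgClosed.exists_pow_nat_eq c (Nat.succ_pos D)
  refine ⟨r • v, hsm v hv r, ?_⟩
  change tens (r • v) (gv g (r • v)) = c • tens v (gv g v)
  rw [gv_smul hg, tens_smul_left, tens_smul_right, smul_smul, ← hr, pow_succ']

/-- the image set in projective space -/
def imgSet {m : ℕ} (g : Fin m → MvPolynomial ι K) (X0 : Set (PP K ι)) : Set (PP K (ι × Fin m)) :=
  {y : PP K (ι × Fin m) | ∃ v ∈ coneOf X0,
      y.submodule = Submodule.span K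
        ({fun p => v p.1 * MvPolynomial.eval v (g p.2)} : Set (ι × Fin m → K))}

lemma mk_mem_img {m : ℕ} {g : Fin m → MvPolynomial ι K} {X0 : Set (PP K ι)} {v : ι → K}
    (hv : v ∈ coneOf X0) (h0 : tens v (gv g v) ≠ 0) :
    Projectivization.mk K (tens v (gv g v)) h0 ∈ imgSet g X0 :=
  ⟨v, hv, by rw [Projectivization.submodule_mk]; rfl⟩

lemma cone_img_sub [IsAlgClosed K] {m D : ℕ} {g : Fin m → MvPolynomial ι K}
    (hg : ∀ j, (g j).IsHomogeneous D) {X0 : Set (PP K ι)} :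
    coneOf (imgSet g X0) ⊆ Tc g (coneOf X0) := by
  intro y hy
  rw [mem_coneOf] at hy
  obtain ⟨x, ⟨v, hv, hx⟩, hy⟩ := hy
  rw [hx, Submodule.mem_span_singleton] at hy
  obtain ⟨c, rfl⟩ := hy
  exact Tc_smul hg (fun v hv c => smul_mem_cone hv c) ⟨v, hv, rfl⟩ c

lemma vI_T_le [IsAlgClosed K] {m D : ℕ} {g : Fin m → MvPolynomial ι K}
    (hg : ∀ j, (g j).IsHomogeneous D) {X0 : Set (PP K ι)} :
    vI (Tc g (coneOf X0)) ≤ vI (coneOf (zclosure (imgSet g X0))) := by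
  rw [vI_zclosure]
  exact vI_anti (cone_img_sub hg)

lemma X_tens [IsAlgClosed K] {m D : ℕ} {g : Fin m → MvPolynomial ι K}
    (hg : ∀ j, (g j).IsHomogeneous D) {X0 : Set (PP K ι)}
    (hcl : ∀ v, (∀ p ∈ vI (coneOf X0), MvPolynomial.eval v p = 0) → v ∈ coneOf X0)
    {y : ι × Fin m → K} (hy : y ∈ coneOf (zclosure (imgSet g X0))) (hy0 : y ≠ 0) :
    ∃ v ∈ coneOf X0, ∃ w : Fin m → K, y = tens v w := by
  have hv : ∀ p ∈ vI (Tc g (coneOf X0)), MvPolynomial.eval y p = 0 := fun p hp =>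
    mem_vI.mp (vI_T_le hg hp) y hy
  obtain ⟨⟨i0, j0⟩, h0⟩ := Function.ne_iff.mp hy0
  have h0 : y (i0, j0) ≠ 0 := h0
  refine ⟨fun i => y (i, j0), ?_, fun j => y (i0, j) / y (i0, j0), ?_⟩
  · apply hcl
    intro f hf
    have := hv (MvPolynomial.rename (fun i => (i, j0)) f) (by
      rw [mem_vI]
      rintro _ ⟨v, hv, rfl⟩
      rw [MvPolynomial.eval_rename]
      have h1 := mem_vI.mp hf _ (smul_mem_cone hv (gv g v j0))
      convert h1 using 3
      funext i
      simp [tens, mul_comm])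
    rw [MvPolynomial.eval_rename] at this
    exact this
  · funext ⟨i, j⟩
    have := hv (MvPolynomial.X (i, j) * MvPolynomial.X (i0, j0) -
        MvPolynomial.X (i, j0) * MvPolynomial.X (i0, j)) (by
      rw [mem_vI]
      rintro _ ⟨v, hv, rfl⟩
      simp [tens]; ring)
    simp only [map_sub, map_mul, MvPolynomial.eval_X] at this
    simp only [tens]
    field_simp
    linear_combination this

/-- translation polynomial map -/
lemma vanish_add {σ : Type*} {A B : Set (σ → K)} (hAB : vI A ≤ vI B) (p : MvPolynomial σ K) (z : σ → K)
    (h : ∀ y ∈ A, MvPolynomial.eval (y + z) p = 0) : ∀ y ∈ B, MvPolynomial.eval (y + z) p = 0 := by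
  have key : ∀ y, MvPolynomial.eval y
      (MvPolynomial.bind₁ (fun s => MvPolynomial.X s + MvPolynomial.C (z s)) p) =
      MvPolynomial.eval (y + z) p := by
    intro y
    rw [eval_bind1]
    congr 2
    funext s; simp [pmap]
  have h1 := hAB (mem_vI.mpr fun y hy => (key y).trans (h y hy))
  intro y hy
  rw [← key]
  exact mem_vI.mp h1 y hy

lemma vanish_sum {σ κ : Type*} [Fintype κ] {A B : Set (σ → K)} (hAB : vI A ≤ vI B) (p : MvPolynomial σ K)
    (h : ∀ y : κ → σ → K, (∀ i, y i ∈ A) → MvPolynomial.eval (∑ i, y i) p = 0)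
    (y : κ → σ → K) (hy : ∀ i, y i ∈ B) : MvPolynomial.eval (∑ i, y i) p = 0 := by
  classical
  have key : ∀ S : Finset κ, ∀ y : κ → σ → K, (∀ i ∈ S, y i ∈ B) → (∀ i ∉ S, y i ∈ A) →
      MvPolynomial.eval (∑ i, y i) p = 0 := by
    intro S
    induction S using Finset.induction_on with
    | empty => intro y _ h2; exact h y fun i => h2 i (by simp)
    | insert i S hi ih =>
      intro y h1 h2
      have h3 : ∀ a : σ → K, ∑ j, Function.update y i a j = a + ∑ j ∈ Finset.univ.erase i, y j := by
        intro a
        rw [← Finset.add_sum_erase _ _ (Finset.mem_univ i), Function.update_self]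
        congr 1
        apply Finset.sum_congr rfl
        intro j hj
        rw [Function.update_of_ne (Finset.ne_of_mem_erase hj)]
      rw [← Finset.add_sum_erase _ _ (Finset.mem_univ i)]
      refine vanish_add hAB p _ ?_ _ (h1 i (by simp))
      intro a ha
      rw [← h3]
      apply ih
      · intro j hj
        have : j ≠ i := fun hh => hi (hh ▸ hj)
        rw [Function.update_of_ne this]
        exact h1 j (by simp [hj])
      · intro j hj
        by_cases hji : j = i
        · subst hji; simpa using ha
        · rw [Function.update_of_ne hji]
          exact h2 j (by simp [hj, hji])
  exact key Finset.univ y (fun i _ => hy i) (fun i hi => absurd (Finset.mem_univ i) hi)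


-- Part 13

lemma tens_indep {μ κ : Type*} [Finite κ] {v : κ → ι → K} (hv : LinearIndependent K v)
    {w : κ → μ → K} (hw : ∀ i, w i ≠ 0) : LinearIndependent K (fun i => tens (v i) (w i)) := by
  have := Fintype.ofFinite κ
  rw [Fintype.linearIndependent_iff]
  intro c hc i
  have h := tens_sum_inj hv (w := fun i => c i • w i) (w' := fun _ => 0) (by
    simp only [tens_smul_right]
    rw [hc]
    symm
    apply Finset.sum_eq_zero
    intro i _
    funext p; simp [tens])
  exact (smul_eq_zero.mp (congrFun h i)).resolve_right (hw i)

lemma mk_inj {σ κ : Type*} {t : κ → σ → K} (ht : LinearIndependent K t) :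
    Function.Injective (fun i => Projectivization.mk K (t i) (ht.ne_zero i)) := by
  intro i j hij
  by_contra hne
  rw [Projectivization.mk_eq_mk_iff'] at hij
  obtain ⟨c, hc⟩ := hij
  have h2 := ht.notMem_span_image (s := {j}) (x := i) (by simpa using hne)
  apply h2
  rw [Set.image_singleton, Submodule.mem_span_singleton]
  exact ⟨c, hc⟩

lemma Good.tens {k m : ℕ} {C : Set (ι → K)} {g : Fin m → MvPolynomial ι K}
    {u : Fin k × ι → K} (hu : Good C g u) :
    LinearIndependent K (fun i => ContactLoci.tens (row u i) (gv g (row u i))) :=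
  tens_indep hu.1 (fun i => hu.2.1.ne_zero i)

open Classical in
/-- the decomposition -/
def gset {k m : ℕ} {C : Set (ι → K)} {g : Fin m → MvPolynomial ι K}
    {u : Fin k × ι → K} (hu : Good C g u) : Finset (PP K (ι × Fin m)) :=
  Finset.univ.image (fun i => Projectivization.mk K _ (hu.tens.ne_zero i))

lemma gset_card {k m : ℕ} {C : Set (ι → K)} {g : Fin m → MvPolynomial ι K}
    {u : Fin k × ι → K} (hu : Good C g u) : (gset hu).card = k := by
  classical
  rw [gset, Finset.card_image_of_injective _ (mk_inj hu.tens)]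
  simp

lemma gset_sub {k m : ℕ} {X0 : Set (PP K ι)} {g : Fin m → MvPolynomial ι K}
    {u : Fin k × ι → K} (hu : Good (coneOf X0) g u) (hut : u ∈ tup (coneOf X0) (Fin k)) :
    (gset hu : Set (PP K (ι × Fin m))) ⊆ zclosure (imgSet g X0) := by
  classical
  intro x hx
  simp only [gset, Finset.coe_image, Finset.coe_univ, Set.image_univ, Set.mem_range] at hx
  obtain ⟨i, rfl⟩ := hx
  exact subset_zclosure _ (mk_mem_img (hut i) _)

lemma gset_span {k m : ℕ} {C : Set (ι → K)} {g : Fin m → MvPolynomial ι K}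
    {u : Fin k × ι → K} (hu : Good C g u) :
    pmap (Phi g k) u ∈ vspan (gset hu : Set (PP K (ι × Fin m))) := by
  classical
  rw [pmap_Phi]
  refine Submodule.sum_mem _ fun i _ => Submodule.subset_span ?_
  rw [mem_coneOf_mk (hu.tens.ne_zero i)]
  simp [gset]

lemma good_ne {k m : ℕ} (hk : 1 ≤ k) {C : Set (ι → K)} {g : Fin m → MvPolynomial ι K}
    {u : Fin k × ι → K} (hu : Good C g u) : pmap (Phi g k) u ≠ 0 := by
  rw [pmap_Phi]
  intro h
  have := Fintype.linearIndependent_iff.mp hu.tens (fun _ => 1) (by simpa using h) ⟨0, hk⟩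
  exact one_ne_zero this

lemma vspan_finset {σ : Type*} [Fintype σ] (S : Finset (PP K σ)) :
    vspan (S : Set (PP K σ)) = Submodule.span K (Set.range (fun x : S => x.1.rep)) := by
  apply le_antisymm
  · rw [vspan, Submodule.span_le]
    intro y hy
    rw [mem_coneOf] at hy
    obtain ⟨x, hx, hy⟩ := hy
    rw [Projectivization.submodule_eq, Submodule.mem_span_singleton] at hy
    obtain ⟨c, rfl⟩ := hy
    exact Submodule.smul_mem _ _ (Submodule.subset_span ⟨⟨x, hx⟩, rfl⟩)
  · rw [Submodule.span_le]
    rintro _ ⟨x, rfl⟩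
    exact Submodule.subset_span (rep_mem_cone x.2)

theorem gset_unique [IsAlgClosed K] {k m D : ℕ} {X0 : Set (PP K ι)} {g : Fin m → MvPolynomial ι K}
    (hg : ∀ j, (g j).IsHomogeneous D)
    (hcl : ∀ v, (∀ p ∈ vI (coneOf X0), MvPolynomial.eval v p = 0) → v ∈ coneOf X0)
    {u : Fin k × ι → K} (hu : Good (coneOf X0) g u) 
    (S : Finset (PP K (ι × Fin m))) (hS : (S : Set _) ⊆ zclosure (imgSet g X0)) (hc : S.card ≤ k)
    (hy : pmap (Phi g k) u ∈ vspan (S : Set (PP K (ι × Fin m)))) : S = gset hu := by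
  classical
  rw [vspan_finset, Submodule.mem_span_range_iff_exists_fun] at hy
  obtain ⟨c, hy⟩ := hy
  have h1 : ∀ x : S, ∃ v ∈ coneOf X0, ∃ w : Fin m → K, x.1.rep = tens v w := fun x =>
    X_tens hg hcl (rep_mem_cone (hS x.2)) (Projectivization.rep_nonzero _)
  choose v hv w hvw using h1
  obtain ⟨e, l, hl, h2⟩ := good_core hu v hv (fun x => c x • w x) (by simpa using hc) (by
    rw [← pmap_Phi, ← hy]
    apply Finset.sum_congr rfl
    intro x _
    rw [tens_smul_right, hvw])
  have key : ∀ x : S, x.1 = Projectivization.mk K _ (hu.tens.ne_zero (e x)) := by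
    intro x
    rw [← mem_submodule_iff]
    have : tens (row u (e x)) (gv g (row u (e x))) = c x • x.1.rep := by
      rw [← (h2 x).2, tens_smul_right, ← tens_smul_left, ← (h2 x).1, tens_smul_right, hvw]
    rw [this]
    exact Submodule.smul_mem _ _ (rep_mem_submodule _)
  apply Finset.eq_of_subset_of_card_le
  · intro x hx
    have hk := key ⟨x, hx⟩
    change x = _ at hk
    rw [hk]
    exact Finset.mem_image_of_mem _ (Finset.mem_univ _)
  · rw [gset_card]
    have := Fintype.card_congr e
    simp at this
    omega

theorem sec_vI [IsAlgClosed K] {k m D : ℕ} (hk : 1 ≤ k) {X0 : Set (PP K ι)} {g : Fin m → MvPolynomial ι K}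
    (hg : ∀ j, (g j).IsHomogeneous D) (hC : (vI (coneOf X0)).IsPrime)
    {G : MvPolynomial (Fin k × ι) K} (hG : G ∉ vI (tup (coneOf X0) (Fin k)))
    (hGood : ∀ u ∈ tup (coneOf X0) (Fin k), MvPolynomial.eval u G ≠ 0 → Good (coneOf X0) g u) :
    vI (coneOf (secant k (zclosure (imgSet g X0)))) = vI (pmap (Phi g k) '' tup (coneOf X0) (Fin k)) := by
  have hP : (vI (tup (coneOf X0) (Fin k))).IsPrime := tup_prime hC
  rw [secant, vI_zclosure]
  apply le_antisymm
  · intro p hp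
    rw [vI_image]
    refine (hP.mem_or_mem (x := MvPolynomial.bind₁ (Phi g k) p) (y := G) ?_).resolve_right hG
    rw [mem_vI]
    intro u hu
    rw [map_mul]
    by_cases h : MvPolynomial.eval u G = 0
    · rw [h, mul_zero]
    · have hgu := hGood u hu h
      rw [eval_bind1, mem_vI.mp hp _ ?_, zero_mul]
      rw [mem_coneOf_mk (good_ne hk hgu)]
      refine ⟨gset hgu, gset_sub hgu hu, gset_card hgu, ?_⟩
      change Projectivization.submodule _ ≤ _
      rw [Projectivization.submodule_mk, Submodule.span_singleton_le_iff_mem]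
      exact gset_span hgu
  · intro p hp
    rw [mem_vI]
    intro y hy
    rw [mem_coneOf] at hy
    obtain ⟨q, ⟨S, hS, hc, hq⟩, hy⟩ := hy
    have hy := hq hy
    rw [vspan_finset, Submodule.mem_span_range_iff_exists_fun] at hy
    obtain ⟨c, rfl⟩ := hy
    refine vanish_sum (vI_T_le hg (X0 := X0)) p ?_ _ (fun x => smul_mem_cone (rep_mem_cone (hS x.2)) _)
    intro z hz
    choose v hv hvz using hz
    let e : S ≃ Fin k := Fintype.equivFinOfCardEq (by simpa using hc)
    have : ∑ i, z i = pmap (Phi g k) (fun p => v (e.symm p.1) p.2) := by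
      rw [pmap_Phi, ← e.symm.sum_comp]
      apply Finset.sum_congr rfl
      intro i _
      exact (hvz _).symm
    rw [this]
    exact mem_vI.mp hp _ ⟨fun p => v (e.symm p.1) p.2, fun i => hv (e.symm i), rfl⟩


-- Part 14

lemma tup_vI_le {κ : Type*} [Finite κ] {A B : Set (ι → K)} (hAB : vI A ≤ vI B) :
    vI (tup A κ) ≤ vI (tup B κ) := by
  classical
  have := Fintype.ofFinite κ
  intro p hp
  have key : ∀ S : Finset κ, ∀ w : κ × ι → K, (∀ i ∈ S, row w i ∈ B) → (∀ i ∉ S, row w i ∈ A) →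
      MvPolynomial.eval w p = 0 := by
    intro S
    induction S using Finset.induction_on with
    | empty => intro w _ h2; exact mem_vI.mp hp w fun i => h2 i (by simp)
    | insert i S hi ih =>
      intro w h1 h2
      have h3 : MvPolynomial.bind₁ (slotMap w i) p ∈ vI B := by
        apply hAB
        rw [mem_vI]
        intro x hx
        rw [eval_bind1]
        apply ih
        · intro j hj
          have : j ≠ i := fun hh => hi (hh ▸ hj)
          rw [row_slot_ne _ _ _ this]
          exact h1 j (by simp [hj])
        · intro j hj
          by_cases hji : j = i
          · subst hji; rwa [row_slot_same]
          · rw [row_slot_ne _ _ _ hji]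
            exact h2 j (by simp [hj, hji])
      have h4 := mem_vI.mp h3 _ (h1 i (by simp))
      rwa [eval_bind1, slot_self] at h4
  exact mem_vI.mpr fun w hw => key Finset.univ w (fun i _ => hw i)
    (fun i hi => absurd (Finset.mem_univ i) hi)

/-- quotients are algebraic once coordinates are -/
lemma alg_of_coord {σ B : Type*} {P : Ideal (MvPolynomial σ K)} [P.IsPrime] [CommRing B] [IsDomain B]
    [Algebra K B] [Algebra B (MvPolynomial σ K ⧸ P)]
    [IsScalarTower K B (MvPolynomial σ K ⧸ P)]
    (h : ∀ s, IsAlgebraic B (Ideal.Quotient.mk P (MvPolynomial.X s))) :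
    Algebra.IsAlgebraic B (MvPolynomial σ K ⧸ P) := by
  constructor
  intro a
  obtain ⟨p, rfl⟩ := Ideal.Quotient.mk_surjective a
  induction p using MvPolynomial.induction_on with
  | C c =>
    have : Ideal.Quotient.mk P (MvPolynomial.C c) =
        algebraMap B (MvPolynomial σ K ⧸ P) (algebraMap K B c) := by
      rw [← IsScalarTower.algebraMap_apply]; rfl
    rw [this]
    exact isAlgebraic_algebraMap _
  | add p q hp hq => rw [map_add]; exact hp.add hq
  | mul_X p s hp => rw [map_mul]; exact hp.mul (h s)

/-- inclusion of a factor -/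
def incl {κ : Type*} (C : Set (ι → K)) (i : κ) :
    (MvPolynomial ι K ⧸ vI C) →ₐ[K] (MvPolynomial (κ × ι) K ⧸ vI (tup C κ)) :=
  Ideal.Quotient.liftₐ (vI C) ((Ideal.Quotient.mkₐ K (vI (tup C κ))).comp
    (MvPolynomial.rename (fun a => (i, a)))) (by
      intro a ha
      apply Ideal.Quotient.eq_zero_iff_mem.mpr
      rw [mem_vI]
      intro u hu
      change MvPolynomial.eval u (MvPolynomial.rename (fun a => (i, a)) a) = 0
      rw [MvPolynomial.eval_rename]
      exact mem_vI.mp ha _ (hu i))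

lemma incl_mk {κ : Type*} (C : Set (ι → K)) (i : κ) (p : MvPolynomial ι K) :
    incl C i (Ideal.Quotient.mk _ p) = Ideal.Quotient.mk _ (MvPolynomial.rename (fun a => (i, a)) p) := rfl

lemma incl_inj {κ : Type*} (C : Set (ι → K)) (i : κ) : Function.Injective (incl C i) := by
  rw [injective_iff_map_eq_zero]
  intro a ha
  obtain ⟨p, rfl⟩ := Ideal.Quotient.mk_surjective a
  rw [incl_mk, Ideal.Quotient.eq_zero_iff_mem] at ha
  rw [Ideal.Quotient.eq_zero_iff_mem, mem_vI]
  intro v hv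
  have := mem_vI.mp ha (fun p => v p.2) (fun i => hv)
  rwa [MvPolynomial.eval_rename] at this

lemma mk_aeval {σ τ : Type*} (P : Ideal (MvPolynomial σ K)) (b : τ → MvPolynomial σ K) (p : MvPolynomial τ K) :
    MvPolynomial.aeval (fun t => Ideal.Quotient.mk P (b t)) p
      = Ideal.Quotient.mk P (MvPolynomial.bind₁ b p) := by
  have := map_aeval' (Ideal.Quotient.mkₐ K P) b p
  exact this.symm

theorem td_tup [Infinite K] {C : Set (ι → K)} (hC : (vI C).IsPrime) (k : ℕ) :
    td (vI (tup C (Fin k))) = k * td (vI C) := by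
  have hP : (vI (tup C (Fin k))).IsPrime := tup_prime hC
  obtain ⟨s, hs⟩ := exists_isTranscendenceBasis K (MvPolynomial ι K ⧸ vI C)
  have hc := hs.cardinalMk_eq_trdeg
  have hlt : Algebra.trdeg K (MvPolynomial ι K ⧸ vI C) < Cardinal.aleph0 :=
    trdeg_lt_aleph0_of_finiteType
  have hfin : Finite s := by rw [← Cardinal.lt_aleph0_iff_finite, hc]; exact hlt
  have := Fintype.ofFinite s
  have hcard : td (vI C) = Fintype.card s := by
    unfold td
    rw [← hc]; simp
  choose b hb using fun x : s => Ideal.Quotient.mk_surjective x.1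
  let y : Fin k × s → MvPolynomial (Fin k × ι) K ⧸ vI (tup C (Fin k)) := fun p => incl C p.1 p.2.1
  let B : Fin k × s → MvPolynomial (Fin k × ι) K := fun p =>
    MvPolynomial.rename (fun a => (p.1, a)) (b p.2)
  have hy : ∀ p, y p = Ideal.Quotient.mk _ (B p) := fun p => by
    rw [← incl_mk, hb]
  have hbot : vI (pmap b '' C) ≤ vI Set.univ := by
    intro p hp
    rw [vI_image] at hp
    have h1 := hs.1
    rw [algebraicIndependent_iff] at h1
    have h2 := h1 p (by
      have : (Subtype.val : s → _) = fun x => Ideal.Quotient.mk (vI C) (b x) := by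
        funext x; exact (hb x).symm
      rw [this, mk_aeval, Ideal.Quotient.eq_zero_iff_mem]
      exact hp)
    rw [h2]; exact Ideal.zero_mem _
  have hAI : AlgebraicIndependent K y := by
    rw [algebraicIndependent_iff]
    intro p hp
    have : y = fun p => Ideal.Quotient.mk _ (B p) := funext hy
    rw [this, mk_aeval, Ideal.Quotient.eq_zero_iff_mem, mem_vI] at hp
    have h3 : p ∈ vI (tup (pmap b '' C) (Fin k)) := by
      rw [mem_vI]
      intro w hw
      choose v hv hvw using hw
      have h4 := hp (fun p => v p.1 p.2) (fun i => hv i)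
      rw [eval_bind1] at h4
      convert h4 using 3
      funext ⟨i, x⟩
      have h5 := congrFun (hvw i) x
      change _ = w (i, x) at h5
      rw [← h5]
      simp only [pmap, B, MvPolynomial.eval_rename]
      rfl
    have h6 := tup_vI_le hbot h3
    apply MvPolynomial.funext
    intro w
    rw [map_zero]
    exact mem_vI.mp h6 w (fun i => trivial)
  have hrange : ∀ i, ∀ z ∈ Algebra.adjoin K (Set.range (Subtype.val : s → MvPolynomial ι K ⧸ vI C)),
      incl C i z ∈ Algebra.adjoin K (Set.range y) := by
    intro i z hz
    have : incl C i z ∈ (Algebra.adjoin K (Set.range (Subtype.val : s → MvPolynomial ι K ⧸ vI C))).map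
      (incl C i) := ⟨z, hz, rfl⟩
    rw [AlgHom.map_adjoin] at this
    refine Algebra.adjoin_mono ?_ this
    rintro _ ⟨_, ⟨x, rfl⟩, rfl⟩
    exact ⟨(i, x), rfl⟩
  have halg : Algebra.IsAlgebraic (Algebra.adjoin K (Set.range y))
      (MvPolynomial (Fin k × ι) K ⧸ vI (tup C (Fin k))) := by
    apply alg_of_coord
    rintro ⟨i, a⟩
    have h1 := hs.isAlgebraic.isAlgebraic (Ideal.Quotient.mk _ (MvPolynomial.X a))
    let f : Algebra.adjoin K (Set.range (Subtype.val : s → MvPolynomial ι K ⧸ vI C)) →+*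
        Algebra.adjoin K (Set.range y) :=
      ((incl C i).comp (Subalgebra.val _)).toRingHom.codRestrict _ (fun z => hrange i z z.2)
    have h2 := h1.ringHom_of_comp_eq f (incl C i).toRingHom (by
      intro z w hzw
      have := congrArg Subtype.val hzw
      exact Subtype.ext (incl_inj C i this)) rfl
    have h3 : (incl C i).toRingHom (Ideal.Quotient.mk _ (MvPolynomial.X a)) =
      Ideal.Quotient.mk _ (MvPolynomial.X (i, a)) := by
      change incl C i _ = _
      rw [incl_mk, MvPolynomial.rename_X]
    rwa [h3] at h2
  have hbase := isTranscendenceBasis_iff_algebraicIndependent_isAlgebraic.mpr ⟨hAI, halg⟩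
  have h9 := hbase.lift_cardinalMk_eq_trdeg
  have h10 := congrArg Cardinal.toNat h9
  rw [Cardinal.toNat_lift, Cardinal.toNat_lift] at h10
  rw [hcard]
  unfold td
  rw [← h10]
  simp


-- Part 15

theorem td_image [IsAlgClosed K] {σ τ : Type*} [Finite σ] [Finite τ] (Z : Set (τ → K))
    (hZ : (vI Z).IsPrime) (hcl : ∀ u, (∀ p ∈ vI Z, MvPolynomial.eval u p = 0) → u ∈ Z)
    (Φ : σ → MvPolynomial τ K) (G : MvPolynomial τ K) (hG : G ∉ vI Z)
    (hfin : ∀ u ∈ Z, MvPolynomial.eval u G ≠ 0 → ∀ s : τ,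
      {c | ∃ t ∈ Z, pmap Φ t = pmap Φ u ∧ t s = c}.Finite) :
    td (vI (pmap Φ '' Z)) = td (vI Z) := by
  classical
  have : Infinite K := IsAlgClosed.instInfinite
  have hP : (vI (pmap Φ '' Z)).IsPrime := vI_image_prime Φ hZ
  let f : (MvPolynomial σ K ⧸ vI (pmap Φ '' Z)) →ₐ[K] (MvPolynomial τ K ⧸ vI Z) :=
    Ideal.Quotient.liftₐ _ ((Ideal.Quotient.mkₐ K (vI Z)).comp (MvPolynomial.bind₁ Φ)) (by
      intro a ha
      apply Ideal.Quotient.eq_zero_iff_mem.mpr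
      exact (vI_image Φ Z a).mp ha)
  have hf : ∀ p, f (Ideal.Quotient.mk _ p) = Ideal.Quotient.mk _ (MvPolynomial.bind₁ Φ p) :=
    fun p => rfl
  have hfi : Function.Injective f := by
    rw [injective_iff_map_eq_zero]
    intro a ha
    obtain ⟨p, rfl⟩ := Ideal.Quotient.mk_surjective a
    rw [hf, Ideal.Quotient.eq_zero_iff_mem, ← vI_image] at ha
    exact Ideal.Quotient.eq_zero_iff_mem.mpr ha
  let inst1 : Algebra (MvPolynomial σ K ⧸ vI (pmap Φ '' Z)) (MvPolynomial τ K ⧸ vI Z) :=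
    f.toRingHom.toAlgebra
  have inst2 : IsScalarTower K (MvPolynomial σ K ⧸ vI (pmap Φ '' Z)) (MvPolynomial τ K ⧸ vI Z) :=
    IsScalarTower.of_algebraMap_eq (fun c => (f.commutes c).symm)
  have hfs : FaithfulSMul (MvPolynomial σ K ⧸ vI (pmap Φ '' Z)) (MvPolynomial τ K ⧸ vI Z) :=
    (faithfulSMul_iff_algebraMap_injective _ _).mpr hfi
  have halg : Algebra.IsAlgebraic (MvPolynomial σ K ⧸ vI (pmap Φ '' Z)) (MvPolynomial τ K ⧸ vI Z) := by
    apply alg_of_coord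
    intro s
    by_contra htr
    have htr : Transcendental (MvPolynomial σ K ⧸ vI (pmap Φ '' Z))
      (Ideal.Quotient.mk (vI Z) (MvPolynomial.X s)) := htr
    rw [transcendental_iff] at htr
    let Φ' : Option σ → MvPolynomial τ K := fun o => o.elim (MvPolynomial.X s) Φ
    have hΦ' : ∀ t, pmap Φ' t = fun o => Option.elim o (t s) (pmap Φ t) := by
      intro t; funext o
      cases o <;> simp [pmap, Φ']
    -- coefficients
    have hco : ∀ P ∈ vI (pmap Φ' '' Z), ∀ d,
        (MvPolynomial.optionEquivLeft K σ P).coeff d ∈ vI (pmap Φ '' Z) := by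
      intro P hP d
      rw [← Ideal.Quotient.eq_zero_iff_mem, ← Polynomial.coeff_map]
      rw [htr ((MvPolynomial.optionEquivLeft K σ P).map (Ideal.Quotient.mk _)) ?_, Polynomial.coeff_zero]
      rw [vI_image] at hP
      rw [Polynomial.aeval_def, Polynomial.eval₂_map]
      have hh : (Polynomial.eval₂RingHom ((algebraMap (MvPolynomial σ K ⧸ vI (pmap Φ '' Z))
          (MvPolynomial τ K ⧸ vI Z)).comp (Ideal.Quotient.mk (vI (pmap Φ '' Z))))
          (Ideal.Quotient.mk (vI Z) (MvPolynomial.X s))).comp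
          ((MvPolynomial.optionEquivLeft K σ) : MvPolynomial (Option σ) K →+* _) =
          (Ideal.Quotient.mk (vI Z)).comp ((MvPolynomial.bind₁ Φ') : MvPolynomial (Option σ) K →+* _) := by
        apply MvPolynomial.ringHom_ext
        · intro c
          simp only [RingHom.comp_apply, RingHom.coe_coe, MvPolynomial.optionEquivLeft_C,
            Polynomial.coe_eval₂RingHom, Polynomial.eval₂_C, MvPolynomial.bind₁_C_right]
          change f (Ideal.Quotient.mk _ _) = _
          rw [hf, MvPolynomial.bind₁_C_right]
        · intro o
          cases o with
          | none =>
            simp only [RingHom.comp_apply, RingHom.coe_coe, MvPolynomial.optionEquivLeft_X_none,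
              Polynomial.coe_eval₂RingHom, Polynomial.eval₂_X, MvPolynomial.bind₁_X_right]
            rfl
          | some o =>
            simp only [RingHom.comp_apply, RingHom.coe_coe, MvPolynomial.optionEquivLeft_X_some,
              Polynomial.coe_eval₂RingHom, Polynomial.eval₂_C, MvPolynomial.bind₁_X_right]
            change f (Ideal.Quotient.mk _ _) = _
            rw [hf, MvPolynomial.bind₁_X_right]
            rfl
      have h2 := RingHom.congr_fun hh P
      refine Eq.trans h2 ?_
      exact Ideal.Quotient.eq_zero_iff_mem.mpr hP
    have hZ' : (vI (pmap Φ' '' Z)).IsPrime := vI_image_prime Φ' hZ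
    rcases geomDL (pmap Φ' '' Z) hZ' Φ' (vI Z : Set _) G with ⟨a, ha, h⟩ | ⟨a, ha, h⟩
    · rw [vI_image] at ha
      have : MvPolynomial.bind₁ Φ' a * G ∈ vI Z := by
        rw [mem_vI]
        intro u hu
        rw [map_mul]
        by_cases hGu : MvPolynomial.eval u G = 0
        · rw [hGu, mul_zero]
        · rw [eval_bind1, h u (fun p hp => mem_vI.mp hp u hu) hGu
            (fun p hp => mem_vI.mp hp _ ⟨u, hu, rfl⟩), zero_mul]
      exact (hZ.mem_or_mem this).elim ha hG
    · have hd : ∃ d, (MvPolynomial.optionEquivLeft K σ a).coeff d ∉ vI (pmap Φ '' Z) := by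
        by_contra hno
        push Not at hno
        apply ha
        rw [mem_vI]
        rintro _ ⟨u, hu, rfl⟩
        rw [hΦ', MvPolynomial.optionEquivLeft_elim_eval]
        have : (MvPolynomial.optionEquivLeft K σ a).map (MvPolynomial.eval (pmap Φ u)) = 0 := by
          ext d
          rw [Polynomial.coeff_map, Polynomial.coeff_zero]
          exact mem_vI.mp (hno d) _ ⟨u, hu, rfl⟩
        rw [this, Polynomial.eval_zero]
      obtain ⟨d, hd⟩ := hd
      obtain ⟨_, ⟨u0, hu0, rfl⟩, hd⟩ := notMem_vI.mp hd
      let Q := (MvPolynomial.optionEquivLeft K σ a).map (MvPolynomial.eval (pmap Φ u0))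
      have hQ : Q ≠ 0 := by
        intro hQ
        apply hd
        rw [← Polynomial.coeff_map]
        change Q.coeff d = 0
        rw [hQ, Polynomial.coeff_zero]
      have key : ∀ c, Q.eval c ≠ 0 → ∃ t ∈ Z, MvPolynomial.eval t G ≠ 0 ∧ pmap Φ t = pmap Φ u0 ∧
          t s = c := by
        intro c hc
        obtain ⟨t, ht, htG, hte⟩ := h (fun o => Option.elim o c (pmap Φ u0)) (by
          intro P hP
          rw [MvPolynomial.optionEquivLeft_elim_eval]
          have : (MvPolynomial.optionEquivLeft K σ P).map (MvPolynomial.eval (pmap Φ u0)) = 0 := by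
            ext d
            rw [Polynomial.coeff_map, Polynomial.coeff_zero]
            exact mem_vI.mp (hco P hP d) _ ⟨u0, hu0, rfl⟩
          rw [this, Polynomial.eval_zero]) (by
          rw [MvPolynomial.optionEquivLeft_elim_eval]; exact hc)
        refine ⟨t, hcl t ht, htG, ?_, ?_⟩
        · funext i
          have := congrFun hte (some i)
          rw [hΦ'] at this
          exact this
        · have := congrFun hte none
          rw [hΦ'] at this
          exact this
      have hfr : {c | Q.eval c = 0}.Finite := by
        have := Q.rootSet_finite K
        refine (Q.roots.toFinset.finite_toSet).subset ?_
        intro c hc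
        simp only [Finset.mem_coe, Multiset.mem_toFinset, Polynomial.mem_roots hQ]
        exact hc
      obtain ⟨c0, hc0⟩ := hfr.infinite_compl.nonempty
      obtain ⟨t0, ht0, htG0, hte0, _⟩ := key c0 hc0
      apply hfr.infinite_compl
      refine (hfin t0 ht0 htG0 s).subset ?_
      intro c hc
      obtain ⟨t, ht, _, hte, hts⟩ := key c hc
      exact ⟨t, ht, hte.trans hte0.symm, hts⟩
  have h1 := lift_trdeg_add_eq K (MvPolynomial σ K ⧸ vI (pmap Φ '' Z)) (MvPolynomial τ K ⧸ vI Z)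
  have h2 : Algebra.trdeg (MvPolynomial σ K ⧸ vI (pmap Φ '' Z)) (MvPolynomial τ K ⧸ vI Z) = 0 :=
    trdeg_eq_zero
  rw [h2] at h1
  have h10 := congrArg Cardinal.toNat h1
  simp only [Cardinal.lift_zero, add_zero, Cardinal.toNat_lift] at h10
  exact h10


-- Part 16

lemma fib_fin {k m D : ℕ} {C : Set (ι → K)} {g : Fin m → MvPolynomial ι K}
    (hg : ∀ j, (g j).IsHomogeneous D)
    {u : Fin k × ι → K} (hu : Good C g u) (s : Fin k × ι) :
    {c | ∃ t ∈ tup C (Fin k), pmap (Phi g k) t = pmap (Phi g k) u ∧ t s = c}.Finite := by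
  classical
  have h1 : {l : K | l ^ (D + 1) = 1}.Finite := by
    refine ((Polynomial.nthRootsFinset (D + 1) (1 : K)).finite_toSet).subset ?_
    intro l hl
    simp only [Finset.mem_coe, Polynomial.mem_nthRootsFinset (Nat.succ_pos D)]
    exact hl
  refine ((Set.finite_univ (α := Fin k)).image2 (fun i l => l * u (i, s.2)) h1).subset ?_
  rintro c ⟨t, ht, hte, rfl⟩
  rw [pmap_Phi, pmap_Phi] at hte
  obtain ⟨i, l, hl, h⟩ := good_fib hg hu ht hte.symm s
  exact ⟨i, trivial, l, hl, h.symm⟩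

lemma mem_projSpan_iff {σ : Type*} [Fintype σ] {S : Set (PP K σ)} {q : PP K σ} {y : σ → K} (hy0 : y ≠ 0)
    (hy : y ∈ q.submodule) : q ∈ projSpan S ↔ y ∈ vspan S := by
  rw [mem_submodule_iff hy0] at hy
  subst hy
  change Projectivization.submodule _ ≤ _ ↔ _
  rw [Projectivization.submodule_mk, Submodule.span_singleton_le_iff_mem]

lemma unique_dec [IsAlgClosed K] {k m D : ℕ} (hk : 1 ≤ k) {X0 : Set (PP K ι)} {g : Fin m → MvPolynomial ι K}
    (hg : ∀ j, (g j).IsHomogeneous D)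
    (hcl : ∀ v, (∀ p ∈ vI (coneOf X0), MvPolynomial.eval v p = 0) → v ∈ coneOf X0)
    {u : Fin k × ι → K} (hu : Good (coneOf X0) g u) (hut : u ∈ tup (coneOf X0) (Fin k))
    {q : PP K (ι × Fin m)} (hq : pmap (Phi g k) u ∈ q.submodule) :
    ∃! S : Finset (PP K (ι × Fin m)), S ∈ decompositions (zclosure (imgSet g X0)) q := by
  have hy0 := good_ne hk hu
  have hrank : xrank (zclosure (imgSet g X0)) q = k := by
    unfold xrank
    have hmem : k ∈ {k | ∃ S : Finset (PP K (ι × Fin m)), ↑S ⊆ zclosure (imgSet g X0) ∧ S.card = k ∧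
        q ∈ projSpan (S : Set (PP K (ι × Fin m)))} :=
      ⟨gset hu, gset_sub hu hut, gset_card hu, (mem_projSpan_iff hy0 hq).mpr (gset_span hu)⟩
    apply le_antisymm (Nat.sInf_le hmem)
    obtain ⟨S, hS, hc, hqS⟩ := Nat.sInf_mem ⟨k, hmem⟩
    have hle := Nat.sInf_le hmem
    rw [← hc] at hle ⊢
    have := gset_unique hg hcl hu S hS hle ((mem_projSpan_iff hy0 hq).mp hqS)
    rw [this, gset_card]
  refine ⟨gset hu, ⟨gset_sub hu hut, ?_, (mem_projSpan_iff hy0 hq).mpr (gset_span hu)⟩, ?_⟩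
  · rw [hrank, gset_card]
  · rintro S ⟨hS, hc, hqS⟩
    exact gset_unique hg hcl hu S hS (by rw [hc, hrank]) ((mem_projSpan_iff hy0 hq).mp hqS)

theorem main_aux [IsAlgClosed K] (n : ℕ)
    (X0 : Set (PP K ι)) (hX0 : IsIntegralVariety X0) (hX0nd : Nondegenerate X0)
    (hX0dim : zdim X0 = ((n : ℕ∞) : WithBot ℕ∞))
    (hvs : ¬VeryStrange n X0)
    (m D : ℕ) (g : Fin m → MvPolynomial ι K)
    (hg : ∀ j, (g j).IsHomogeneous D)
    (hgind : LinearIndependent K fun j : Fin m =>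
      (fun v : coneOf X0 => MvPolynomial.eval (v : ι → K) (g j)))
    (k : ℕ) (hk : 1 ≤ k) (hkm : k ≤ m) (hkV : k + n + 2 ≤ Fintype.card ι) :
    zdim (secant k (zclosure (imgSet g X0))) = (((k * n + k - 1 : ℕ) : ℕ∞) : WithBot ℕ∞) ∧
      HoldsGenerically (secant k (zclosure (imgSet g X0))) fun q =>
        ∃! S : Finset (PP K (ι × Fin m)), S ∈ decompositions (zclosure (imgSet g X0)) q := by
  have : Infinite K := IsAlgClosed.instInfinite
  obtain ⟨hne, hC⟩ := irr_iff.mp hX0.2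
  have hcl : ∀ v, (∀ p ∈ vI (coneOf X0), MvPolynomial.eval v p = 0) → v ∈ coneOf X0 :=
    fun v hv => cone_closed hX0.1 hne hv
  have htd : td (vI (coneOf X0)) = n + 1 := by
    have h1 := zdim_eq hX0.1 hX0.2
    rw [hX0dim] at h1
    have h2 := td_pos hX0.2
    have h3 : n = td (vI (coneOf X0)) - 1 := by
      have h4 : (n : ℕ∞) = ((td (vI (coneOf X0)) - 1 : ℕ) : ℕ∞) := WithBot.coe_injective h1
      exact Nat.cast_injective h4
    omega
  obtain ⟨G, hG, hGood⟩ := exists_good hC hcl hX0nd htd hvs g hgind k hk hkm hkV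
  have hP : (vI (tup (coneOf X0) (Fin k))).IsPrime := tup_prime hC
  have hvI := sec_vI hk hg hC hG hGood
  have hZP := vI_image_prime (Phi g k) hP
  obtain ⟨u0, hu0, hGu0⟩ := notMem_vI.mp hG
  have hsecne : (secant k (zclosure (imgSet g X0))).Nonempty := by
    have hgu := hGood u0 hu0 hGu0
    refine ⟨Projectivization.mk K _ (good_ne hk hgu), subset_zclosure _
      ⟨gset hgu, gset_sub hgu hu0, gset_card hgu, ?_⟩⟩
    rw [mem_projSpan_iff (good_ne hk hgu) ((mem_submodule_iff (good_ne hk hgu)).mpr rfl)]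
    exact gset_span hgu
  have hsecc : IsZClosed (secant k (zclosure (imgSet g X0))) := zclosure_isZClosed _
  have hseci : IsZIrreducible (secant k (zclosure (imgSet g X0))) := by
    rw [irr_iff, hvI]; exact ⟨hsecne, hZP⟩
  constructor
  · rw [zdim_eq hsecc hseci, hvI]
    rw [td_image _ hP (fun u hu => tup_closed hcl hu) (Phi g k) G hG
      (fun u hu hGu s => fib_fin hg (hGood u hu hGu) s), td_tup hC, htd, mul_add, mul_one]
    rfl
  · rcases geomDL (pmap (Phi g k) '' tup (coneOf X0) (Fin k)) hZP (Phi g k)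
      (vI (tup (coneOf X0) (Fin k)) : Set _) G with ⟨a, ha, h⟩ | ⟨a, ha, h⟩
    · exfalso
      rw [vI_image] at ha
      have : MvPolynomial.bind₁ (Phi g k) a * G ∈ vI (tup (coneOf X0) (Fin k)) := by
        rw [mem_vI]
        intro u hu
        rw [map_mul]
        by_cases hGu : MvPolynomial.eval u G = 0
        · rw [hGu, mul_zero]
        · rw [eval_bind1, h u (fun p hp => mem_vI.mp hp u hu) hGu
            (fun p hp => mem_vI.mp hp _ ⟨u, hu, rfl⟩), zero_mul]
      exact (hP.mem_or_mem this).elim ha hG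
    · obtain ⟨d, hd⟩ := exists_hom_notMem ha
      refine ⟨zeroLocus {MvPolynomial.homogeneousComponent d a}, ⟨_, ?_, rfl⟩, ?_, ?_⟩
      · intro f hf
        rw [Set.mem_singleton_iff] at hf
        subst hf
        exact ⟨d, MvPolynomial.homogeneousComponent_isHomogeneous d a⟩
      · intro hsub
        apply hd
        rw [← hvI, mem_vI]
        intro v hv
        obtain ⟨x, hx, hvx⟩ := mem_coneOf.mp hv
        exact hsub hx _ rfl v hvx
      · rintro q ⟨hq, hqY⟩
        have hqY' : ∃ v ∈ q.submodule,
            MvPolynomial.eval v (MvPolynomial.homogeneousComponent d a) ≠ 0 := by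
          by_contra hno
          push Not at hno
          apply hqY
          intro f hf v hv
          rw [Set.mem_singleton_iff] at hf
          subst hf
          exact hno v hv
        obtain ⟨v, hv, hva⟩ := hqY'
        have hc : ∃ y ∈ q.submodule, MvPolynomial.eval y a ≠ 0 := by
          by_contra hno
          push Not at hno
          apply hva
          have h1 : a ∈ vI (q.submodule : Set (ι × Fin m → K)) := mem_vI.mpr hno
          exact mem_vI.mp (vI_hom_comp (fun v hv c => q.submodule.smul_mem c hv) h1 d) v hv
        obtain ⟨y, hy, hya⟩ := hc
        obtain ⟨t, ht, htG, rfl⟩ := h y (by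
          intro p hp
          rw [← hvI] at hp
          exact mem_vI.mp hp y (mem_coneOf.mpr ⟨q, hq, hy⟩)) hya
        have htt := tup_closed hcl ht
        exact unique_dec hk hg hcl (hGood t htt htG) htt hy



/-- **Theorem (ii1).**  Let `M` be an integral projective variety of dimension `n`
over an algebraically closed field of arbitrary characteristic, `L`, `R` line
bundles with `L` very ample, and `V ⊆ H⁰(L)` a subspace such that the associated map
`j : M → ℙ^{dim V - 1}` is an embedding with image `X₀` not very strange.  (We work
directly with the embedded image `X₀`, so that `V` is the space of linear forms, of
dimension `card ι`, and `H⁰(R)` is modeled, after twisting by a power `L^D`, by an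
`m`-dimensional space spanned by forms `g 1, …, g m` of degree `D` that are linearly
independent on the cone over `X₀`.)  Fix `k ≤ min {h⁰(R), dim V - n - 2}` and let
`X` be the image of the embedding induced by `W = im (V ⊗ H⁰(R) → H⁰(L ⊗ R))`, i.e.
the closure of the image of `X₀` under `v ↦ (v i * g j (v))_{i,j}`.  Then
`σ_k(X)` has dimension `kn + k - 1` and `#𝒮(q,X) = 1` for a general `q ∈ σ_k(X)`. -/
theorem statement18 {K : Type*} [Field K] [IsAlgClosed K]
    {ι : Type*} [Fintype ι] (n : ℕ)
    (X0 : Set (PP K ι)) (hX0 : IsIntegralVariety X0) (hX0nd : Nondegenerate X0)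
    (hX0dim : zdim X0 = ((n : ℕ∞) : WithBot ℕ∞))
    (hvs : ¬VeryStrange n X0)
    (m D : ℕ) (g : Fin m → MvPolynomial ι K)
    (hg : ∀ j, (g j).IsHomogeneous D)
    (hgind : LinearIndependent K fun j : Fin m =>
      (fun v : coneOf X0 => MvPolynomial.eval (v : ι → K) (g j)))
    (k : ℕ) (hk : 1 ≤ k) (hkm : k ≤ m) (hkV : k + n + 2 ≤ Fintype.card ι)
    (X : Set (PP K (ι × Fin m)))
    (hX : X = zclosure {y : PP K (ι × Fin m) | ∃ v ∈ coneOf X0,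
      y.submodule = Submodule.span K
        ({fun p => v p.1 * MvPolynomial.eval v (g p.2)} : Set (ι × Fin m → K))}) :
    zdim (secant k X) = (((k * n + k - 1 : ℕ) : ℕ∞) : WithBot ℕ∞) ∧
      HoldsGenerically (secant k X) fun q =>
        ∃! S : Finset (PP K (ι × Fin m)), S ∈ decompositions X q := by
  subst hX
  exact main_aux n X0 hX0 hX0nd hX0dim hvs m D g hg hgind k hk hkm hkV

end ContactLoci
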